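/- Let A be a simple, separable, unital C*-algebra with weak complexity rank at most one. Then A has real rank zero. -/

import Mathlib

universe u

/-- A C*-algebra has real rank zero if every self-adjoint element can be approximated in norm
by self-adjoint elements with finite spectrum. -/
def RealRankZero (A : Type u) [CStarAlgebra A] : Prop :=
  ∀ a : A, IsSelfAdjoint a → ∀ ε : ℝ, 0 < ε →
    ∃ b : A, IsSelfAdjoint b ∧ (spectrum ℝ b).Finite ∧ ‖a - b‖ < ε
/-- `a ∈_ε S`: there is `s ∈ S` with `‖a - s‖ < ε`. -/
def MemEps {A : Type u} [CStarAlgebra A] (ε : ℝ) (S : Set A) (a : A) : Prop :=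
  ∃ s ∈ S, ‖a - s‖ < ε

/-- A unital C*-algebra `A` has weak complexity rank at most one: for every finite subset
`X` of `A` and every `ε > 0` there are finite-dimensional C*-subalgebras `C`, `D` of `A` and
a positive contraction `h ∈ A` with `‖[h,x]‖ < ε`, `h x ∈_ε C` and `(1-h) x ∈_ε D` for all
`x ∈ X`. -/
def WeakCRLeOne (A : Type u) [CStarAlgebra A] : Prop :=
  ∀ (X : Finset A) (ε : ℝ), 0 < ε →
    ∃ C D : NonUnitalStarSubalgebra ℂ A,
      FiniteDimensional ℂ C ∧ FiniteDimensional ℂ D ∧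
      ∃ h : A, (∃ x : A, h = star x * x) ∧ ‖h‖ ≤ 1 ∧
        (∀ x ∈ X, ‖h * x - x * h‖ < ε) ∧
        (∀ x ∈ X, MemEps ε (C : Set A) (h * x)) ∧
        (∀ x ∈ X, MemEps ε (D : Set A) ((1 - h) * x))

/-- A C*-algebra is simple if its only closed two-sided ideals are `0` and the whole
algebra. -/
def IsSimpleCStarAlgebra (A : Type u) [CStarAlgebra A] : Prop :=
  ∀ I : TwoSidedIdeal A, IsClosed (I : Set A) → I = ⊥ ∨ I = ⊤

section PartFile1
set_option linter.unusedSectionVars false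
set_option linter.unusedVariables false

section Part1
variable {A : Type*} [CStarAlgebra A] [PartialOrder A] [StarOrderedRing A]

lemma fc_mul {c : A} {f g e : ℝ → ℝ} (hf : ContinuousOn f (spectrum ℝ c))
    (hg : ContinuousOn g (spectrum ℝ c)) (h : ∀ s ∈ spectrum ℝ c, f s * g s = e s) :
    cfc f c * cfc g c = cfc e c := by
  rw [← cfc_mul f g c hf hg]
  exact cfc_congr fun s hs => h s hs

lemma fc_id {c : A} (hc : IsSelfAdjoint c) : cfc (fun s : ℝ => s) c = c := cfc_id' ℝ c

lemma fc_one {c : A} (hc : IsSelfAdjoint c) : cfc (fun _ : ℝ => (1 : ℝ)) c = 1 := cfc_const_one ℝ c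

lemma fc_sa (f : ℝ → ℝ) (c : A) : IsSelfAdjoint (cfc f c) := IsSelfAdjoint.cfc

lemma fc_comm (f g : ℝ → ℝ) (c : A) : cfc f c * cfc g c = cfc g c * cfc f c :=
  (cfc_commute_cfc f g c).eq

lemma fc_comm_self {c : A} (hc : IsSelfAdjoint c) (f : ℝ → ℝ) : cfc f c * c = c * cfc f c := by
  have h := fc_comm f (fun s => s) c
  rwa [fc_id hc] at h

lemma spectrum_Icc {c : A} {a b : ℝ} (h1 : algebraMap ℝ A a ≤ c) (h2 : c ≤ algebraMap ℝ A b)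
    (hc : IsSelfAdjoint c) {s : ℝ} (hs : s ∈ spectrum ℝ c) : a ≤ s ∧ s ≤ b :=
  ⟨(algebraMap_le_iff_le_spectrum (a := c)).1 h1 s hs, (le_algebraMap_iff_spectrum_le (a := c)).1 h2 s hs⟩

lemma spectrum_01 {c : A} (h1 : 0 ≤ c) (h2 : c ≤ 1)
    {s : ℝ} (hs : s ∈ spectrum ℝ c) : 0 ≤ s ∧ s ≤ 1 :=
  spectrum_Icc (by simpa using h1) (by simpa using h2) (IsSelfAdjoint.of_nonneg h1) hs


lemma mul_aeval_mem (C : NonUnitalStarSubalgebra ℂ A) {R : Type*} [CommSemiring R] [Algebra R A]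
    (hR : ∀ (r : R) (x : A), x ∈ C → r • x ∈ C) {c : A}
    (hc : c ∈ C) (p : Polynomial R) : c * Polynomial.aeval c p ∈ C := by
  induction p using Polynomial.induction_on' with
  | add p q hp hq => rw [map_add, mul_add]; exact add_mem hp hq
  | monomial n a =>
    rw [Polynomial.aeval_monomial, ← Algebra.smul_def, mul_smul_comm]
    apply hR
    induction n with
    | zero => simpa using hc
    | succ n ih => rw [pow_succ, ← mul_assoc]; exact mul_mem ih hc

lemma rsmul_mem (C : NonUnitalStarSubalgebra ℂ A) (r : ℝ) {x : A} (hx : x ∈ C) : r • x ∈ C := by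
  have : r • x = (r : ℂ) • x := (Complex.coe_smul r x).symm
  rw [this]
  exact SMulMemClass.smul_mem _ hx

/-- Elements of finite-dimensional subalgebras. -/
lemma fd_finite_spectrum (C : NonUnitalStarSubalgebra ℂ A) [hfd : FiniteDimensional ℂ C] {c : A}
    (hc : c ∈ C) : (spectrum ℝ c).Finite := by
  let T0 : Polynomial ℂ →ₗ[ℂ] A := (LinearMap.mulLeft ℂ c) ∘ₗ (Polynomial.aeval c).toLinearMap
  have hT0 : ∀ p, T0 p ∈ C.toSubmodule := fun p =>
    mul_aeval_mem C (fun r x hx => SMulMemClass.smul_mem _ hx) hc p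
  let T : Polynomial ℂ →ₗ[ℂ] C.toSubmodule := T0.codRestrict _ hT0
  have hninj : ¬ Function.Injective T := by
    intro h
    have : FiniteDimensional ℂ C.toSubmodule := hfd
    have := FiniteDimensional.of_injective T h
    exact Polynomial.not_finite this
  rw [← LinearMap.ker_eq_bot, Submodule.eq_bot_iff] at hninj
  push Not at hninj
  obtain ⟨p, hp, hp0⟩ := hninj
  have hp' : c * Polynomial.aeval c p = 0 := by
    have := congrArg Subtype.val (LinearMap.mem_ker.1 hp)
    exact this
  have hq : Polynomial.aeval c (Polynomial.X * p) = 0 := by simpa using hp'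
  have hq0 : Polynomial.X * p ≠ 0 := mul_ne_zero Polynomial.X_ne_zero hp0
  have hsub : spectrum ℂ c ⊆ ((Polynomial.X * p).roots.toFinset : Set ℂ) := by
    intro z hz
    have h1 := spectrum.subset_polynomial_aeval c (Polynomial.X * p) ⟨z, hz, rfl⟩
    rw [hq] at h1
    have hnt : Nontrivial A := by
      by_contra hn
      rw [not_nontrivial_iff_subsingleton] at hn
      simp [spectrum.of_subsingleton] at hz
    rw [spectrum.zero_eq] at h1
    simp only [Set.mem_singleton_iff] at h1
    simpa [hq0] using (Polynomial.mem_roots hq0).2 h1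
  have hfin : (spectrum ℂ c).Finite := (Finset.finite_toSet _).subset hsub
  rw [← spectrum.preimage_algebraMap ℂ]
  exact hfin.preimage (fun a _ b _ h => by simpa using h)

lemma fin_cont {c : A} (h : (spectrum ℝ c).Finite) (f : ℝ → ℝ) : ContinuousOn f (spectrum ℝ c) :=
  h.continuousOn f

lemma fd_cfc_mem (C : NonUnitalStarSubalgebra ℂ A) [FiniteDimensional ℂ C] {c : A}
    (hc : c ∈ C) (hs : IsSelfAdjoint c) (f : ℝ → ℝ) (f0 : f 0 = 0) : cfc f c ∈ C := by
  classical
  have hfin := fd_finite_spectrum C hc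
  let S : Finset ℝ := insert 0 hfin.toFinset
  let p : Polynomial ℝ := Lagrange.interpolate S id f
  have hev : ∀ s ∈ S, p.eval s = f s := fun s hs =>
    Lagrange.eval_interpolate_at_node (v := id) f (fun a _ b _ h => h) hs
  have h1 : cfc f c = Polynomial.aeval c p := by
    rw [← cfc_polynomial p c]
    apply cfc_congr
    intro s hs
    exact (hev s (by simp [S, hs])).symm
  have hp0 : p.coeff 0 = 0 := by
    rw [Polynomial.coeff_zero_eq_eval_zero, hev 0 (by simp [S]), f0]
  obtain ⟨q, hq⟩ := Polynomial.X_dvd_iff.2 hp0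
  rw [h1, hq, map_mul, Polynomial.aeval_X]
  exact mul_aeval_mem C (fun r x hx => rsmul_mem C r hx) hc q


/-! ### order and norm -/
lemma le_smul_one {x : A} (hx : IsSelfAdjoint x) {r : ℝ} (h : ‖x‖ ≤ r) : x ≤ r • (1 : A) := by
  have h1 := hx.le_algebraMap_norm_self
  have h2 : algebraMap ℝ A ‖x‖ ≤ algebraMap ℝ A r := algebraMap_mono A h
  rw [← Algebra.algebraMap_eq_smul_one]
  exact h1.trans h2

lemma neg_smul_one_le {x : A} (hx : IsSelfAdjoint x) {r : ℝ} (h : ‖x‖ ≤ r) :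
    -(r • (1 : A)) ≤ x := by
  have := le_smul_one hx.neg (r := r) (by simpa using h)
  exact neg_le.1 this

lemma norm_le_of_le {x : A} (hx : IsSelfAdjoint x) {r : ℝ} (hr : 0 ≤ r) (h1 : -(r • (1 : A)) ≤ x)
    (h2 : x ≤ r • (1 : A)) : ‖x‖ ≤ r := by
  conv_lhs => rw [← fc_id hx]
  refine norm_cfc_le hr fun s hs => ?_
  have := spectrum_Icc (a := -r) (b := r) (by simpa [Algebra.algebraMap_eq_smul_one] using h1)
    (by simpa [Algebra.algebraMap_eq_smul_one] using h2) hx hs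
  rw [Real.norm_eq_abs, abs_le]; exact this

lemma norm_le_of_nonneg_le {x : A} (hx : 0 ≤ x) {r : ℝ} (hr : 0 ≤ r)
    (h2 : x ≤ r • (1 : A)) : ‖x‖ ≤ r := by
  refine norm_le_of_le (IsSelfAdjoint.of_nonneg hx) hr (le_trans ?_ hx) h2
  rw [neg_nonpos]; exact smul_nonneg hr zero_le_one

lemma norm_le_one_of {x : A} (hx : 0 ≤ x) (h2 : x ≤ 1) : ‖x‖ ≤ 1 :=
  norm_le_of_nonneg_le hx zero_le_one (by simpa using h2)

lemma rsmul_one_mono {r s : ℝ} (h : r ≤ s) : r • (1 : A) ≤ s • (1 : A) :=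
  smul_le_smul_of_nonneg_right h zero_le_one

lemma conj_le {a x y : A} (h : x ≤ y) : star a * x * a ≤ star a * y * a :=
  star_left_conjugate_le_conjugate h a

lemma conj_le' {a x y : A} (h : x ≤ y) : a * x * star a ≤ a * y * star a :=
  star_right_conjugate_le_conjugate h a

lemma conj_sa_le {a x y : A} (ha : IsSelfAdjoint a) (h : x ≤ y) : a * x * a ≤ a * y * a := by
  have := conj_le (a := a) h
  rwa [ha.star_eq] at this

lemma conj_sa_nonneg {a x : A} (ha : IsSelfAdjoint a) (h : 0 ≤ x) : 0 ≤ a * x * a := by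
  simpa using conj_sa_le ha h

lemma proj_norm_le {p : A} (hp : IsStarProjection p) : ‖p‖ ≤ 1 := norm_le_one_of hp.nonneg hp.le_one

lemma proj_sq {p : A} (hp : IsStarProjection p) : p * p = p := hp.isIdempotentElem
lemma proj_star {p : A} (hp : IsStarProjection p) : star p = p := hp.isSelfAdjoint

lemma proj_conj_le {p x : A} (hp : IsStarProjection p) {r : ℝ} (h : x ≤ r • (1 : A)) :
    p * x * p ≤ r • p := by
  have := conj_sa_le hp.isSelfAdjoint h
  simpa [proj_sq hp] using this

lemma le_proj_conj {p x : A} (hp : IsStarProjection p) {r : ℝ} (h : -(r • (1 : A)) ≤ x) :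
    -(r • p) ≤ p * x * p := by
  have := conj_sa_le hp.isSelfAdjoint h
  simpa [proj_sq hp] using this

/-! ### spectral projections -/
/-- Spectral projection. -/
noncomputable def chi (θ : ℝ) (c : A) : A := cfc (fun s : ℝ => if θ ≤ s then (1 : ℝ) else 0) c
/-- Partial inverse on the spectral projection. -/
noncomputable def pinv (θ : ℝ) (c : A) : A := cfc (fun s : ℝ => if θ ≤ s then s⁻¹ else 0) c

section chi
variable {c : A} {θ : ℝ}

lemma chi_proj (hfin : (spectrum ℝ c).Finite) : IsStarProjection (chi θ c) := by
  refine ⟨?_, fc_sa _ _⟩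
  refine fc_mul (fin_cont hfin _) (fin_cont hfin _) fun s _ => ?_
  split_ifs <;> simp

lemma chi_mem (C : NonUnitalStarSubalgebra ℂ A) [FiniteDimensional ℂ C]
    (hc : c ∈ C) (hs : IsSelfAdjoint c) (hθ : 0 < θ) : chi θ c ∈ C :=
  fd_cfc_mem C hc hs _ (by simp [hθ])

lemma pinv_mem (C : NonUnitalStarSubalgebra ℂ A) [FiniteDimensional ℂ C]
    (hc : c ∈ C) (hs : IsSelfAdjoint c) (hθ : 0 < θ) : pinv θ c ∈ C :=
  fd_cfc_mem C hc hs _ (by simp)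

lemma pinv_mul (hfin : (spectrum ℝ c).Finite) (hs : IsSelfAdjoint c) (hθ : 0 < θ) :
    pinv θ c * c = chi θ c := by
  conv_lhs => rw [← fc_id hs]
  rw [pinv, fc_id hs]
  conv_lhs => enter [2]; rw [← fc_id hs]
  refine fc_mul (fin_cont hfin _) (fin_cont hfin _) fun s _ => ?_
  split_ifs with h
  · exact inv_mul_cancel₀ (by linarith)
  · simp

lemma mul_pinv (hfin : (spectrum ℝ c).Finite) (hs : IsSelfAdjoint c) (hθ : 0 < θ) :
    c * pinv θ c = chi θ c := by
  rw [← pinv_mul hfin hs hθ, pinv, fc_comm_self hs]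

lemma pinv_norm (hθ : 0 < θ) : ‖pinv θ c‖ ≤ θ⁻¹ := by
  refine norm_cfc_le (by positivity) fun s _ => ?_
  split_ifs with h
  · rw [Real.norm_eq_abs, abs_of_nonneg (by have := hθ.trans_le h; positivity)]
    exact inv_anti₀ hθ h
  · simp; positivity

lemma chi_comm (hs : IsSelfAdjoint c) : chi θ c * c = c * chi θ c := fc_comm_self hs _

lemma mul_one_sub_chi (hfin : (spectrum ℝ c).Finite) (hs : IsSelfAdjoint c) :
    c * (1 - chi θ c) = cfc (fun s : ℝ => if θ ≤ s then 0 else s) c := by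
  rw [mul_sub, mul_one, chi]
  conv_lhs => enter [2, 1]; rw [← fc_id hs]
  conv_lhs => enter [1]; rw [← fc_id hs]
  rw [← cfc_mul _ _ c (fin_cont hfin _) (fin_cont hfin _),
    ← cfc_sub _ _ c (fin_cont hfin _) (fin_cont hfin _)]
  refine cfc_congr fun s _ => ?_
  split_ifs <;> simp

lemma norm_mul_one_sub_chi (hfin : (spectrum ℝ c).Finite) (hs : IsSelfAdjoint c) (hθ : 0 ≤ θ)
    (h : -(θ • (1 : A)) ≤ c) : ‖c * (1 - chi θ c)‖ ≤ θ := by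
  rw [mul_one_sub_chi hfin hs]
  refine norm_cfc_le hθ fun s hs' => ?_
  have h1 : -θ ≤ s := (algebraMap_le_iff_le_spectrum (a := c)).1
    (by simpa [Algebra.algebraMap_eq_smul_one] using h) s hs'
  split_ifs with h2
  · simpa using hθ
  · rw [Real.norm_eq_abs, abs_le]; constructor <;> linarith

lemma chi_conj_ge (hfin : (spectrum ℝ c).Finite) (hs : IsSelfAdjoint c) :
    θ • chi θ c ≤ chi θ c * c * chi θ c := by
  have h1 : chi θ c * c * chi θ c = cfc (fun s : ℝ => if θ ≤ s then s else 0) c := by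
    rw [chi_comm hs, mul_assoc, proj_sq (chi_proj hfin), chi]
    conv_lhs => enter [1]; rw [← fc_id hs]
    refine fc_mul (fin_cont hfin _) (fin_cont hfin _) fun s _ => ?_
    split_ifs <;> simp
  rw [h1, chi, ← cfc_smul _ _ _ (fin_cont hfin _)]
  refine cfc_mono (fun s _ => ?_) (fin_cont hfin _) (fin_cont hfin _)
  simp only [smul_eq_mul]
  split_ifs with h <;> simp [h]

lemma chi_anti {θ' : ℝ} (h : θ' ≤ θ) (hfin : (spectrum ℝ c).Finite) :
    chi θ' c * chi θ c = chi θ c := by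
  refine fc_mul (fin_cont hfin _) (fin_cont hfin _) fun s _ => ?_
  by_cases h1 : θ ≤ s
  · simp [h1, h.trans h1]
  · simp [h1]

end chi
end Part1
end PartFile1

section PartFile2
set_option linter.unusedSectionVars false
set_option linter.unusedVariables false
open Filter Topology

section Part2
variable {I : Type*}
section noOrder
variable {A : Type*} [CStarAlgebra A]

/-- Bounded families. -/
def bSub (I A : Type*) [CStarAlgebra A] : StarSubalgebra ℝ (I → A) where
  carrier := {f | ∃ M : ℝ, ∀ i, ‖f i‖ ≤ M}
  mul_mem' := by
    rintro f g ⟨M, hM⟩ ⟨N, hN⟩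
    refine ⟨M * N, fun i => (norm_mul_le _ _).trans ?_⟩
    exact mul_le_mul (hM i) (hN i) (norm_nonneg _) ((norm_nonneg _).trans (hM i))
  add_mem' := by
    rintro f g ⟨M, hM⟩ ⟨N, hN⟩
    exact ⟨M + N, fun i => (norm_add_le _ _).trans (add_le_add (hM i) (hN i))⟩
  algebraMap_mem' := fun r => ⟨‖algebraMap ℝ A r‖, fun i => le_rfl⟩
  star_mem' := by
    rintro f ⟨M, hM⟩
    exact ⟨M, fun i => by simpa using hM i⟩

/-- Type of bounded families. -/
abbrev Bd (I A : Type*) [CStarAlgebra A] := ↥(bSub I A)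

instance : CoeFun (Bd I A) (fun _ => I → A) := ⟨fun f => f.1⟩

lemma Bd.bound (f : Bd I A) : ∃ M : ℝ, 0 < M ∧ ∀ i, ‖f i‖ ≤ M := by
  obtain ⟨M, hM⟩ := f.2
  exact ⟨max M 1, by positivity, fun i => (hM i).trans (le_max_left _ _)⟩

/-- Build a bounded family. -/
def Bd.mk (f : I → A) (M : ℝ) (h : ∀ i, ‖f i‖ ≤ M) : Bd I A := ⟨f, M, h⟩

@[simp] lemma Bd.mk_apply (f : I → A) (M : ℝ) (h : ∀ i, ‖f i‖ ≤ M) (i : I) : (Bd.mk f M h) i = f i := rfl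
@[simp] lemma Bd.mul_apply (f g : Bd I A) (i : I) : (f * g) i = f i * g i := rfl
@[simp] lemma Bd.add_apply (f g : Bd I A) (i : I) : (f + g) i = f i + g i := rfl
@[simp] lemma Bd.sub_apply (f g : Bd I A) (i : I) : (f - g) i = f i - g i := rfl
@[simp] lemma Bd.neg_apply (f : Bd I A) (i : I) : (-f) i = -f i := rfl
@[simp] lemma Bd.smul_apply (r : ℝ) (f : Bd I A) (i : I) : (r • f) i = r • f i := rfl
@[simp] lemma Bd.star_apply (f : Bd I A) (i : I) : (star f) i = star (f i) := rfl
@[simp] lemma Bd.one_apply (i : I) : (1 : Bd I A) i = 1 := rfl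
@[simp] lemma Bd.zero_apply (i : I) : (0 : Bd I A) i = 0 := rfl

/-- constant family -/
def cst (I : Type*) (a : A) : Bd I A := ⟨fun _ => a, ‖a‖, fun _ => le_rfl⟩
@[simp] lemma cst_apply (a : A) (i : I) : (cst I a) i = a := rfl
lemma cst_mul (a b : A) : cst I (a * b) = cst I a * cst I b := rfl
lemma cst_add (a b : A) : cst I (a + b) = cst I a + cst I b := rfl
lemma cst_one : cst I (1 : A) = 1 := rfl
lemma cst_zero : cst I (0 : A) = 0 := rfl
lemma cst_smul (r : ℝ) (a : A) : cst I (r • a) = r • cst I a := rfl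

/-- congruence modulo null families -/
def nullCon (F : Filter I) (A : Type*) [CStarAlgebra A] : RingCon (Bd I A) where
  r f g := Tendsto (fun i => f i - g i) F (𝓝 0)
  iseqv := by
    refine ⟨fun f => by simpa using tendsto_const_nhds, fun {f g} h => ?_, fun {f g e} h1 h2 => ?_⟩
    · simpa using h.neg
    · simpa using h1.add h2
  mul' := by
    intro w x y z h1 h2
    change Tendsto (fun i => w i - x i) F (𝓝 0) at h1
    change Tendsto (fun i => y i - z i) F (𝓝 0) at h2
    change Tendsto (fun i => w i * y i - x i * z i) F (𝓝 0)
    obtain ⟨M, hM0, hM⟩ := Bd.bound y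
    obtain ⟨N, hN0, hN⟩ := Bd.bound x
    have e : (fun i => w i * y i - x i * z i) = fun i => (w i - x i) * y i + x i * (y i - z i) := by
      funext i; noncomm_ring
    rw [e, ← add_zero (0 : A)]
    have b1 : IsBoundedUnder (· ≤ ·) F ((fun x => ‖x‖) ∘ (fun i => y i)) :=
      ⟨M, by simpa using Eventually.of_forall hM⟩
    have b2 : IsBoundedUnder (· ≤ ·) F ((fun x => ‖x‖) ∘ (fun i => x i)) :=
      ⟨N, by simpa using Eventually.of_forall hN⟩
    exact (h1.zero_mul_isBoundedUnder_le b1).add (isBoundedUnder_le_mul_tendsto_zero b2 h2)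
  add' := by
    intro w x y z h1 h2
    change Tendsto (fun i => w i - x i) F (𝓝 0) at h1
    change Tendsto (fun i => y i - z i) F (𝓝 0) at h2
    change Tendsto (fun i => w i + y i - (x i + z i)) F (𝓝 0)
    simpa [add_sub_add_comm] using h1.add h2

end noOrder
variable {A : Type*} [CStarAlgebra A] [PartialOrder A] [StarOrderedRing A]
/-- The asymptotic algebra. -/
abbrev AsA (F : Filter I) (A : Type*) [CStarAlgebra A] := (nullCon F A).Quotient

/-- The quotient map. -/
noncomputable def asy (F : Filter I) : Bd I A →+* AsA F A := (nullCon F A).mk'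

lemma asy_eq {F : Filter I} {f g : Bd I A} :
    asy F f = asy F g ↔ Tendsto (fun i => f i - g i) F (𝓝 0) := RingCon.eq (nullCon F A)

lemma asy_smul {F : Filter I} (r : ℝ) (f : Bd I A) : asy F (r • f) = r • asy F f := rfl

lemma asy_star {F : Filter I} {f g : Bd I A} (h : asy F f = asy F g) :
    asy F (star f) = asy F (star g) := by
  rw [asy_eq] at h ⊢
  simpa using h.star

lemma asy_ev {F : Filter I} {f g : Bd I A} (h : asy F f = asy F g) {η : ℝ} (hη : 0 < η) :
    ∀ᶠ i in F, ‖f i - g i‖ < η := by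
  rw [asy_eq, tendsto_zero_iff_norm_tendsto_zero] at h
  exact h.eventually (gt_mem_nhds hη)

lemma asy_eq_of_le {F : Filter I} {f g : Bd I A} (e : I → ℝ) (he : Tendsto e F (𝓝 0))
    (h : ∀ᶠ i in F, ‖f i - g i‖ ≤ e i) : asy F f = asy F g := by
  rw [asy_eq]
  exact squeeze_zero_norm' h he

/-- continuous functional calculus of a family -/
noncomputable def bcfc (f : ℝ → ℝ) (k : Bd I A) (M : ℝ) (hM : 0 ≤ M)
    (h : ∀ i, ∀ s ∈ spectrum ℝ (k i), ‖f s‖ ≤ M) : Bd I A :=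
  Bd.mk (fun i => cfc f (k i)) M (fun i => norm_cfc_le hM (h i))

lemma poly_comm {F : Filter I} {k x : Bd I A} (h : asy F k * asy F x = asy F x * asy F k)
    (p : Polynomial ℝ) : asy F (Polynomial.aeval k p) * asy F x = asy F x * asy F (Polynomial.aeval k p) := by
  induction p using Polynomial.induction_on' with
  | add p q hp hq => simp only [map_add, add_mul, mul_add, hp, hq]
  | monomial n a =>
    rw [Polynomial.aeval_monomial, ← Algebra.smul_def, asy_smul, map_pow]
    rw [smul_mul_assoc, mul_smul_comm]
    congr 1
    exact (show Commute (asy F k) (asy F x) from h).pow_left n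

lemma aeval_apply (k : Bd I A) (p : Polynomial ℝ) (i : I) :
    (Polynomial.aeval k p) i = Polynomial.aeval (k i) p := by
  let ev : Bd I A →ₐ[ℝ] A := (Pi.evalAlgHom ℝ (fun _ : I => A) i).comp (bSub I A).toSubalgebra.val
  exact (Polynomial.aeval_algHom_apply ev k p).symm

/-- Commutation passes to continuous functions. -/
lemma cfc_asy_comm {F : Filter I} {k x : Bd I A} (h : asy F k * asy F x = asy F x * asy F k)
    (k0 : ∀ i, 0 ≤ k i) (k1 : ∀ i, k i ≤ 1) {f : ℝ → ℝ} (hf : ContinuousOn f (Set.Icc 0 1))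
    {fk : Bd I A} (hfk : ∀ i, fk i = cfc f (k i)) :
    asy F fk * asy F x = asy F x * asy F fk := by
  rw [← map_mul, ← map_mul, asy_eq, Metric.tendsto_nhds]
  intro ε hε
  obtain ⟨M, hM0, hM⟩ := Bd.bound x
  have hη : 0 < ε / (4 * M) := by positivity
  obtain ⟨p, hp⟩ := exists_polynomial_near_of_continuousOn 0 1 f hf _ hη
  have hpc := poly_comm h p
  rw [← map_mul, ← map_mul] at hpc
  filter_upwards [asy_ev hpc (show 0 < ε / 2 by positivity)] with i hi
  rw [dist_zero_right]
  have hsa := IsSelfAdjoint.of_nonneg (k0 i)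
  have hcont : ContinuousOn f (spectrum ℝ (k i)) := hf.mono fun s hs => spectrum_01 (k0 i) (k1 i) hs
  have hd : ‖fk i - (Polynomial.aeval k p) i‖ ≤ ε / (4 * M) := by
    rw [hfk, aeval_apply, ← cfc_polynomial p (k i), ← cfc_sub _ _ _ hcont (by fun_prop)]
    refine norm_cfc_le hη.le fun s hs => ?_
    have := hp s (spectrum_01 (k0 i) (k1 i) hs)
    rw [Real.norm_eq_abs, abs_sub_comm]; exact this.le
  set P := (Polynomial.aeval k p) i with hP
  have e : (fk * x) i - (x * fk) i = (fk i - P) * x i + (P * x i - x i * P) - x i * (fk i - P) := by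
    simp only [Bd.mul_apply]; noncomm_ring
  rw [e]
  have hi' : ‖P * x i - x i * P‖ < ε / 2 := hi
  have n1 : ‖(fk i - P) * x i‖ ≤ ε / 4 := by
    refine (norm_mul_le _ _).trans ((mul_le_mul hd (hM i) (norm_nonneg _) hη.le).trans ?_)
    apply le_of_eq; field_simp
  have n2 : ‖x i * (fk i - P)‖ ≤ ε / 4 := by
    refine (norm_mul_le _ _).trans ((mul_le_mul (hM i) hd (norm_nonneg _) hM0.le).trans ?_)
    apply le_of_eq; field_simp
  have := norm_sub_le ((fk i - P) * x i + (P * x i - x i * P)) (x i * (fk i - P))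
  have := norm_add_le ((fk i - P) * x i) (P * x i - x i * P)
  linarith

end Part2
end PartFile2

section PartFile3
set_option linter.unusedSectionVars false
set_option linter.unusedVariables false
open Filter Topology

section Part3
variable {A : Type*} [CStarAlgebra A] [PartialOrder A] [StarOrderedRing A]
variable {I : Type*}

/-- A half model along a filter. -/
structure HMS (F : Filter I) (C : I → NonUnitalStarSubalgebra ℂ A) (k : Bd I A)
    (L : A → Bd I A) : Prop where
  fd : ∀ i, FiniteDimensional ℂ (C i)
  kmem : ∀ i, k i ∈ C i
  k0 : ∀ i, 0 ≤ k i
  k1 : ∀ i, k i ≤ 1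
  Lmem : ∀ a i, L a i ∈ C i
  Lnorm : ∀ a i, ‖L a i‖ ≤ ‖a‖ + 1
  Lstar : ∀ a i, star (L a i) = L (star a) i
  comm : ∀ a, asy F k * asy F (cst I a) = asy F (cst I a) * asy F k
  Lk : ∀ a, asy F (L a) = asy F k * asy F (cst I a)

lemma clamp_close {c h : A} (hc : IsSelfAdjoint c) (h0 : 0 ≤ h) (h1 : h ≤ 1) :
    ‖cfc (fun s : ℝ => max 0 (min s 1)) c - c‖ ≤ ‖c - h‖ := by
  set r := ‖c - h‖ with hr
  have hsa : IsSelfAdjoint (c - h) := hc.sub (IsSelfAdjoint.of_nonneg h0)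
  have u := le_smul_one hsa (le_refl r)
  have l := neg_smul_one_le hsa (le_refl r)
  have u' : c ≤ algebraMap ℝ A (1 + r) := by
    rw [Algebra.algebraMap_eq_smul_one, add_smul, one_smul]
    have := add_le_add h1 u
    simpa using this
  have l' : algebraMap ℝ A (-r) ≤ c := by
    rw [Algebra.algebraMap_eq_smul_one, neg_smul]
    have := add_le_add h0 l
    simpa using this
  conv_lhs => enter [1, 2]; rw [← fc_id hc]
  rw [← cfc_sub _ _ c (by fun_prop) (by fun_prop)]
  have r0 : 0 ≤ r := norm_nonneg _
  refine norm_cfc_le r0 fun s hs => ?_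
  obtain ⟨h2, h3⟩ := spectrum_Icc l' u' hc hs
  rw [Real.norm_eq_abs, abs_le]
  rcases le_total s 1 with h4 | h4
  · rw [min_eq_left h4]
    rcases le_total 0 s with h5 | h5
    · rw [max_eq_right h5]; constructor <;> linarith
    · rw [max_eq_left h5]; constructor <;> linarith
  · rw [min_eq_right h4, max_eq_right zero_le_one]; constructor <;> linarith

open Classical in
lemma half_model {F : Filter I} (C : I → NonUnitalStarSubalgebra ℂ A)
    (fd : ∀ i, FiniteDimensional ℂ (C i)) (h : Bd I A) (h0 : ∀ i, 0 ≤ h i) (h1 : ∀ i, h i ≤ 1)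
    (hcomm : ∀ a, asy F h * asy F (cst I a) = asy F (cst I a) * asy F h)
    (e : I → ℝ) (he : Tendsto e F (𝓝 0)) (he1 : ∀ i, e i ≤ 1) (he0 : ∀ i, 0 < e i)
    (hmem : ∀ a, ∀ᶠ i in F, ∃ c ∈ C i, ‖h i * a - c‖ < e i) :
    ∃ k L, HMS F C k L ∧ asy F k = asy F h := by
  let c0 : A → I → A := fun a i =>
    if hx : ∃ c ∈ C i, ‖h i * a - c‖ < e i then hx.choose else 0
  have c0mem : ∀ a i, c0 a i ∈ C i := by
    intro a i
    simp only [c0]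
    split_ifs with hx
    · exact hx.choose_spec.1
    · exact zero_mem _
  have c0close : ∀ a i, (∃ c ∈ C i, ‖h i * a - c‖ < e i) → ‖h i * a - c0 a i‖ < e i := by
    intro a i hx
    simp only [c0, dif_pos hx]
    exact hx.choose_spec.2
  have c0zero : ∀ a i, (∃ c ∈ C i, ‖h i * a - c‖ < e i) ∨ c0 a i = 0 := by
    intro a i
    by_cases hx : ∃ c ∈ C i, ‖h i * a - c‖ < e i
    · exact Or.inl hx
    · exact Or.inr (by simp only [c0, dif_neg hx])
  clear_value c0
  have hn : ∀ i, ‖h i‖ ≤ 1 := fun i => norm_le_one_of (h0 i) (h1 i)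
  have c0n : ∀ a i, ‖c0 a i‖ ≤ ‖a‖ + 1 := by
    intro a i
    rcases c0zero a i with hx | hx
    · have h2 := c0close a i hx
      have h3 : ‖h i * a‖ ≤ ‖a‖ := (norm_mul_le _ _).trans (mul_le_of_le_one_left (norm_nonneg _) (hn i))
      have h4 := norm_sub_norm_le (c0 a i) (h i * a)
      rw [norm_sub_rev] at h4
      linarith [he1 i]
    · rw [hx, norm_zero]; positivity
  let L : A → Bd I A := fun a => Bd.mk (fun i => (1 / 2 : ℝ) • (c0 a i + star (c0 (star a) i))) (‖a‖ + 1) (by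
    intro i
    rw [norm_smul]
    have := norm_add_le (c0 a i) (star (c0 (star a) i))
    have h2 := c0n a i
    have h3 := c0n (star a) i
    rw [norm_star] at this h3
    norm_num
    linarith)
  have Lmem : ∀ a i, L a i ∈ C i := fun a i =>
    rsmul_mem _ _ (add_mem (c0mem a i) (star_mem (c0mem _ i)))
  have Lstar : ∀ a i, star (L a i) = L (star a) i := by
    intro a i
    change star ((1 / 2 : ℝ) • (c0 a i + star (c0 (star a) i))) =
      (1 / 2 : ℝ) • (c0 (star a) i + star (c0 (star (star a)) i))
    rw [star_smul, star_add, star_star, star_star, add_comm, star_trivial]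
  have Lk : ∀ a, asy F (L a) = asy F h * asy F (cst I a) := by
    intro a
    have hc := hcomm a
    rw [← map_mul, ← map_mul, asy_eq, tendsto_zero_iff_norm_tendsto_zero] at hc
    rw [← map_mul]
    refine asy_eq_of_le (fun i => e i + ‖(h * cst I a) i - (cst I a * h) i‖) (by simpa using he.add hc) ?_
    filter_upwards [hmem a, hmem (star a)] with i hi1 hi2
    have n1 := c0close _ _ hi1
    have n2 := c0close _ _ hi2
    have n3 : ‖a * h i - star (c0 (star a) i)‖ < e i := by
      rw [← norm_star]; simpa [(IsSelfAdjoint.of_nonneg (h0 i)).star_eq] using n2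
    have eq : L a i - (h * cst I a) i = (1 / 2 : ℝ) • (-(h i * a - c0 a i) - (a * h i - star (c0 (star a) i))
        - (h i * a - a * h i)) := by
      have e2 : h i * a = (1/2:ℝ) • (h i * a + h i * a) := by
        rw [← two_smul ℝ, smul_smul]; norm_num
      simp only [L, Bd.mk_apply, Bd.mul_apply, cst_apply]
      conv_lhs => rw [e2]
      rw [← smul_sub]; congr 1; abel
    rw [eq, norm_smul]
    simp only [Bd.mul_apply, cst_apply]
    have t1 := norm_sub_le (-(h i * a - c0 a i) - (a * h i - star (c0 (star a) i))) (h i * a - a * h i)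
    have t2 := norm_sub_le (-(h i * a - c0 a i)) (a * h i - star (c0 (star a) i))
    rw [norm_neg] at t2
    rw [Real.norm_of_nonneg (by norm_num : (0 : ℝ) ≤ 1 / 2)]
    have := norm_nonneg (h i * a - a * h i)
    linarith
  have L1sa : ∀ i, IsSelfAdjoint (L 1 i) := fun i => by
    rw [isSelfAdjoint_iff, Lstar, star_one]
  let k : Bd I A := bcfc (fun s : ℝ => max 0 (min s 1)) (L 1) 1 zero_le_one (by
    intro i s _
    rw [Real.norm_eq_abs, abs_of_nonneg (le_max_left _ _)]
    exact max_le zero_le_one (min_le_right _ _))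
  have hkL : asy F k = asy F (L 1) := by
    have h2 := Lk 1
    rw [cst_one, map_one, mul_one, asy_eq, tendsto_zero_iff_norm_tendsto_zero] at h2
    exact asy_eq_of_le _ h2 (Eventually.of_forall fun i => clamp_close (L1sa i) (h0 i) (h1 i))
  have hkh : asy F k = asy F h := by rw [hkL, Lk 1, cst_one, map_one, mul_one]
  refine ⟨k, L, ⟨fd, ?_, ?_, ?_, Lmem, ?_, Lstar, ?_, ?_⟩, hkh⟩
  · intro i
    have := fd i
    exact fd_cfc_mem (C i) (Lmem 1 i) (L1sa i) _ (by simp)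
  · intro i
    exact cfc_nonneg fun s _ => le_max_left _ _
  · intro i
    exact cfc_le_one _ _ fun s _ => max_le zero_le_one (min_le_right _ _)
  · intro a i
    obtain ⟨M, hM⟩ := (L a).2
    change ‖(1 / 2 : ℝ) • (c0 a i + star (c0 (star a) i))‖ ≤ _
    rw [norm_smul]
    have := norm_add_le (c0 a i) (star (c0 (star a) i))
    have h2 := c0n a i
    have h3 := c0n (star a) i
    rw [norm_star] at this h3
    norm_num
    linarith
  · intro a; rw [hkh]; exact hcomm a
  · intro a; rw [hkh]; exact Lk a

end Part3

section Part3b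
variable {A : Type u} [CStarAlgebra A] [PartialOrder A] [StarOrderedRing A]

/-- A model: two half models. -/
structure MDL {I : Type u} (F : Filter I) (C D : I → NonUnitalStarSubalgebra ℂ A) (k l : Bd I A)
    (L M : A → Bd I A) : Prop where
  hC : HMS F C k L
  hD : HMS F D l M
  sum : asy F k + asy F l = 1

lemma exists_model (hw : WeakCRLeOne A) : ∃ (I : Type u) (F : Ultrafilter I)
    (C D : I → NonUnitalStarSubalgebra ℂ A) (k l : Bd I A) (L M : A → Bd I A),
    MDL (F : Filter I) C D k l L M := by
  let I := Finset A × ℕ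
  classical
  have hne : (atTop : Filter I).NeBot := atTop_neBot
  let F : Ultrafilter I := Ultrafilter.of atTop
  have hF : (F : Filter I) ≤ atTop := Ultrafilter.of_le (atTop : Filter I)
  have hpos : ∀ i : I, 0 < (1 / ((i.2 : ℝ) + 1)) := fun i => by positivity
  choose C D hfC hfD h hp hn hcomm hmC hmD using fun i : I => hw i.1 (1 / ((i.2 : ℝ) + 1)) (hpos i)
  have h0 : ∀ i, 0 ≤ h i := fun i => by
    obtain ⟨x, hx⟩ := hp i; rw [hx]; exact star_mul_self_nonneg x
  have h1 : ∀ i, h i ≤ 1 := fun i => by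
    have := le_smul_one (IsSelfAdjoint.of_nonneg (h0 i)) (hn i); simpa using this
  let hB : Bd I A := Bd.mk h 1 hn
  let hB' : Bd I A := Bd.mk (fun i => 1 - h i) 1 fun i => norm_le_one_of (sub_nonneg.2 (h1 i)) (by simpa using h0 i)
  have hB'eq : hB' = 1 - hB := by ext i; rfl
  have hev : ∀ a, ∀ᶠ i : I in (F : Filter I), a ∈ i.1 := fun a => by
    apply hF
    filter_upwards [eventually_ge_atTop (({a}, 0) : I)] with i hi
    exact hi.1 (by simp)
  have he : Tendsto (fun i : I => 1 / ((i.2 : ℝ) + 1)) F (𝓝 0) := by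
    refine (Tendsto.comp (tendsto_one_div_add_atTop_nhds_zero_nat (𝕜 := ℝ)) ?_).mono_left hF
    have : (atTop : Filter I) = atTop ×ˢ atTop := by rw [prod_atTop_atTop_eq]
    rw [this]; exact tendsto_snd
  have he1 : ∀ i : I, 1 / ((i.2 : ℝ) + 1) ≤ 1 := fun i => by
    rw [div_le_one (by positivity)]; linarith [Nat.cast_nonneg (α := ℝ) i.2]
  have hc : ∀ a, asy (F : Filter I) hB * asy F (cst I a) = asy F (cst I a) * asy F hB := by
    intro a
    rw [← map_mul, ← map_mul]
    refine asy_eq_of_le _ he ?_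
    filter_upwards [hev a] with i hi
    exact (hcomm i a hi).le
  obtain ⟨k, L, hkL, hk⟩ := half_model (F := (F : Filter I)) C hfC hB h0 h1 hc _ he he1 hpos (by
    intro a; filter_upwards [hev a] with i hi; exact hmC i a hi)
  obtain ⟨l, M, hlM, hl⟩ := half_model (F := (F : Filter I)) D hfD hB' (fun i => sub_nonneg.2 (h1 i))
    (fun i => sub_le_self _ (h0 i)) (by
      intro a; rw [hB'eq, map_sub, map_one, sub_mul, mul_sub, hc a, one_mul, mul_one]) _ he he1 hpos (by
    intro a; filter_upwards [hev a] with i hi; exact hmD i a hi)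
  refine ⟨I, F, C, D, k, l, L, M, hkL, hlM, ?_⟩
  rw [hk, hl, hB'eq, map_sub, map_one]; abel

end Part3b
end PartFile3

section PartFile4
set_option linter.unusedSectionVars false
set_option linter.unusedVariables false
open Filter Topology

section Part4
variable {A : Type*} [CStarAlgebra A] [PartialOrder A] [StarOrderedRing A]

/-- Traces on a subalgebra. -/
structure FDTr (C : NonUnitalStarSubalgebra ℂ A) (t : A →ₗ[ℝ] ℝ) : Prop where
  pos : ∀ x ∈ C, 0 ≤ x → 0 ≤ t x
  tr : ∀ x ∈ C, ∀ y ∈ C, t (x * y) = t (y * x)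
  st : ∀ x ∈ C, t (star x) = t x

lemma pi_mul {u : A} (h : IsStarProjection (u * star u)) : u * star u * u = u := by
  have h1 : (1 - u * star u) * u * star ((1 - u * star u) * u) = 0 := by
    have h2 : (1 - u * star u) * (u * star u) = 0 := h.one_sub_mul_self
    rw [star_mul]
    calc _ = (1 - u * star u) * (u * star u) * star (1 - u * star u) := by simp only [mul_assoc]
      _ = 0 := by rw [h2, zero_mul]
  have h3 := (CStarRing.mul_star_self_eq_zero_iff _).1 h1
  rw [sub_mul, one_mul, sub_eq_zero] at h3
  exact h3.symm

lemma pi_star {u : A} (h : IsStarProjection (u * star u)) : IsStarProjection (star u * u) := by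
  refine ⟨?_, IsSelfAdjoint.star_mul_self u⟩
  have := pi_mul h
  change star u * u * (star u * u) = _
  calc _ = star u * (u * star u * u) := by simp only [mul_assoc]
    _ = _ := by rw [this]

lemma chi_ne_zero {m : A} (hm : 0 ≤ m) (h0 : m ≠ 0) (hfin : (spectrum ℝ m).Finite) :
    chi (‖m‖ / 2) m ≠ 0 := by
  intro h
  have hn : 0 < ‖m‖ := norm_pos_iff.2 h0
  have hsa := IsSelfAdjoint.of_nonneg hm
  have := norm_mul_one_sub_chi (θ := ‖m‖ / 2) hfin hsa (by positivity) (le_trans (by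
    rw [neg_nonpos]; exact smul_nonneg (by positivity) zero_le_one) hm)
  rw [h, sub_zero, mul_one] at this
  linarith

lemma polar_exists (C : NonUnitalStarSubalgebra ℂ A) [FiniteDimensional ℂ C] {w : A} (hw : w ∈ C)
    (hw0 : w ≠ 0) : ∃ u ∈ C, IsStarProjection (u * star u) ∧ u * star u ≠ 0 ∧
      (∀ p, p * w = w → p * u = u) ∧ (∀ q, w * q = w → u * q = u) := by
  set m := w * star w with hm
  have hm0 : 0 ≤ m := mul_star_self_nonneg w
  have hmne : m ≠ 0 := fun h => hw0 ((CStarRing.mul_star_self_eq_zero_iff _).1 h)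
  have hsa := IsSelfAdjoint.of_nonneg hm0
  have hmC : m ∈ C := mul_mem hw (star_mem hw)
  have hfin := fd_finite_spectrum C hmC
  set θ := ‖m‖ / 2
  have hθ : 0 < θ := by have := norm_pos_iff.2 hmne; positivity
  set e := cfc (fun s : ℝ => if θ ≤ s then (Real.sqrt s)⁻¹ else 0) m with he
  have heC : e ∈ C := fd_cfc_mem C hmC hsa _ (by simp)
  have heme : e * m * e = chi θ m := by
    have h1 : e * m = cfc (fun s : ℝ => if θ ≤ s then (Real.sqrt s)⁻¹ * s else 0) m := by
      conv_lhs => enter [2]; rw [← fc_id hsa]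
      refine fc_mul (fin_cont hfin _) (fin_cont hfin _) fun s _ => ?_
      split_ifs <;> simp
    rw [h1]
    refine fc_mul (fin_cont hfin _) (fin_cont hfin _) fun s _ => ?_
    split_ifs with h
    · have hs : 0 < s := hθ.trans_le h
      have h2 := Real.mul_self_sqrt hs.le
      have h3 : 0 < Real.sqrt s := Real.sqrt_pos.2 hs
      field_simp
      nlinarith
    · simp
  have hce : chi θ m * e = e := by
    refine fc_mul (fin_cont hfin _) (fin_cont hfin _) fun s _ => ?_
    split_ifs <;> simp
  have hesa : star e = e := (fc_sa _ _)
  have huu : (e * w) * star (e * w) = chi θ m := by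
    rw [star_mul, hesa, ← heme, hm]; simp only [mul_assoc]
  refine ⟨e * w, mul_mem heC hw, ?_, ?_, ?_, ?_⟩
  · rw [huu]; exact chi_proj hfin
  · rw [huu]; exact chi_ne_zero hm0 hmne hfin
  · intro p hp
    have h1 : p * m = m := by rw [hm, ← mul_assoc, hp]
    have h2 : p * chi θ m = chi θ m := by
      rw [← mul_pinv hfin hsa hθ, ← mul_assoc, h1]
    rw [← mul_assoc, ← hce, ← mul_assoc, h2]
  · intro q hq; rw [mul_assoc, hq]

lemma fd_trace_exists (C : NonUnitalStarSubalgebra ℂ A) [FiniteDimensional ℂ C] {p q : A}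
    (hp : p ∈ C) (hq : q ∈ C) (pp : IsStarProjection p) (pq : IsStarProjection q) (hp0 : p ≠ 0)
    (hpq : ∀ x ∈ C, p * x * q = 0) : ∃ t : A →ₗ[ℝ] ℝ, FDTr C t ∧ t q < t p := by
  let P : C := ⟨p, hp⟩
  let T : C → Module.End ℂ C := fun x => (LinearMap.mulLeft ℂ x) * (LinearMap.mulRight ℂ P)
  have hTapp : ∀ x v, T x v = x * (v * P) := fun x v => rfl
  let τ : C → ℂ := fun x => LinearMap.trace ℂ C (T x)
  have τadd : ∀ x y, τ (x + y) = τ x + τ y := by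
    intro x y
    have : T (x + y) = T x + T y := by ext v; simp [hTapp, add_mul]
    simp only [τ]
    rw [this, map_add]
  have τsmul : ∀ (c : ℝ) x, τ (c • x) = c • τ x := by
    intro c x
    have : T (c • x) = (c : ℂ) • T x := by ext v; simp [hTapp]
    simp only [τ]
    rw [this, map_smul]; simp
  have hcomm : ∀ x, LinearMap.mulLeft ℂ x * LinearMap.mulRight ℂ P
      = LinearMap.mulRight ℂ P * LinearMap.mulLeft ℂ x := by
    intro x; ext v; simp [mul_assoc]
  have τtr : ∀ x y, τ (x * y) = τ (y * x) := by
    intro x y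
    have h1 : ∀ x y, T (x * y) = LinearMap.mulLeft ℂ x * (LinearMap.mulLeft ℂ y * LinearMap.mulRight ℂ P) := by
      intro x y; ext v; simp [hTapp, mul_assoc]
    simp only [τ]
    rw [h1, LinearMap.trace_mul_comm, h1, mul_assoc, hcomm]
  have τproj : ∀ e : C, e * e = e → ∃ n : ℕ, τ e = n ∧ (T e ≠ 0 → n ≠ 0) := by
    intro e he
    have hid : IsIdempotentElem (T e) := by
      change T e * T e = T e
      ext v
      have hPP : P * P = P := Subtype.ext (proj_sq pp)
      have : e * (e * (v * P) * P) = e * (v * P) := by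
        calc _ = (e * e) * v * (P * P) := by simp only [mul_assoc]
          _ = _ := by rw [he, hPP, mul_assoc]
      simpa [hTapp] using congrArg Subtype.val this
    refine ⟨_, LinearMap.IsProj.trace ((LinearMap.isProj_range_iff_isIdempotentElem _).2 hid), ?_⟩
    intro h h2
    exact h (LinearMap.range_eq_bot.1 (Submodule.finrank_eq_zero.1 h2))
  let t0 : C →ₗ[ℝ] ℝ :=
    { toFun := fun x => (τ x).re + (τ (star x)).re
      map_add' := by intro x y; simp only [star_add, τadd, Complex.add_re]; ring
      map_smul' := by
        intro c x
        have : star (c • x) = c • star x := by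
          ext; simp
        rw [this, τsmul, τsmul]; simp; ring }
  have ht0 : ∀ x, t0 x = (τ x).re + (τ (star x)).re := fun x => rfl
  obtain ⟨t, ht⟩ := LinearMap.exists_extend (K := ℝ) (p := C.toSubmodule.restrictScalars ℝ) t0
  have htx : ∀ x (hx : x ∈ C), t x = t0 ⟨x, hx⟩ := by
    intro x hx
    have := LinearMap.congr_fun ht (⟨x, hx⟩ : C.toSubmodule.restrictScalars ℝ)
    exact this
  have hproj : ∀ e ∈ C, IsStarProjection e → 0 ≤ t e := by
    intro e he pe
    rw [htx e he, ht0]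
    have : star (⟨e, he⟩ : C) = ⟨e, he⟩ := Subtype.ext (proj_star pe)
    rw [this]
    obtain ⟨n, hn, -⟩ := τproj ⟨e, he⟩ (Subtype.ext (proj_sq pe))
    rw [hn]; simp
  refine ⟨t, ⟨?_, ?_, ?_⟩, ?_⟩
  · intro x hx hx0
    have hsa := IsSelfAdjoint.of_nonneg hx0
    have hfin := fd_finite_spectrum C hx
    have hsum : x = ∑ r ∈ hfin.toFinset.erase 0, r • cfc (fun s : ℝ => if s = r then (1 : ℝ) else 0) x := by
      conv_lhs => rw [← fc_id hsa]
      rw [Finset.sum_congr rfl (fun r _ => (cfc_smul r (fun s : ℝ => if s = r then (1 : ℝ) else 0) x (fin_cont hfin _)).symm)]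
      rw [← cfc_sum _ x _ (fun _ _ => fin_cont hfin _)]
      refine cfc_congr fun s hs => ?_
      simp only [Finset.sum_apply, smul_eq_mul, mul_ite, mul_one, mul_zero]
      rw [Finset.sum_ite_eq]
      by_cases h : s = 0
      · simp [h]
      · rw [if_pos]; simp [h, hs]
    rw [hsum, map_sum]
    refine Finset.sum_nonneg fun r hr => ?_
    rw [map_smul]
    simp only [Finset.mem_erase, Set.Finite.mem_toFinset] at hr
    refine mul_nonneg (spectrum_nonneg_of_nonneg hx0 hr.2) (hproj _ (fd_cfc_mem C hx hsa _ (by simp [Ne.symm hr.1])) ⟨?_, fc_sa _ _⟩)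
    refine fc_mul (fin_cont hfin _) (fin_cont hfin _) fun s _ => ?_
    split_ifs <;> simp
  · intro x hx y hy
    rw [htx _ (mul_mem hx hy), htx _ (mul_mem hy hx), ht0, ht0]
    have e1 : (⟨x * y, mul_mem hx hy⟩ : C) = ⟨x, hx⟩ * ⟨y, hy⟩ := rfl
    have e2 : (⟨y * x, mul_mem hy hx⟩ : C) = ⟨y, hy⟩ * ⟨x, hx⟩ := rfl
    rw [e1, e2, star_mul, star_mul, τtr, τtr (star _)]
  · intro x hx
    rw [htx _ hx, htx _ (star_mem hx), ht0, ht0]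
    have e1 : (⟨star x, star_mem hx⟩ : C) = star ⟨x, hx⟩ := rfl
    rw [e1, star_star, add_comm]
  · have sp : star P = P := Subtype.ext (proj_star pp)
    let Q : C := ⟨q, hq⟩
    have sq : star Q = Q := Subtype.ext (proj_star pq)
    rw [htx _ hp, htx _ hq, ht0, ht0]
    change (τ Q).re + (τ (star Q)).re < (τ P).re + (τ (star P)).re
    rw [sp, sq]
    have hQ : T Q = 0 := by
      ext v
      have h1 := congrArg star (hpq _ (star_mem v.2))
      have h2 : q * (v * p) = 0 := by
        simpa [mul_assoc, proj_star pp, proj_star pq] using h1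
      exact h2
    obtain ⟨n, hn, hn0⟩ := τproj P (Subtype.ext (proj_sq pp))
    have h3 : T P ≠ 0 := by
      intro h
      have := congrArg Subtype.val (LinearMap.congr_fun h P)
      have h4 : p * (p * p) = 0 := this
      rw [proj_sq pp, proj_sq pp] at h4
      exact hp0 h4
    have := hn0 h3
    have hQ' : τ Q = 0 := by simp only [τ]; rw [hQ, map_zero]
    rw [hn, hQ']
    have : 0 < (n : ℝ) := by positivity
    simpa using this

/-- Dimension of the right ideal `pC`. -/
noncomputable def rk (C : NonUnitalStarSubalgebra ℂ A) (p : A) : ℕ :=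
  Module.finrank ℂ (C.toSubmodule ⊓ LinearMap.ker (LinearMap.mulLeft ℂ p - LinearMap.id) : Submodule ℂ A)

lemma rk_lt (C : NonUnitalStarSubalgebra ℂ A) [hfd : FiniteDimensional ℂ C] {p e : A}
    (hpe : p * e = e) (hep : e * p = e) (he : e ∈ C) (pe : IsStarProjection e) (he0 : e ≠ 0) :
    rk C (p - e) < rk C p := by
  have : FiniteDimensional ℂ C.toSubmodule := hfd
  have : FiniteDimensional ℂ (C.toSubmodule ⊓ LinearMap.ker (LinearMap.mulLeft ℂ p - LinearMap.id) : Submodule ℂ A) :=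
    Submodule.finiteDimensional_of_le (inf_le_left : _ ≤ C.toSubmodule)
  refine Submodule.finrank_lt_finrank_of_lt (lt_of_le_of_ne ?_ ?_)
  · rintro x ⟨hx, hx2⟩
    refine ⟨hx, ?_⟩
    have h1 : (p - e) * x = x := by simpa [sub_eq_zero] using hx2
    have h2 : e * x = 0 := by
      rw [← h1, ← mul_assoc, mul_sub, hep, proj_sq pe, sub_self, zero_mul]
    have h3 : p * x = x := by rw [sub_mul, h2, sub_zero] at h1; exact h1
    simp [h3]
  · intro h
    have h1 : e ∈ (C.toSubmodule ⊓ LinearMap.ker (LinearMap.mulLeft ℂ p - LinearMap.id) : Submodule ℂ A) :=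
      ⟨he, by simp [hpe]⟩
    rw [← h] at h1
    have h2 : (p - e) * e = e := by simpa [sub_eq_zero] using h1.2
    rw [sub_mul, hpe, proj_sq pe, sub_self] at h2
    exact he0 h2.symm

lemma proj_mul_star {p e : A} (pp : IsStarProjection p) (pe : IsStarProjection e)
    (h : p * e = e) : e * p = e := by
  have := congrArg star h
  simpa [proj_star pp, proj_star pe] using this

lemma proj_sub {p e : A} (pp : IsStarProjection p) (pe : IsStarProjection e)
    (h : p * e = e) : IsStarProjection (p - e) := by
  have h2 := proj_mul_star pp pe h
  refine ⟨?_, pp.isSelfAdjoint.sub pe.isSelfAdjoint⟩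
  change (p - e) * (p - e) = p - e
  rw [mul_sub, sub_mul, sub_mul, h, h2, proj_sq pp, proj_sq pe]; abel

lemma fd_compare (C : NonUnitalStarSubalgebra ℂ A) [hfd : FiniteDimensional ℂ C] (n : ℕ) :
    ∀ {p q : A}, p ∈ C → q ∈ C → IsStarProjection p → IsStarProjection q → rk C p ≤ n →
    (∃ u ∈ C, u * star u = p ∧ u * q = u) ∨ ∃ t : A →ₗ[ℝ] ℝ, FDTr C t ∧ t q < t p := by
  induction n using Nat.strong_induction_on with
  | _ n ih =>
    intro p q hp hq pp pq hn
    by_cases hp0 : p = 0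
    · exact Or.inl ⟨0, zero_mem _, by simp [hp0], by simp⟩
    by_cases hz : ∀ x ∈ C, p * x * q = 0
    · exact Or.inr (fd_trace_exists C hp hq pp pq hp0 hz)
    push Not at hz
    obtain ⟨x, hx, hne⟩ := hz
    obtain ⟨u, hu, pu, hu0, hup, huq⟩ := polar_exists C (mul_mem (mul_mem hp hx) hq) hne
    have h1 : p * u = u := hup p (by rw [← mul_assoc, ← mul_assoc, proj_sq pp])
    have h2 : u * q = u := huq q (by rw [mul_assoc, proj_sq pq])
    set e := u * star u with he
    set f := star u * u with hf
    have pf : IsStarProjection f := pi_star pu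
    have hpe : p * e = e := by rw [he, ← mul_assoc, h1]
    have hfq : f * q = f := by rw [hf, mul_assoc, h2]
    have hep := proj_mul_star pp pu hpe
    have hqf : q * f = f := by
      have := congrArg star hfq
      simpa [proj_star pq, proj_star pf] using this
    have heC : e ∈ C := mul_mem hu (star_mem hu)
    have hfC : f ∈ C := mul_mem (star_mem hu) hu
    have hlt := rk_lt C hpe hep heC pu hu0
    rcases ih (rk C (p - e)) (lt_of_lt_of_le hlt hn) (sub_mem hp heC) (sub_mem hq hfC)
      (proj_sub pp pu hpe) (proj_sub pq pf hqf) le_rfl with ⟨v, hv, hvv, hvq⟩ | ⟨t, ht, hlt⟩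
    · left
      have huf : u * f = u := by rw [hf, ← mul_assoc]; exact pi_mul pu
      have hfu : f * star u = star u := by
        have := congrArg star huf
        simpa [proj_star pf] using this
      have hvf : v * f = 0 := by
        rw [← hvq, mul_assoc, sub_mul, hqf, proj_sq pf, sub_self, mul_zero]
      have hvu : v * star u = 0 := by rw [← hfu, ← mul_assoc, hvf, zero_mul]
      have huv : u * star v = 0 := by
        have := congrArg star hvu
        simpa using this
      refine ⟨u + v, add_mem hu hv, ?_, ?_⟩
      · rw [star_add, mul_add, add_mul, add_mul, hvu, huv, hvv, ← he]; abel
      · have : v * q = v := by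
          conv_lhs => rw [← hvq]
          rw [mul_assoc, sub_mul, proj_sq pq, hfq, hvq]
        rw [add_mul, h2, this]
    · right
      refine ⟨t, ht, ?_⟩
      have : t e = t f := ht.tr u hu _ (star_mem hu)
      rw [map_sub, map_sub, this] at hlt
      linarith

/-- compression bound for traces -/
lemma fdtr_conj_le {C : NonUnitalStarSubalgebra ℂ A} {t : A →ₗ[ℝ] ℝ} (ht : FDTr C t) {p x : A}
    (hp : p ∈ C) (pp : IsStarProjection p) (hx : x ∈ C) : |t (p * x * p)| ≤ ‖x‖ * t p := by
  set y := (1 / 2 : ℝ) • (x + star x) with hy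
  have hyC : y ∈ C := rsmul_mem _ _ (add_mem hx (star_mem hx))
  have hysa : IsSelfAdjoint y := by
    rw [isSelfAdjoint_iff, hy, star_smul, star_add, star_star, add_comm, star_trivial]
  have hyn : ‖y‖ ≤ ‖x‖ := by
    rw [hy, norm_smul, Real.norm_of_nonneg (by norm_num : (0 : ℝ) ≤ 1 / 2)]
    have := norm_add_le x (star x)
    rw [norm_star] at this; linarith
  have h1 : t (p * x * p) = t (p * y * p) := by
    have h2 : t (p * star x * p) = t (p * x * p) := by
      rw [← ht.st _ (mul_mem (mul_mem hp hx) hp)]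
      simp [proj_star pp, mul_assoc]
    have h3 : p * y * p = (1 / 2 : ℝ) • (p * x * p + p * star x * p) := by
      rw [hy]; simp [mul_add, add_mul]
    rw [h3, map_smul, map_add, h2]; simp; ring
  have hpyp : p * y * p ∈ C := mul_mem (mul_mem hp hyC) hp
  have u := proj_conj_le pp (le_smul_one hysa hyn)
  have l := le_proj_conj pp (neg_smul_one_le hysa hyn)
  have u' := ht.pos _ (sub_mem (rsmul_mem C ‖x‖ hp) hpyp) (sub_nonneg.2 u)
  have l' := ht.pos _ (add_mem hpyp (rsmul_mem C ‖x‖ hp)) (by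
    have := sub_nonneg.2 l; rwa [sub_neg_eq_add] at this)
  rw [map_sub, map_smul, smul_eq_mul] at u'
  rw [map_add, map_smul, smul_eq_mul] at l'
  rw [h1, abs_le]; constructor <;> linarith

end Part4
end PartFile4

section PartFile5
set_option linter.unusedSectionVars false
set_option linter.unusedVariables false
open Filter Topology

section Part5
variable {A : Type*} [CStarAlgebra A] [PartialOrder A] [StarOrderedRing A]

/-- Positive tracial functionals. -/
structure IsTr (t : A →ₗ[ℝ] ℝ) : Prop where
  pos : ∀ x, 0 ≤ x → 0 ≤ t x
  tr : ∀ x y, t (x * y) = t (y * x)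
  st : ∀ x, t (star x) = t x

lemma IsTr.mono {t : A →ₗ[ℝ] ℝ} (ht : IsTr t) {x y : A} (h : x ≤ y) : t x ≤ t y := by
  have := ht.pos _ (sub_nonneg.2 h)
  rw [map_sub] at this; linarith

lemma IsTr.one_nonneg {t : A →ₗ[ℝ] ℝ} (ht : IsTr t) : 0 ≤ t 1 := ht.pos _ zero_le_one

lemma IsTr.conj_le {t : A →ₗ[ℝ] ℝ} (ht : IsTr t) (w x : A) :
    |t (star w * x * w)| ≤ ‖x‖ * t (star w * w) := by
  set y := (1 / 2 : ℝ) • (x + star x) with hy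
  have hysa : IsSelfAdjoint y := by
    rw [isSelfAdjoint_iff, hy, star_smul, star_add, star_star, add_comm, star_trivial]
  have hyn : ‖y‖ ≤ ‖x‖ := by
    rw [hy, norm_smul, Real.norm_of_nonneg (by norm_num : (0 : ℝ) ≤ 1 / 2)]
    have := norm_add_le x (star x)
    rw [norm_star] at this; linarith
  have h1 : t (star w * x * w) = t (star w * y * w) := by
    have h2 : t (star w * star x * w) = t (star w * x * w) := by
      rw [← ht.st (star w * x * w)]
      simp [mul_assoc]
    have h3 : star w * y * w = (1 / 2 : ℝ) • (star w * x * w + star w * star x * w) := by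
      rw [hy]; simp [mul_add, add_mul]
    rw [h3, map_smul, map_add, h2]; simp; ring
  have u := ht.mono (_root_.conj_le (a := w) (le_smul_one hysa hyn))
  have l := ht.mono (_root_.conj_le (a := w) (neg_smul_one_le hysa hyn))
  simp only [mul_smul_comm, smul_mul_assoc, mul_one, mul_neg, neg_mul, map_neg, map_smul, smul_eq_mul] at u l
  rw [h1, abs_le]; constructor <;> linarith

lemma IsTr.abs_le {t : A →ₗ[ℝ] ℝ} (ht : IsTr t) (x : A) : |t x| ≤ ‖x‖ * t 1 := by
  simpa using ht.conj_le 1 x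

lemma IsTr.le_norm {t : A →ₗ[ℝ] ℝ} (ht : IsTr t) (x : A) : t x ≤ ‖x‖ * t 1 :=
  (le_abs_self _).trans (ht.abs_le x)

lemma IsTr.conj_sa_le {t : A →ₗ[ℝ] ℝ} (ht : IsTr t) {w : A} (hw : IsSelfAdjoint w) (x : A) :
    t (w * x * w) ≤ ‖x‖ * t (w * w) := by
  have := (le_abs_self _).trans (ht.conj_le w x)
  rwa [hw.star_eq] at this

lemma simple_sum (hs : IsSimpleCStarAlgebra A) {y : A} (hy : y ≠ 0) :
    ∃ (n : ℕ) (a b : Fin n → A), 1 = ∑ i, a i * y * b i := by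
  let f : A × A → A := fun z => z.1 * y * z.2
  let J : Set A := {x | ∃ l : List (A × A), x = (l.map f).sum}
  have J0 : (0 : A) ∈ J := ⟨[], by simp⟩
  have Jadd : ∀ x ∈ J, ∀ z ∈ J, x + z ∈ J := by
    rintro x ⟨l, rfl⟩ z ⟨l', rfl⟩
    exact ⟨l ++ l', by simp⟩
  have Jl : ∀ c, ∀ x ∈ J, c * x ∈ J := by
    rintro c x ⟨l, rfl⟩
    refine ⟨l.map fun z => (c * z.1, z.2), ?_⟩
    rw [List.map_map, ← List.sum_map_mul_left]
    simp [f, Function.comp_def, mul_assoc]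
  have Jr : ∀ c, ∀ x ∈ J, x * c ∈ J := by
    rintro c x ⟨l, rfl⟩
    refine ⟨l.map fun z => (z.1, z.2 * c), ?_⟩
    rw [List.map_map, ← List.sum_map_mul_right]
    simp [f, Function.comp_def, mul_assoc]
  have Jneg : ∀ x ∈ J, -x ∈ J := fun x hx => by
    have := Jl (-1) x hx; simpa using this
  let K : TwoSidedIdeal A := TwoSidedIdeal.mk' (closure J) (subset_closure J0)
    (fun {x z} hx hz => map_mem_closure₂ continuous_add hx hz Jadd)
    (fun {x} hx => map_mem_closure continuous_neg hx Jneg)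
    (fun {x z} hz => map_mem_closure (continuous_const_mul x) hz (Jl x))
    (fun {x z} hx => map_mem_closure (f := fun w => w * z) (continuous_mul_const z) hx (Jr z))
  have hK : (K : Set A) = closure J := by
    ext x; simp [K]
  have yJ : y ∈ J := ⟨[(1, 1)], by simp [f]⟩
  rcases hs K (by rw [hK]; exact isClosed_closure) with h | h
  · exfalso
    have : y ∈ (K : Set A) := by rw [hK]; exact subset_closure yJ
    rw [h] at this
    exact hy (by simpa using this)
  · have h1 : (1 : A) ∈ closure J := by
      rw [← hK, h]; simp
    obtain ⟨x, hx, hd⟩ := Metric.mem_closure_iff.1 h1 1 one_pos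
    rw [dist_eq_norm] at hd
    have hu : IsUnit x := by
      have := isUnit_one_sub_of_norm_lt_one hd
      simpa using this
    obtain ⟨u, hu⟩ := hu
    have h2 : (1 : A) ∈ J := by
      have := Jl (↑u⁻¹ : A) x hx
      rwa [← hu, Units.inv_mul] at this
    obtain ⟨l, hl⟩ := h2
    refine ⟨l.length, fun i => (l.get i).1, fun i => (l.get i).2, ?_⟩
    rw [hl]
    rw [← List.sum_ofFn]
    congr 1
    exact (List.ofFn_getElem_eq_map l f).symm

lemma simple_tr_lower (hs : IsSimpleCStarAlgebra A) {y : A} (hy0 : 0 ≤ y) (hy : y ≠ 0) :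
    ∃ κ > 0, ∀ t : A →ₗ[ℝ] ℝ, IsTr t → κ * t 1 ≤ t y := by
  obtain ⟨n, a, b, h1⟩ := simple_sum hs hy
  set w := CFC.sqrt y with hw
  have hww : w * w = y := CFC.sqrt_mul_sqrt_self y
  have hwsa : IsSelfAdjoint w := IsSelfAdjoint.of_nonneg (CFC.sqrt_nonneg y)
  set S := ∑ i, ‖b i * a i‖ with hS
  have hS0 : 0 ≤ S := Finset.sum_nonneg fun i _ => norm_nonneg _
  refine ⟨(1 + S)⁻¹, by positivity, fun t ht => ?_⟩
  have h2 : t 1 ≤ S * t y := by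
    rw [h1, map_sum, hS, Finset.sum_mul]
    refine Finset.sum_le_sum fun i _ => ?_
    have e1 : a i * y * b i = (a i * w) * (w * b i) := by rw [← hww]; simp only [mul_assoc]
    have e2 : (w * b i) * (a i * w) = w * (b i * a i) * w := by simp only [mul_assoc]
    rw [e1, ht.tr, e2, ← hww]
    exact ht.conj_sa_le hwsa _
  have h3 := ht.pos y hy0
  rw [inv_mul_le_iff₀ (by positivity)]
  nlinarith

end Part5
end PartFile5

section PartFile6
set_option linter.unusedSectionVars false
set_option linter.unusedVariables false
open Filter Topology

/-- Cut-off function. -/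
noncomputable def phi (t s : ℝ) : ℝ := max 0 (min (2 * s / t - 1) 1)

lemma phi_cont (t : ℝ) : Continuous (phi t) := by unfold phi; fun_prop
lemma phi_nonneg (t s : ℝ) : 0 ≤ phi t s := le_max_left _ _
lemma phi_le_one (t s : ℝ) : phi t s ≤ 1 := max_le zero_le_one (min_le_right _ _)
lemma phi_eq_zero {t s : ℝ} (ht : 0 < t) (h : s ≤ t / 2) : phi t s = 0 := by
  refine max_eq_left (le_trans (min_le_left _ _) ?_)
  have : 2 * s / t ≤ 1 := by rw [div_le_one ht]; linarith
  linarith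
lemma phi_eq_one {t s : ℝ} (ht : 0 < t) (h : t ≤ s) : phi t s = 1 := by
  have : 2 ≤ 2 * s / t := by rw [le_div_iff₀ ht]; linarith
  unfold phi
  rw [min_eq_right (by linarith), max_eq_right zero_le_one]
lemma phi_mul_phi {t t' s : ℝ} (ht : 0 < t) (ht' : 0 < t') (h : t' ≤ t / 2) : phi t' s * phi t s = phi t s := by
  rcases le_total s (t / 2) with h1 | h1
  · rw [phi_eq_zero ht h1, mul_zero]
  · rw [phi_eq_one ht' (h.trans h1), one_mul]
lemma phi_ge {t s : ℝ} (ht : 0 < t) (hs : s ≤ 1) : s - t ≤ phi t s := by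
  rcases le_total s t with h | h
  · linarith [phi_nonneg t s]
  · rw [phi_eq_one ht h]; linarith
lemma phi_comp_le {t s : ℝ} (ht : 0 < t) (hs : 0 ≤ s) : s * (1 - phi t s) ≤ t := by
  rcases le_total s t with h | h
  · nlinarith [phi_nonneg t s]
  · rw [phi_eq_one ht h]; linarith
lemma phi_anti {t t' s : ℝ} (ht' : 0 < t') (h : t' ≤ t) (hs : 0 ≤ s) : phi t s ≤ phi t' s := by
  unfold phi
  have : 2 * s / t ≤ 2 * s / t' := by gcongr
  gcongr

section Part6
variable {A : Type*} [CStarAlgebra A] [PartialOrder A] [StarOrderedRing A]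
variable {I : Type*}

lemma trace_E_bound {C : NonUnitalStarSubalgebra ℂ A} {t : A →ₗ[ℝ] ℝ} (ht : FDTr C t) {n : ℕ}
    {a b : Fin n → A} {E P U c : A} (ha : ∀ j, a j ∈ C) (hb : ∀ j, b j ∈ C) (hE : E ∈ C) (hP : P ∈ C)
    (hU : U ∈ C) (hc : c ∈ C) (pE : IsStarProjection E) (pP : IsStarProjection P)
    {δ B S : ℝ} (hδ : ‖c - c * P‖ ≤ δ) (hc2 : ‖c‖ ≤ 2) (hB : ‖U‖ ≤ B)
    (hS : ∑ j, ‖a j‖ * ‖b j‖ ≤ S) (hBS : B * S * δ ≤ 1 / 4)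
    (hX : ‖E - ∑ j, U * a j * c * b j‖ ≤ 1 / 4) : t E ≤ 4 * B * S * t P := by
  have hB0 : 0 ≤ B := (norm_nonneg _).trans hB
  have hδ0 : 0 ≤ δ := (norm_nonneg _).trans hδ
  have tE := ht.pos E hE pE.nonneg
  have tP := ht.pos P hP pP.nonneg
  have hXC : ∑ j, U * a j * c * b j ∈ C := sum_mem fun j _ =>
    mul_mem (mul_mem (mul_mem hU (ha j)) hc) (hb j)
  set X := ∑ j, U * a j * c * b j with hXd
  have hX1C : ∀ j, U * a j * (c * P) * b j ∈ C := fun j =>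
    mul_mem (mul_mem (mul_mem hU (ha j)) (mul_mem hc hP)) (hb j)
  set X1 := ∑ j, U * a j * (c * P) * b j with hX1
  set X2 := ∑ j, U * a j * (c - c * P) * b j with hX2
  have hX2C : X2 ∈ C := sum_mem fun j _ =>
    mul_mem (mul_mem (mul_mem hU (ha j)) (sub_mem hc (mul_mem hc hP))) (hb j)
  have h12 : X = X1 + X2 := by
    rw [hXd, hX1, hX2, ← Finset.sum_add_distrib]
    refine Finset.sum_congr rfl fun j _ => ?_
    noncomm_ring
  have nX2 : ‖X2‖ ≤ 1 / 4 := by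
    refine le_trans ?_ hBS
    calc ‖X2‖ ≤ ∑ j, ‖U * a j * (c - c * P) * b j‖ := norm_sum_le _ _
      _ ≤ ∑ j, B * (‖a j‖ * ‖b j‖) * δ := by
        refine Finset.sum_le_sum fun j _ => ?_
        calc _ ≤ ‖U‖ * ‖a j‖ * ‖c - c * P‖ * ‖b j‖ := by
              refine (norm_mul_le _ _).trans ?_
              gcongr
              refine (norm_mul_le _ _).trans ?_
              gcongr
              exact norm_mul_le _ _
          _ ≤ B * ‖a j‖ * δ * ‖b j‖ := by gcongr
          _ = _ := by ring
      _ = B * (∑ j, ‖a j‖ * ‖b j‖) * δ := by rw [← Finset.sum_mul, ← Finset.mul_sum]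
      _ ≤ _ := by gcongr
  have e1 : t E = t (E * (E - X) * E) + t (E * X1 * E) + t (E * X2 * E) := by
    rw [← map_add, ← map_add]; congr 1
    rw [h12, mul_sub, sub_mul, proj_sq pE, proj_sq pE, mul_add, add_mul]; abel
  have b1 := (le_abs_self _).trans (fdtr_conj_le ht hE pE (sub_mem hE hXC))
  have b2 := (le_abs_self _).trans (fdtr_conj_le ht hE pE hX2C)
  have b3 : t (E * X1 * E) ≤ 2 * B * S * t P := by
    rw [hX1, Finset.mul_sum, Finset.sum_mul, map_sum]
    calc _ ≤ ∑ j, 2 * B * (‖a j‖ * ‖b j‖) * t P := by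
          refine Finset.sum_le_sum fun j _ => ?_
          have e : t (E * (U * a j * (c * P) * b j) * E) = t (P * (b j * E * E * U * a j * c) * P) := by
            have h1 : E * (U * a j * (c * P) * b j) * E = (E * U * a j * c * P) * (P * b j * E) := by
              rw [show (E * U * a j * c * P) * (P * b j * E) = E * U * a j * c * (P * P) * b j * E by
                simp only [mul_assoc], proj_sq pP]
              simp only [mul_assoc]
            rw [h1, ht.tr _ (mul_mem (mul_mem (mul_mem (mul_mem hE hU) (ha j)) hc) hP) _
              (mul_mem (mul_mem hP (hb j)) hE)]
            simp only [mul_assoc]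
          rw [e]
          refine ((le_abs_self _).trans (fdtr_conj_le ht hP pP (mul_mem (mul_mem (mul_mem (mul_mem (mul_mem (hb j) hE) hE) hU) (ha j)) hc))).trans ?_
          refine mul_le_mul_of_nonneg_right ?_ tP
          calc _ ≤ ‖b j‖ * ‖E‖ * ‖E‖ * ‖U‖ * ‖a j‖ * ‖c‖ := by
                refine (norm_mul_le _ _).trans ?_
                gcongr
                refine (norm_mul_le _ _).trans ?_
                gcongr
                refine (norm_mul_le _ _).trans ?_
                gcongr
                refine (norm_mul_le _ _).trans ?_
                gcongr
                exact norm_mul_le _ _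
            _ ≤ ‖b j‖ * 1 * 1 * B * ‖a j‖ * 2 := by
                have := proj_norm_le pE
                gcongr
            _ = _ := by ring
      _ = 2 * B * (∑ j, ‖a j‖ * ‖b j‖) * t P := by rw [← Finset.sum_mul, ← Finset.mul_sum]
      _ ≤ _ := by gcongr
  have b1' : ‖E - X‖ * t E ≤ 1 / 4 * t E := by gcongr
  have b2' : ‖X2‖ * t E ≤ 1 / 4 * t E := by gcongr
  linarith

/-- `L y` is asymptotically `√y k √y`. -/
lemma HMS.Lsqrt {F : Filter I} {C : I → NonUnitalStarSubalgebra ℂ A} {k : Bd I A} {L : A → Bd I A}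
    (H : HMS F C k L) {y : A} (hy : 0 ≤ y) :
    asy F (L y) = asy F (cst I (CFC.sqrt y) * k * cst I (CFC.sqrt y)) := by
  rw [H.Lk, map_mul, map_mul, ← H.comm, mul_assoc, ← map_mul (asy F) (cst I _), ← cst_mul, CFC.sqrt_mul_sqrt_self y]

lemma HMS.Lsa {F : Filter I} {C : I → NonUnitalStarSubalgebra ℂ A} {k : Bd I A} {L : A → Bd I A}
    (H : HMS F C k L) {y : A} (hy : IsSelfAdjoint y) (i : I) : IsSelfAdjoint (L y i) := by
  rw [isSelfAdjoint_iff, H.Lstar, hy.star_eq]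

lemma HMS.bounds {F : Filter I} {C : I → NonUnitalStarSubalgebra ℂ A} {k : Bd I A} {L : A → Bd I A}
    (H : HMS F C k L) {y : A} (hy : 0 ≤ y) {η : ℝ} (hη : 0 < η) :
    ∀ᶠ i in F, -(η • (1 : A)) ≤ L y i ∧ L y i ≤ y + η • (1 : A) := by
  filter_upwards [asy_ev (H.Lsqrt hy) hη] with i hi
  set w := CFC.sqrt y
  have hw : IsSelfAdjoint w := IsSelfAdjoint.of_nonneg (CFC.sqrt_nonneg y)
  have hww : w * w = y := CFC.sqrt_mul_sqrt_self y
  have h0 := conj_sa_nonneg hw (H.k0 i)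
  have h1 := _root_.conj_sa_le hw (H.k1 i)
  rw [mul_one, hww] at h1
  have hsa : IsSelfAdjoint (L y i - w * k i * w) :=
    (H.Lsa (IsSelfAdjoint.of_nonneg hy) i).sub (IsSelfAdjoint.of_nonneg h0)
  have u := le_smul_one hsa hi.le
  have l := neg_smul_one_le hsa hi.le
  constructor
  · have := add_le_add l h0; simpa using this
  · have := add_le_add u h1
    rw [sub_add_cancel] at this; rwa [add_comm]

end Part6
end PartFile6

section PartFile7
set_option linter.unusedSectionVars false
set_option linter.unusedVariables false
open Filter Topology

section Part7
variable {A : Type*} [CStarAlgebra A] [PartialOrder A] [StarOrderedRing A]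
variable {I : Type*}

/-- Cutoffs of `k`. -/
structure CUT (F : Filter I) (C : I → NonUnitalStarSubalgebra ℂ A) (k : Bd I A) (t : ℝ)
    (κ ψ E V : Bd I A) : Prop where
  κm : ∀ i, κ i ∈ C i
  ψm : ∀ i, ψ i ∈ C i
  Em : ∀ i, E i ∈ C i
  Vm : ∀ i, V i ∈ C i
  Ep : ∀ i, IsStarProjection (E i)
  κ0 : ∀ i, 0 ≤ κ i
  κ1 : ∀ i, κ i ≤ 1
  κs : star κ = κ
  ψs : star ψ = ψ
  Eκ : E * κ = κ
  κE : κ * E = κ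
  Eψ : E * ψ = ψ
  ψE : ψ * E = ψ
  ψk : ψ * k = κ
  kψ : k * ψ = κ
  κk : κ * k = k * κ
  κψ : κ * ψ = ψ * κ
  VE : V * V * V * (k * k * k) = E
  Vn : ∀ i, ‖V i‖ ≤ 2 / t
  ψn : ∀ i, ‖ψ i‖ ≤ 2 / t
  κn : ∀ i, ‖k i * (1 - κ i)‖ ≤ t
  κc : ∀ a, asy F κ * asy F (cst I a) = asy F (cst I a) * asy F κ
  ψc : ∀ a, asy F ψ * asy F (cst I a) = asy F (cst I a) * asy F ψ

lemma Bd.ext' {f g : Bd I A} (h : ∀ i, f i = g i) : f = g := Subtype.ext (funext h)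

lemma exists_cut {F : Filter I} {C : I → NonUnitalStarSubalgebra ℂ A} {k : Bd I A} {L : A → Bd I A}
    (H : HMS F C k L) {t : ℝ} (ht : 0 < t) : ∃ κ ψ E V, CUT F C k t κ ψ E V := by
  have := H.fd
  have hsa : ∀ i, IsSelfAdjoint (k i) := fun i => IsSelfAdjoint.of_nonneg (H.k0 i)
  have hfin : ∀ i, (spectrum ℝ (k i)).Finite := fun i => fd_finite_spectrum (C i) (H.kmem i)
  have fc : ∀ (f : ℝ → ℝ) i, ContinuousOn f (spectrum ℝ (k i)) := fun f i => fin_cont (hfin i) f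
  set g : ℝ → ℝ := fun s => phi t s / max s (t / 2) with hg
  have gc : Continuous g := (phi_cont t).div (by fun_prop) (fun s => by positivity)
  have ht2 : 0 < t / 2 := by positivity
  have g0 : g 0 = 0 := by simp [hg, phi_eq_zero ht (show (0:ℝ) ≤ t/2 by positivity)]
  have gb : ∀ s, ‖g s‖ ≤ 2 / t := by
    intro s
    rw [hg, Real.norm_of_nonneg (div_nonneg (phi_nonneg _ _) (by positivity))]
    have := phi_le_one t s
    calc phi t s / max s (t/2) ≤ 1 / (t / 2) := by
          gcongr
          exact le_max_right _ _
      _ = 2 / t := by field_simp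
  have gk : ∀ s, g s * s = phi t s := by
    intro s
    simp only [hg]
    rcases le_total s (t/2) with h | h
    · rw [phi_eq_zero ht h]; simp
    · rw [max_eq_left h]; have : 0 < s := ht2.trans_le h
      field_simp
  let κ : Bd I A := bcfc (phi t) k 1 zero_le_one (fun i s _ => by
    rw [Real.norm_of_nonneg (phi_nonneg _ _)]; exact phi_le_one _ _)
  let ψ : Bd I A := bcfc g k (2 / t) (by positivity) (fun i s _ => gb s)
  let E : Bd I A := Bd.mk (fun i => chi (t/2) (k i)) 1 (fun i => proj_norm_le (chi_proj (hfin i)))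
  let V : Bd I A := Bd.mk (fun i => pinv (t/2) (k i)) (2/t) (fun i => by
    have := pinv_norm (c := k i) ht2
    rwa [inv_div] at this)
  have eE : ∀ s, (if t/2 ≤ s then (1:ℝ) else 0) * phi t s = phi t s := by
    intro s
    split_ifs with h
    · simp
    · rw [phi_eq_zero ht (not_le.1 h).le]; simp
  have eG : ∀ s, (if t/2 ≤ s then (1:ℝ) else 0) * g s = g s := by
    intro s
    simp only [hg]
    rw [mul_div_assoc', eE]
  have idk : ∀ i, k i = cfc (fun s : ℝ => s) (k i) := fun i => (fc_id (hsa i)).symm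
  refine ⟨κ, ψ, E, V, ?_⟩
  constructor
  · exact fun i => fd_cfc_mem (C i) (H.kmem i) (hsa i) _ (phi_eq_zero ht (by positivity))
  · exact fun i => fd_cfc_mem (C i) (H.kmem i) (hsa i) _ g0
  · exact fun i => chi_mem (C i) (H.kmem i) (hsa i) ht2
  · exact fun i => pinv_mem (C i) (H.kmem i) (hsa i) ht2
  · exact fun i => chi_proj (hfin i)
  · exact fun i => cfc_nonneg (fun s _ => phi_nonneg _ _)
  · exact fun i => cfc_le_one _ _ (fun s _ => phi_le_one _ _)
  · exact Bd.ext' fun i => fc_sa (phi t) (k i)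
  · exact Bd.ext' fun i => fc_sa g (k i)
  · exact Bd.ext' fun i => fc_mul (fc _ i) (fc _ i) (fun s _ => eE s)
  · exact Bd.ext' fun i => fc_mul (fc _ i) (fc _ i) (fun s _ => by rw [mul_comm]; exact eE s)
  · exact Bd.ext' fun i => fc_mul (fc _ i) (fc _ i) (fun s _ => eG s)
  · exact Bd.ext' fun i => fc_mul (fc _ i) (fc _ i) (fun s _ => by rw [mul_comm]; exact eG s)
  · refine Bd.ext' fun i => ?_
    change cfc g (k i) * k i = cfc (phi t) (k i)
    conv_lhs => enter [2]; rw [idk i]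
    exact fc_mul (fc _ i) (fc _ i) (fun s _ => gk s)
  · refine Bd.ext' fun i => ?_
    change k i * cfc g (k i) = cfc (phi t) (k i)
    rw [← fc_comm_self (hsa i)]
    conv_lhs => enter [2]; rw [idk i]
    exact fc_mul (fc _ i) (fc _ i) (fun s _ => gk s)
  · exact Bd.ext' fun i => fc_comm_self (hsa i) _
  · exact Bd.ext' fun i => fc_comm _ _ _
  · refine Bd.ext' fun i => ?_
    change pinv (t/2) (k i) * pinv (t/2) (k i) * pinv (t/2) (k i) * (k i * k i * k i) = chi (t/2) (k i)
    have h1 := pinv_mul (hfin i) (hsa i) ht2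
    have h2 : chi (t/2) (k i) * k i = k i * chi (t/2) (k i) := chi_comm (hsa i)
    have h3 := proj_sq (chi_proj (θ := t/2) (hfin i))
    set v := pinv (t/2) (k i)
    set e := chi (t/2) (k i)
    calc v * v * v * (k i * k i * k i) = v * v * (v * k i) * k i * k i := by noncomm_ring
      _ = v * v * (e * k i) * k i := by rw [h1]; noncomm_ring
      _ = v * (v * k i) * (e * k i) := by simp only [h2, mul_assoc]
      _ = v * (e * e) * k i := by rw [h1]; noncomm_ring
      _ = (v * k i) * e := by rw [h3, mul_assoc, h2, ← mul_assoc]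
      _ = e := by rw [h1, h3]
  · intro i
    have := pinv_norm (c := k i) ht2
    rwa [inv_div] at this
  · exact fun i => norm_cfc_le (by positivity) (fun s _ => gb s)
  · intro i
    have e1 : k i * (1 - cfc (phi t) (k i)) = cfc (fun s => s * (1 - phi t s)) (k i) := by
      have e2 : 1 - cfc (phi t) (k i) = cfc (fun s => 1 - phi t s) (k i) := by
        rw [cfc_sub _ _ _ (fc _ i) (fc _ i), fc_one (hsa i)]
      rw [e2]
      conv_lhs => enter [1]; rw [idk i]
      exact fc_mul (fc _ i) (fc _ i) (fun s _ => rfl)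
    change ‖k i * (1 - cfc (phi t) (k i))‖ ≤ t
    rw [e1]
    refine norm_cfc_le ht.le fun s hs => ?_
    have := spectrum_01 (H.k0 i) (H.k1 i) hs
    rw [Real.norm_of_nonneg (mul_nonneg this.1 (by linarith [phi_le_one t s]))]
    exact phi_comp_le ht this.1
  · exact fun a => cfc_asy_comm (H.comm a) H.k0 H.k1 (phi_cont t).continuousOn (fun i => rfl)
  · exact fun a => cfc_asy_comm (H.comm a) H.k0 H.k1 gc.continuousOn (fun i => rfl)

end Part7
end PartFile7

section PartFile8
set_option linter.unusedSectionVars false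
set_option linter.unusedVariables false
open Filter Topology

section Part8
variable {A : Type*} [CStarAlgebra A] [PartialOrder A] [StarOrderedRing A]
variable {I : Type*}

/-- families in `E C E`. -/
def Gd (C : I → NonUnitalStarSubalgebra ℂ A) (E f : Bd I A) : Prop :=
  ∀ i, f i ∈ C i ∧ E i * f i * E i = f i

lemma Gd.add {C : I → NonUnitalStarSubalgebra ℂ A} {E f g : Bd I A} (hf : Gd C E f) (hg : Gd C E g) :
    Gd C E (f + g) := fun i => ⟨add_mem (hf i).1 (hg i).1, by
      rw [Bd.add_apply, mul_add, add_mul, (hf i).2, (hg i).2]⟩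
lemma Gd.sub {C : I → NonUnitalStarSubalgebra ℂ A} {E f g : Bd I A} (hf : Gd C E f) (hg : Gd C E g) :
    Gd C E (f - g) := fun i => ⟨sub_mem (hf i).1 (hg i).1, by
      rw [Bd.sub_apply, mul_sub, sub_mul, (hf i).2, (hg i).2]⟩
lemma Gd.smul {C : I → NonUnitalStarSubalgebra ℂ A} {E f : Bd I A} (hf : Gd C E f) (r : ℝ) :
    Gd C E (r • f) := fun i => ⟨rsmul_mem _ _ (hf i).1, by
      rw [Bd.smul_apply, mul_smul_comm, smul_mul_assoc, (hf i).2]⟩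
lemma Gd.mk {C : I → NonUnitalStarSubalgebra ℂ A} {E f : Bd I A} (h : ∀ i, f i ∈ C i)
    (h1 : E * f = f) (h2 : f * E = f) : Gd C E f := fun i => ⟨h i, by
      have h1 := congrArg (fun g : Bd I A => g i) h1
      have h2 := congrArg (fun g : Bd I A => g i) h2
      simp only [Bd.mul_apply] at h1 h2
      rw [h1, h2]⟩

lemma Gd.bound {F : Filter I} {C : I → NonUnitalStarSubalgebra ℂ A} {E f : Bd I A} (hf : Gd C E f)
    (hE : ∀ i, E i ∈ C i ∧ IsStarProjection (E i)) {t0 : I → A →ₗ[ℝ] ℝ} {m : ℝ}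
    (ht : ∀ᶠ i in F, FDTr (C i) (t0 i) ∧ t0 i (E i) ≤ m) :
    ∀ᶠ i in F, |t0 i (f i)| ≤ ‖f i‖ * m := by
  filter_upwards [ht] with i hi
  have := fdtr_conj_le hi.1 (hE i).1 (hE i).2 (hf i).1
  rw [(hf i).2] at this
  exact this.trans (mul_le_mul_of_nonneg_left hi.2 (norm_nonneg _))

lemma Gd.lim {F : Ultrafilter I} {C : I → NonUnitalStarSubalgebra ℂ A} {E f : Bd I A} (hf : Gd C E f)
    (hE : ∀ i, E i ∈ C i ∧ IsStarProjection (E i)) {t0 : I → A →ₗ[ℝ] ℝ} {m : ℝ} (hm : 0 ≤ m)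
    (ht : ∀ᶠ i in (F : Filter I), FDTr (C i) (t0 i) ∧ t0 i (E i) ≤ m) :
    ∃ l, Tendsto (fun i => t0 i (f i)) F (𝓝 l) := by
  obtain ⟨M, hM, hb⟩ := f.bound
  have h1 := hf.bound hE ht
  have h2 : ∀ᶠ i in (F : Filter I), t0 i (f i) ∈ Set.Icc (-(M * m)) (M * m) := by
    filter_upwards [h1] with i hi
    have := hi.trans (mul_le_mul_of_nonneg_right (hb i) hm)
    exact abs_le.1 this
  obtain ⟨l, -, hl⟩ := (isCompact_Icc (a := -(M * m)) (b := M * m)).ultrafilter_le_nhds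
    (F.map (fun i => t0 i (f i))) (by
      rw [le_principal_iff]; exact h2)
  exact ⟨l, hl⟩

lemma Gd.null {F : Filter I} {C : I → NonUnitalStarSubalgebra ℂ A} {E f g : Bd I A} (hf : Gd C E f)
    (hg : Gd C E g)
    (hE : ∀ i, E i ∈ C i ∧ IsStarProjection (E i)) {t0 : I → A →ₗ[ℝ] ℝ} {m : ℝ} (hm : 0 ≤ m)
    (ht : ∀ᶠ i in (F : Filter I), FDTr (C i) (t0 i) ∧ t0 i (E i) ≤ m) (h : asy F f = asy F g) :
    Tendsto (fun i => t0 i (f i) - t0 i (g i)) F (𝓝 0) := by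
  have h1 := (hf.sub hg).bound hE ht
  rw [asy_eq, tendsto_zero_iff_norm_tendsto_zero] at h
  have h2 := h.mul_const m
  rw [zero_mul] at h2
  refine squeeze_zero_norm' ?_ h2
  filter_upwards [h1] with i hi
  rw [← map_sub]; exact hi

lemma tendsto_of_sub {F : Filter I} {f g : I → ℝ} {l : ℝ} (hf : Tendsto f F (𝓝 l))
    (h : Tendsto (fun i => f i - g i) F (𝓝 0)) : Tendsto g F (𝓝 l) := by
  have := hf.sub h
  simpa using this

lemma lim_trace {F : Ultrafilter I} {C : I → NonUnitalStarSubalgebra ℂ A} {k : Bd I A} {L : A → Bd I A}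
    (H : HMS (F : Filter I) C k L) {t : ℝ} {κ ψ E V : Bd I A} (K : CUT (F : Filter I) C k t κ ψ E V)
    {t0 : I → A →ₗ[ℝ] ℝ} {m : ℝ} (hm : 0 ≤ m)
    (ht : ∀ᶠ i in (F : Filter I), FDTr (C i) (t0 i) ∧ t0 i (E i) ≤ m) :
    ∃ T : A →ₗ[ℝ] ℝ, IsTr T ∧ (∀ a f, Gd C E f →
      asy (F : Filter I) f = asy (F : Filter I) κ * asy (F : Filter I) κ * asy (F : Filter I) (cst I a) →
      Tendsto (fun i => t0 i (f i)) F (𝓝 (T a))) ∧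
      (∀ a, 0 ≤ a → ∃ X : Bd I A, (∀ i, X i ∈ C i) ∧ Gd C E (star X * X) ∧
        asy (F : Filter I) (star X * X) = asy (F : Filter I) κ * asy (F : Filter I) κ * asy (F : Filter I) (cst I a)) := by
  have hE : ∀ i, E i ∈ C i ∧ IsStarProjection (E i) := fun i => ⟨K.Em i, K.Ep i⟩
  set G := (F : Filter I) with hG
  have EE : E * E = E := Bd.ext' fun i => proj_sq (K.Ep i)
  have Es : star E = E := Bd.ext' fun i => proj_star (K.Ep i)
  have aκE : asy G κ * asy G E = asy G κ := by rw [← map_mul, K.κE]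
  have aEκ : asy G E * asy G κ = asy G κ := by rw [← map_mul, K.Eκ]
  have aψk : asy G ψ * asy G k = asy G κ := by rw [← map_mul, K.ψk]
  have akψ : asy G k * asy G ψ = asy G κ := by rw [← map_mul, K.kψ]
  have aψE : asy G ψ * asy G E = asy G ψ := by rw [← map_mul, K.ψE]
  have aEψ : asy G E * asy G ψ = asy G ψ := by rw [← map_mul, K.Eψ]
  have pL : ∀ a, asy G ψ * asy G (L a) = asy G κ * asy G (cst I a) := fun a => by
    rw [H.Lk, ← mul_assoc, aψk]
  have Lp : ∀ a, asy G (L a) * asy G ψ = asy G κ * asy G (cst I a) := fun a => by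
    rw [H.Lk, mul_assoc, ← K.ψc, ← mul_assoc, akψ]
  let f : A → Bd I A := fun a => ψ * L a * κ
  have fg : ∀ a, Gd C E (f a) := fun a => Gd.mk
    (fun i => mul_mem (mul_mem (K.ψm i) (H.Lmem a i)) (K.κm i))
    (by simp only [f]; rw [← mul_assoc, ← mul_assoc, K.Eψ]) (by simp only [f]; rw [mul_assoc, K.κE])
  have fa : ∀ a, asy G (f a) = asy G κ * asy G κ * asy G (cst I a) := fun a => by
    simp only [f]
    rw [map_mul, map_mul, pL, mul_assoc, ← K.κc, mul_assoc]
  choose T hT using fun a => (fg a).lim hE hm ht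
  have key : ∀ a g, Gd C E g → asy G g = asy G κ * asy G κ * asy G (cst I a) →
      Tendsto (fun i => t0 i (g i)) G (𝓝 (T a)) := fun a g hg h =>
    tendsto_of_sub (hT a) ((fg a).null hg hE hm ht ((fa a).trans h.symm))
  have hX : ∀ a, 0 ≤ a → ∃ X : Bd I A, (∀ i, X i ∈ C i) ∧ Gd C E (star X * X) ∧
        asy G (star X * X) = asy G κ * asy G κ * asy G (cst I a) := by
    intro a ha
    set w := CFC.sqrt a with hw
    have ws : star w = w := (IsSelfAdjoint.of_nonneg (CFC.sqrt_nonneg a)).star_eq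
    have hww : w * w = a := CFC.sqrt_mul_sqrt_self a
    refine ⟨ψ * L w * E, fun i => mul_mem (mul_mem (K.ψm i) (H.Lmem w i)) (K.Em i), ?_, ?_⟩
    · refine Gd.mk (fun i => mul_mem (star_mem ?_) ?_) ?_ ?_
      · exact mul_mem (mul_mem (K.ψm i) (H.Lmem w i)) (K.Em i)
      · exact mul_mem (mul_mem (K.ψm i) (H.Lmem w i)) (K.Em i)
      · simp only [star_mul, Es, ← mul_assoc, EE]
      · rw [mul_assoc, mul_assoc _ E E, EE]
    · have Lw : star (L w) = L w := Bd.ext' fun i => by rw [Bd.star_apply, H.Lstar, ws]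
      rw [star_mul, star_mul, Es, Lw, K.ψs]
      simp only [map_mul]
      calc asy G E * (asy G (L w) * asy G ψ) * (asy G ψ * asy G (L w) * asy G E)
          = asy G E * asy G κ * asy G (cst I w) * (asy G κ * asy G (cst I w)) * asy G E := by
            rw [Lp, pL]; noncomm_ring
        _ = asy G κ * (asy G (cst I w) * asy G κ) * asy G (cst I w) * asy G E := by
            rw [aEκ]; noncomm_ring
        _ = asy G κ * asy G κ * (asy G (cst I w) * asy G (cst I w)) * asy G E := by
            rw [← K.κc]; noncomm_ring
        _ = asy G κ * (asy G κ * asy G (cst I a)) * asy G E := by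
            rw [← map_mul (asy G) (cst I w), ← cst_mul, hww]; noncomm_ring
        _ = asy G (cst I a) * asy G κ * (asy G κ * asy G E) := by
            rw [K.κc, ← mul_assoc, K.κc]; noncomm_ring
        _ = asy G κ * asy G κ * asy G (cst I a) := by
            rw [aκE, ← K.κc, mul_assoc, ← K.κc, mul_assoc]
  have Tadd : ∀ a b, T (a + b) = T a + T b := by
    intro a b
    have h1 := key (a + b) (f a + f b) ((fg a).add (fg b)) (by rw [map_add, fa, fa, cst_add, map_add, mul_add])
    have h2 := (hT a).add (hT b)
    simp only [Bd.add_apply, map_add] at h1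
    exact tendsto_nhds_unique h1 h2
  have Tsmul : ∀ (r : ℝ) a, T (r • a) = r • T a := by
    intro r a
    have h1 := key (r • a) (r • f a) ((fg a).smul r) (by
      have e : asy G (r • f a) = asy G (f a) * asy G (cst I (r • (1:A))) := by
        rw [← map_mul]; congr 1; exact Bd.ext' fun i => by simp
      have e2 : cst I (r • a) = cst I a * cst I (r • (1:A)) := Bd.ext' fun i => by simp
      rw [e, fa, e2, map_mul, ← mul_assoc])
    have h2 := (hT a).const_mul r
    simp only [Bd.smul_apply, map_smul, smul_eq_mul] at h1
    exact tendsto_nhds_unique h1 h2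
  let T' : A →ₗ[ℝ] ℝ := { toFun := T, map_add' := Tadd, map_smul' := Tsmul }
  refine ⟨T', ⟨?_, ?_, ?_⟩, key, hX⟩
  · intro a ha
    obtain ⟨X, hX, hXg, hXa⟩ := hX a ha
    refine ge_of_tendsto (key a _ hXg hXa) ?_
    filter_upwards [ht] with i hi
    exact hi.1.pos _ (hXg i).1 (star_mul_self_nonneg (X i))
  · intro a b
    have gg : ∀ a b, Gd C E ((ψ * L a * E) * (ψ * L b * E)) := fun a b => by
      refine Gd.mk (fun i => mul_mem ?_ ?_) ?_ ?_
      · exact mul_mem (mul_mem (K.ψm i) (H.Lmem a i)) (K.Em i)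
      · exact mul_mem (mul_mem (K.ψm i) (H.Lmem b i)) (K.Em i)
      · simp only [← mul_assoc, K.Eψ]
      · rw [mul_assoc, mul_assoc _ E E, EE]
    have ga : ∀ a b, asy G ((ψ * L a * E) * (ψ * L b * E)) = asy G κ * asy G κ * asy G (cst I (a * b)) := by
      intro a b
      simp only [map_mul]
      calc asy G ψ * asy G (L a) * asy G E * (asy G ψ * asy G (L b) * asy G E)
          = asy G ψ * asy G (L a) * (asy G E * asy G ψ) * asy G (L b) * asy G E := by noncomm_ring
        _ = (asy G ψ * asy G (L a)) * (asy G ψ * asy G (L b)) * asy G E := by rw [aEψ]; noncomm_ring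
        _ = asy G κ * (asy G (cst I a) * asy G κ) * asy G (cst I b) * asy G E := by
            rw [pL, pL]; noncomm_ring
        _ = asy G κ * (asy G κ * (asy G (cst I a) * asy G (cst I b))) * asy G E := by
            rw [← K.κc]; noncomm_ring
        _ = asy G (cst I (a * b)) * asy G κ * (asy G κ * asy G E) := by
            rw [← map_mul (asy G) (cst I a), ← cst_mul, K.κc, ← mul_assoc, K.κc]; noncomm_ring
        _ = asy G κ * asy G κ * asy G (cst I (a * b)) := by
            rw [aκE, ← K.κc, mul_assoc, ← K.κc, mul_assoc]
    have h1 := key (a * b) _ (gg a b) (ga a b)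
    have h2 := key (b * a) _ (gg b a) (ga b a)
    refine tendsto_nhds_unique_of_eventuallyEq h1 h2 ?_
    filter_upwards [ht] with i hi
    exact hi.1.tr _ (mul_mem (mul_mem (K.ψm i) (H.Lmem a i)) (K.Em i)) _
      (mul_mem (mul_mem (K.ψm i) (H.Lmem b i)) (K.Em i))
  · intro a
    have h1 := key (star a) (star (f a)) (fun i => ⟨star_mem (fg a i).1, by
        have := congrArg star (fg a i).2
        rw [star_mul, star_mul, proj_star (K.Ep i), ← mul_assoc] at this
        exact this⟩) (by
      have e1 : star (f a) = κ * L (star a) * ψ := by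
        simp only [f]
        rw [star_mul, star_mul, K.κs, K.ψs, mul_assoc]
        congr 2
        exact Bd.ext' fun i => by rw [Bd.star_apply, H.Lstar]
      rw [e1, mul_assoc, map_mul, map_mul, Lp, ← mul_assoc])
    refine tendsto_nhds_unique_of_eventuallyEq h1 (hT a) ?_
    filter_upwards [ht] with i hi
    exact hi.1.st _ (fg a i).1

end Part8
end PartFile8

section PartFile9
set_option linter.unusedSectionVars false
set_option linter.unusedVariables false
open Filter Topology

section Part9
variable {A : Type u} [CStarAlgebra A] [PartialOrder A] [StarOrderedRing A]
variable {I : Type*}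

lemma FDTr.smul {C : NonUnitalStarSubalgebra ℂ A} {t : A →ₗ[ℝ] ℝ} (ht : FDTr C t) {r : ℝ} (hr : 0 ≤ r) :
    FDTr C (r • t) :=
  ⟨fun x hx h0 => mul_nonneg hr (ht.pos x hx h0), fun x hx y hy => by simp [ht.tr x hx y hy],
    fun x hx => by simp [ht.st x hx]⟩

lemma cst_sum {n : ℕ} (f : Fin n → A) : cst I (∑ j, f j) = ∑ j, cst I (f j) := by
  let φ : A →+ Bd I A := { toFun := cst I, map_zero' := cst_zero, map_add' := cst_add }
  exact map_sum φ f Finset.univ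

lemma Bd.sum_apply {n : ℕ} (f : Fin n → Bd I A) (i : I) : (∑ j, f j : Bd I A) i = ∑ j, f j i := by
  let φ : Bd I A →+ A := { toFun := fun f => f i, map_zero' := rfl, map_add' := fun _ _ => rfl }
  exact map_sum φ f Finset.univ

lemma half_compare_aux1 {F : Filter I} {C : I → NonUnitalStarSubalgebra ℂ A} {k : Bd I A} {L : A → Bd I A}
    (H : HMS F C k L) {t : ℝ} {κ ψ E V : Bd I A} (K : CUT F C k t κ ψ E V) {z : A}
    {n : ℕ} {a b : Fin n → A} (hab : 1 = ∑ j, a j * z * b j) :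
    asy F E = asy F (∑ j, V * V * V * L (a j) * L z * L (b j)) := by
  rw [map_sum]
  have h1 : ∀ j, asy F (V * V * V * L (a j) * L z * L (b j)) =
      asy F E * asy F (cst I (a j * z * b j)) := by
    intro j
    rw [cst_mul, cst_mul]
    simp only [map_mul, H.Lk]
    calc asy F V * asy F V * asy F V * (asy F k * asy F (cst I (a j))) * (asy F k * asy F (cst I z)) *
            (asy F k * asy F (cst I (b j)))
        = asy F V * asy F V * asy F V * asy F k * (asy F (cst I (a j)) * asy F k) * (asy F (cst I z) *
            asy F k) * asy F (cst I (b j)) := by noncomm_ring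
      _ = asy F V * asy F V * asy F V * asy F k * asy F k * (asy F (cst I (a j)) * asy F k) * asy F (cst I z) *
            asy F (cst I (b j)) := by
              conv_lhs => rw [← H.comm (a j), ← H.comm z]
              noncomm_ring
      _ = asy F V * asy F V * asy F V * (asy F k * asy F k * asy F k) * (asy F (cst I (a j)) * asy F (cst I z) *
            asy F (cst I (b j))) := by rw [← H.comm]; noncomm_ring
      _ = _ := by rw [← K.VE]; simp only [map_mul]
  rw [Finset.sum_congr rfl (fun j _ => h1 j), ← Finset.mul_sum, ← map_sum, ← cst_sum, ← hab, cst_one, map_one, mul_one]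

lemma half_compare_aux2 {F : Filter I} {C : I → NonUnitalStarSubalgebra ℂ A} {k : Bd I A} {L : A → Bd I A}
    (H : HMS F C k L) {t : ℝ} {κ ψ E V : Bd I A} (K : CUT F C k t κ ψ E V) {x xb : A}
    (hx : IsSelfAdjoint x) (hx1 : ‖x‖ ≤ 1) (hxb : x * xb = x) {δ γ : ℝ} (hδ : 0 < δ) (hγ : 0 < γ)
    (ht : t = γ * δ / 2) {g : Bd I A} (hg : asy F g = asy F κ * asy F κ * asy F (cst I xb)) :
    ∀ᶠ i in F, ‖chi δ (L x i) * g i * chi δ (L x i) - chi δ (L x i)‖ ≤ 2 * γ := by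
  have := H.fd
  have hfin : ∀ i, (spectrum ℝ (L x i)).Finite := fun i => fd_finite_spectrum (C i) (H.Lmem x i)
  let Q : Bd I A := Bd.mk (fun i => chi δ (L x i)) 1 (fun i => proj_norm_le (chi_proj (hfin i)))
  let W : Bd I A := Bd.mk (fun i => pinv δ (L x i)) δ⁻¹ (fun i => pinv_norm hδ)
  have QW : Q = W * L x := Bd.ext' fun i => (pinv_mul (hfin i) (H.Lsa hx i) hδ).symm
  have aQ : asy F Q = asy F W * asy F k * asy F (cst I x) := by
    rw [QW, map_mul, H.Lk, mul_assoc]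
  have Qxb : asy F Q * asy F (cst I xb) = asy F Q := by
    rw [aQ, mul_assoc, ← map_mul (asy F) (cst I x), ← cst_mul, hxb]
  have h1 : asy F (Q * g * Q) = asy F (Q * κ * κ * Q) := by
    simp only [map_mul, hg]
    congr 1
    rw [mul_assoc (asy F κ), K.κc, ← mul_assoc (asy F κ), K.κc, mul_assoc, ← mul_assoc, Qxb, mul_assoc]
  have h2 : asy F (Q * (1 - κ)) = asy F (W * cst I x * (k * (1 - κ))) := by
    simp only [map_mul, aQ]
    rw [mul_assoc (asy F W), H.comm]; noncomm_ring
  filter_upwards [asy_ev h1 (show 0 < γ / 4 by positivity), asy_ev h2 (show 0 < γ / 4 by positivity)] with i i1 i2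
  have pQ : IsStarProjection (Q i) := chi_proj (hfin i)
  change ‖Q i * g i * Q i - Q i‖ ≤ 2 * γ
  simp only [Bd.mul_apply, Bd.sub_apply, Bd.one_apply, cst_apply] at i1 i2
  have n1 : ‖W i * x * (k i * (1 - κ i))‖ ≤ γ / 2 := by
    have := K.κn i
    have nW : ‖W i‖ ≤ δ⁻¹ := pinv_norm hδ
    calc _ ≤ ‖W i‖ * ‖x‖ * ‖k i * (1 - κ i)‖ := (norm_mul_le _ _).trans (by gcongr; exact norm_mul_le _ _)
      _ ≤ δ⁻¹ * 1 * t := by gcongr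
      _ = γ / 2 := by rw [ht]; field_simp
  have n2 : ‖Q i * (1 - κ i)‖ ≤ 3 / 4 * γ := by
    have := norm_le_norm_add_norm_sub' (Q i * (1 - κ i)) (W i * x * (k i * (1 - κ i)))
    linarith
  have n3 : ‖Q i * κ i * κ i * Q i - Q i‖ ≤ 3 / 2 * γ := by
    have e : Q i * κ i * κ i * Q i - Q i = -((Q i * (1 - κ i)) * ((1 + κ i) * Q i)) := by
      have := proj_sq pQ
      have e2 : (Q i * (1 - κ i)) * ((1 + κ i) * Q i) = Q i * Q i - Q i * κ i * κ i * Q i := by noncomm_ring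
      rw [e2, this]; noncomm_ring
    rw [e, norm_neg]
    have n4 : ‖(1 + κ i) * Q i‖ ≤ 2 := by
      have h1 := proj_norm_le pQ
      have h2 := norm_le_one_of (K.κ0 i) (K.κ1 i)
      have h3 : ‖(1 + κ i) * Q i‖ ≤ ‖Q i‖ + ‖κ i‖ * ‖Q i‖ := by
        rw [add_mul, one_mul]
        exact (norm_add_le _ _).trans (by gcongr; exact norm_mul_le _ _)
      nlinarith [norm_nonneg (Q i), norm_nonneg (κ i)]
    calc _ ≤ ‖Q i * (1 - κ i)‖ * ‖(1 + κ i) * Q i‖ := norm_mul_le _ _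
      _ ≤ (3 / 4 * γ) * 2 := by gcongr
      _ = 3 / 2 * γ := by ring
  have := norm_sub_le_norm_sub_add_norm_sub (Q i * g i * Q i) (Q i * κ i * κ i * Q i) (Q i)
  linarith

/-- `t(g) ≥ 1 - r`. -/
lemma fdtr_lower {C : NonUnitalStarSubalgebra ℂ A} {t : A →ₗ[ℝ] ℝ} (ht : FDTr C t) {X Q : A}
    (hX : X ∈ C) (hQ : Q ∈ C) (pQ : IsStarProjection Q) (h1 : t Q = 1) {r : ℝ}
    (h : ‖Q * (star X * X) * Q - Q‖ ≤ r) : 1 - r ≤ t (star X * X) := by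
  have hXX : star X * X ∈ C := mul_mem (star_mem hX) hX
  have a1 : t (Q * (star X * X) * Q) ≤ t (star X * X) := by
    have e1 : t (Q * (star X * X) * Q) = t (X * Q * star X) := by
      have := ht.tr (Q * star X) (mul_mem hQ (star_mem hX)) (X * Q) (mul_mem hX hQ)
      have e : Q * (star X * X) * Q = Q * star X * (X * Q) := by noncomm_ring
      rw [e, this]
      have e : X * Q * (Q * star X) = X * (Q * Q) * star X := by noncomm_ring
      rw [e, proj_sq pQ]
    have e2 : t (star X * X) = t (X * star X) := ht.tr _ (star_mem hX) _ hX
    rw [e1, e2]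
    have := ht.pos (X * star X - X * Q * star X) (sub_mem (mul_mem hX (star_mem hX))
      (mul_mem (mul_mem hX hQ) (star_mem hX))) (by
        have := _root_.conj_le' (a := X) pQ.le_one
        rw [mul_one] at this
        exact sub_nonneg.2 this)
    rw [map_sub] at this; linarith
  have a2 := fdtr_conj_le ht hQ pQ (x := Q * (star X * X) * Q - Q) (sub_mem (mul_mem (mul_mem hQ hXX) hQ) hQ)
  have e3 : Q * (Q * (star X * X) * Q - Q) * Q = Q * (star X * X) * Q - Q := by
    have := proj_sq pQ
    have e : Q * (Q * (star X * X) * Q - Q) * Q = (Q * Q) * (star X * X) * (Q * Q) - Q * Q * Q := by noncomm_ring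
    rw [e, this, this]
  rw [e3, map_sub, h1, mul_one] at a2
  have := (abs_le.1 a2).1
  linarith

lemma half_compare {F : Ultrafilter I} {C : I → NonUnitalStarSubalgebra ℂ A} {k : Bd I A} {L : A → Bd I A}
    (H : HMS (F : Filter I) C k L) (hs : IsSimpleCStarAlgebra A) {x xb z : A}
    (hx : IsSelfAdjoint x) (hx1 : ‖x‖ ≤ 1) (hxb : x * xb = x) (xb0 : 0 ≤ xb) (xb1 : xb ≤ 1)
    (z0 : 0 ≤ z) (z1 : z ≤ 1) (hz : z ≠ 0) {σ : ℝ} (hσ : 0 < σ)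
    (hgap : ∀ t : A →ₗ[ℝ] ℝ, IsTr t → t xb + σ * t 1 ≤ t z) {δ : ℝ} (hδ : 0 < δ) :
    ∃ δ' > 0, ∀ᶠ i in (F : Filter I), ∃ u ∈ C i, u * star u = chi δ (L x i) ∧ u * chi δ' (L z i) = u := by
  have := H.fd
  obtain ⟨n, a, b, hab⟩ := simple_sum hs hz
  set σ1 := min σ 1 with hσ1
  have s0 : 0 < σ1 := by positivity
  have s1 : σ1 ≤ 1 := min_le_right _ _
  have s2 : σ1 ≤ σ := min_le_left _ _
  obtain ⟨γ, hγ⟩ : ∃ γ, γ = σ1 / 8 := ⟨_, rfl⟩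
  have γ0 : 0 < γ := by rw [hγ]; positivity
  obtain ⟨t, ht⟩ : ∃ t, t = γ * δ / 2 := ⟨_, rfl⟩
  have t0' : 0 < t := by rw [ht]; positivity
  obtain ⟨S, hS⟩ : ∃ S, S = ∑ j, (‖a j‖ + 1) * (‖b j‖ + 1) := ⟨_, rfl⟩
  have S0 : 0 ≤ S := by rw [hS]; positivity
  obtain ⟨B, hB⟩ : ∃ B, B = (2 / t) * (2 / t) * (2 / t) := ⟨_, rfl⟩
  have B0 : 0 < B := by rw [hB]; positivity
  obtain ⟨m, hm⟩ : ∃ m, m = 4 * B * S := ⟨_, rfl⟩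
  have m0 : 0 ≤ m := by rw [hm]; positivity
  obtain ⟨δ', d0, d1, d2⟩ : ∃ δ' > 0, B * S * δ' ≤ 1 / 4 ∧ 2 / t * δ' * m ≤ σ1 / 8 := by
    refine ⟨min (1 / (4 * (B * S + 1))) (σ1 * t / (16 * (m + 1))), by positivity, ?_, ?_⟩
    · calc _ ≤ B * S * (1 / (4 * (B * S + 1))) := by gcongr; exact min_le_left _ _
        _ ≤ 1 / 4 := by
          have : 0 < B * S + 1 := by positivity
          field_simp; linarith
    · calc _ ≤ 2 / t * (σ1 * t / (16 * (m + 1))) * m := by gcongr; exact min_le_right _ _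
        _ ≤ σ1 / 8 := by
          have : 0 < m + 1 := by positivity
          field_simp; nlinarith
  obtain ⟨κ, ψ, E, V, K⟩ := exists_cut H t0'
  refine ⟨δ', d0, ?_⟩
  by_contra hne
  rw [← Ultrafilter.eventually_not] at hne
  have xfin : ∀ i, (spectrum ℝ (L x i)).Finite := fun i => fd_finite_spectrum (C i) (H.Lmem x i)
  have zfin : ∀ i, (spectrum ℝ (L z i)).Finite := fun i => fd_finite_spectrum (C i) (H.Lmem z i)
  have zsa : IsSelfAdjoint z := IsSelfAdjoint.of_nonneg z0
  have Qm : ∀ i, chi δ (L x i) ∈ C i := fun i => chi_mem _ (H.Lmem x i) (H.Lsa hx i) hδ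
  have Pm : ∀ i, chi δ' (L z i) ∈ C i := fun i => chi_mem _ (H.Lmem z i) (H.Lsa zsa i) d0
  have Qp : ∀ i, IsStarProjection (chi δ (L x i)) := fun i => chi_proj (xfin i)
  have Pp : ∀ i, IsStarProjection (chi δ' (L z i)) := fun i => chi_proj (zfin i)
  have ex : ∀ᶠ i in (F : Filter I), ∃ τ : A →ₗ[ℝ] ℝ, FDTr (C i) τ ∧ τ (chi δ (L x i)) = 1 ∧ τ (chi δ' (L z i)) ≤ 1 := by
    filter_upwards [hne] with i hi
    rcases fd_compare (C i) _ (Qm i) (Pm i) (Qp i) (Pp i) le_rfl with h | ⟨τ, hτ, hlt⟩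
    · exact absurd h hi
    · have h0 := hτ.pos _ (Pm i) (Pp i).nonneg
      have h1 : 0 < τ (chi δ (L x i)) := h0.trans_lt hlt
      refine ⟨(τ (chi δ (L x i)))⁻¹ • τ, hτ.smul (by positivity), ?_, ?_⟩
      · simp [h1.ne']
      · simp only [LinearMap.smul_apply, smul_eq_mul]
        rw [inv_mul_le_iff₀ h1]; linarith
  obtain ⟨t0, ht0⟩ := ex.choice
  have zn : ‖z‖ ≤ 1 := norm_le_one_of z0 z1
  have hP := (H.bounds z0 d0)
  have hP' : ∀ᶠ i in (F : Filter I), ‖L z i * (1 - chi δ' (L z i))‖ ≤ δ' := by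
    filter_upwards [hP] with i hi
    exact norm_mul_one_sub_chi (zfin i) (H.Lsa zsa i) d0.le hi.1
  have htE : ∀ᶠ i in (F : Filter I), FDTr (C i) (t0 i) ∧ t0 i (E i) ≤ m := by
    filter_upwards [ht0, hP', asy_ev (half_compare_aux1 H K hab) (show (0:ℝ) < 1 / 4 by norm_num)] with i hi i1 i2
    refine ⟨hi.1, ?_⟩
    have := trace_E_bound hi.1 (fun j => H.Lmem (a j) i) (fun j => H.Lmem (b j) i) (K.Em i) (Pm i)
      (mul_mem (mul_mem (K.Vm i) (K.Vm i)) (K.Vm i)) (H.Lmem z i) (K.Ep i) (Pp i)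
      (δ := δ') (B := B) (S := S) (by rw [mul_sub, mul_one] at i1; exact i1)
      ((H.Lnorm z i).trans (by linarith)) (by
        rw [hB]
        have := K.Vn i
        refine (norm_mul_le _ _).trans ?_
        gcongr
        refine (norm_mul_le _ _).trans ?_
        gcongr) (by
        rw [hS]
        refine Finset.sum_le_sum fun j _ => ?_
        have h1 := H.Lnorm (a j) i
        have h2 := H.Lnorm (b j) i
        gcongr) d1 (by
        rw [Bd.sum_apply] at i2
        exact i2.le)
    calc t0 i (E i) ≤ 4 * B * S * t0 i (chi δ' (L z i)) := this
      _ ≤ 4 * B * S * 1 := by gcongr; exact hi.2.2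
      _ = m := by rw [hm, mul_one]
  obtain ⟨T, hT, key, pos⟩ := lim_trace H K m0 htE
  -- lower bound
  have lower : 1 - 2 * γ ≤ T xb := by
    obtain ⟨X, Xm, Xg, Xa⟩ := pos xb xb0
    refine ge_of_tendsto (key xb _ Xg Xa) ?_
    filter_upwards [ht0, half_compare_aux2 H K hx hx1 hxb hδ γ0 ht Xa] with i hi i1
    exact fdtr_lower hi.1 (Xm i) (Qm i) (Qp i) hi.2.1 i1
  have upper : T z ≤ 1 + σ1 / 16 + σ1 / 8 := by
    have ek : asy (F : Filter I) ψ * asy (F : Filter I) (L z) = asy (F : Filter I) κ * asy (F : Filter I) (cst I z) := by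
      rw [H.Lk, ← mul_assoc, ← map_mul, K.ψk]
    have lim := key z (ψ * L z * κ) (Gd.mk
      (fun i => mul_mem (mul_mem (K.ψm i) (H.Lmem z i)) (K.κm i))
      (by rw [← mul_assoc, ← mul_assoc, K.Eψ]) (by rw [mul_assoc, K.κE])) (by
        rw [map_mul, map_mul, ek, mul_assoc, ← K.κc, mul_assoc])
    have ea : asy (F : Filter I) (κ * ψ * L z) = asy (F : Filter I) (κ * κ * cst I z) := by
      rw [mul_assoc, map_mul, map_mul, ek, ← mul_assoc]; simp only [map_mul]
    refine le_of_tendsto lim ?_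
    filter_upwards [ht0, hP', htE, asy_ev ea (show 0 < σ1 / 16 by positivity)] with i hi i1 i2 i3
    set P := chi δ' (L z i) with hPd
    have PP := proj_sq (Pp i)
    have ht := hi.1
    have c1 : ψ i * L z i * P ∈ C i := mul_mem (mul_mem (K.ψm i) (H.Lmem z i)) (Pm i)
    have c2 : P * κ i ∈ C i := mul_mem (Pm i) (K.κm i)
    have e1 : t0 i (ψ i * L z i * P * κ i) = t0 i (P * (κ i * ψ i * L z i) * P) := by
      have := ht.tr _ c1 _ c2
      have e : ψ i * L z i * P * (P * κ i) = ψ i * L z i * (P * P) * κ i := by noncomm_ring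
      rw [e, PP] at this
      rw [this]; congr 1; noncomm_ring
    have b1 : t0 i (ψ i * L z i * P * κ i) ≤ 1 + σ1 / 16 := by
      rw [e1]
      have := fdtr_conj_le ht (Pm i) (Pp i) (x := κ i * ψ i * L z i) (mul_mem (mul_mem (K.κm i) (K.ψm i)) (H.Lmem z i))
      have tP0 := ht.pos _ (Pm i) (Pp i).nonneg
      simp only [Bd.mul_apply, cst_apply] at i3
      have n1 : ‖κ i * κ i * z‖ ≤ 1 := by
        have h2 := norm_le_one_of (K.κ0 i) (K.κ1 i)
        calc _ ≤ ‖κ i‖ * ‖κ i‖ * ‖z‖ := (norm_mul_le _ _).trans (by gcongr; exact norm_mul_le _ _)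
          _ ≤ 1 * 1 * 1 := by gcongr
          _ = 1 := by norm_num
      have n2 := norm_le_norm_add_norm_sub' (κ i * ψ i * L z i) (κ i * κ i * z)
      calc _ ≤ _ := le_abs_self _
        _ ≤ _ := this
        _ ≤ (1 + σ1 / 16) * 1 := by
          gcongr
          · linarith
          · exact hi.2.2
        _ = _ := mul_one _
    have b2 : t0 i (ψ i * (L z i * (1 - P)) * κ i) ≤ σ1 / 8 := by
      have g : Gd C E (ψ * (L z * (1 - Bd.mk (fun i => chi δ' (L z i)) 1 (fun i => proj_norm_le (Pp i)))) * κ) := by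
        refine Gd.mk (fun j => ?_) (by rw [← mul_assoc, ← mul_assoc, K.Eψ]) (by rw [mul_assoc, K.κE])
        refine mul_mem (mul_mem (K.ψm j) ?_) (K.κm j)
        rw [mul_sub, mul_one]
        exact sub_mem (H.Lmem z j) (mul_mem (H.Lmem z j) (Pm j))
      have g1 := (g i).1
      have g2 := (g i).2
      have := fdtr_conj_le ht (K.Em i) (K.Ep i) g1
      rw [g2] at this
      simp only [Bd.mul_apply, Bd.sub_apply, Bd.one_apply, Bd.mk_apply] at this
      rw [← hPd] at this
      have n3 : ‖ψ i * (L z i * (1 - P)) * κ i‖ ≤ 2 / t * δ' := by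
        have h2 := norm_le_one_of (K.κ0 i) (K.κ1 i)
        have h3 := K.ψn i
        calc _ ≤ ‖ψ i‖ * ‖L z i * (1 - P)‖ * ‖κ i‖ := (norm_mul_le _ _).trans (by gcongr; exact norm_mul_le _ _)
          _ ≤ 2 / t * δ' * 1 := by gcongr
          _ = _ := mul_one _
      calc _ ≤ _ := le_abs_self _
        _ ≤ _ := this
        _ ≤ 2 / t * δ' * m := by
          have := ht.pos _ (K.Em i) (K.Ep i).nonneg
          gcongr
          exact i2.2
        _ ≤ _ := d2
    have e2 : (ψ * L z * κ) i = ψ i * L z i * P * κ i + ψ i * (L z i * (1 - P)) * κ i := by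
      simp only [Bd.mul_apply]; noncomm_ring
    rw [e2, map_add]; linarith
  have g := hgap T hT
  have g1 : T xb ≤ T 1 := hT.mono xb1
  have g2 : σ1 * (1 - 2 * γ) ≤ σ * T 1 := by
    have : 0 ≤ 1 - 2 * γ := by rw [hγ]; linarith
    calc _ ≤ σ * (1 - 2 * γ) := by gcongr
      _ ≤ _ := by gcongr; linarith
  rw [hγ] at g2 lower
  nlinarith

end Part9
end PartFile9

section PartFile10
set_option linter.unusedSectionVars false
set_option linter.unusedVariables false
open Filter Topology

section Part10
variable {A : Type u} [CStarAlgebra A] [PartialOrder A] [StarOrderedRing A]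
variable {I : Type*}

lemma rho_exists {z : A} (z0 : 0 ≤ z) {t : ℝ} (ht : 0 < t) :
    ∃ r : A, 0 ≤ r * z ∧ r * z ≤ 1 ∧ ‖z * (1 - r * z)‖ ≤ t := by
  have zsa : IsSelfAdjoint z := IsSelfAdjoint.of_nonneg z0
  have nn : ∀ s ∈ spectrum ℝ z, 0 ≤ s := fun s hs => spectrum_nonneg_of_nonneg z0 hs
  have c1 : Continuous (fun s : ℝ => (max s t)⁻¹) := by
    refine Continuous.inv₀ (by fun_prop) (fun s => by positivity)
  have e1 : cfc (fun s : ℝ => (max s t)⁻¹) z * z = cfc (fun s : ℝ => (max s t)⁻¹ * s) z := by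
    conv_lhs => enter [2]; rw [← fc_id zsa]
    exact fc_mul c1.continuousOn (by fun_prop) (fun s _ => rfl)
  have b : ∀ s ∈ spectrum ℝ z, 0 ≤ (max s t)⁻¹ * s ∧ (max s t)⁻¹ * s ≤ 1 := by
    intro s hs
    have := nn s hs
    refine ⟨by positivity, ?_⟩
    rw [inv_mul_le_iff₀ (by positivity), mul_one]; exact le_max_left _ _
  have c2 : Continuous (fun s : ℝ => (max s t)⁻¹ * s) := c1.mul continuous_id
  refine ⟨cfc (fun s : ℝ => (max s t)⁻¹) z, ?_, ?_, ?_⟩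
  · rw [e1]; exact cfc_nonneg fun s hs => (b s hs).1
  · rw [e1]; exact cfc_le_one _ _ fun s hs => (b s hs).2
  · have e2 : z * (1 - cfc (fun s : ℝ => (max s t)⁻¹) z * z) = cfc (fun s : ℝ => s * (1 - (max s t)⁻¹ * s)) z := by
      have e3 : 1 - cfc (fun s : ℝ => (max s t)⁻¹ * s) z = cfc (fun s : ℝ => 1 - (max s t)⁻¹ * s) z := by
        rw [cfc_sub _ _ _ (by fun_prop) c2.continuousOn, fc_one zsa]
      rw [e1, e3]
      conv_lhs => enter [1]; rw [← fc_id zsa]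
      exact fc_mul (by fun_prop) (continuous_const.sub c2).continuousOn (fun s _ => rfl)
    rw [e2]
    refine norm_cfc_le ht.le fun s hs => ?_
    have h1 := nn s hs
    have h2 := b s hs
    rw [Real.norm_of_nonneg (mul_nonneg h1 (by linarith))]
    rcases le_total s t with h | h
    · nlinarith
    · rw [max_eq_left h, inv_mul_cancel₀ (by linarith)]; simpa using ht.le

lemma norm_conj_le (a x : A) : ‖a * x * star a‖ ≤ ‖a‖ * ‖x‖ * ‖a‖ := by
  calc _ ≤ ‖a * x‖ * ‖star a‖ := norm_mul_le _ _
    _ ≤ ‖a‖ * ‖x‖ * ‖a‖ := by rw [norm_star]; gcongr; exact norm_mul_le _ _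

lemma half_v {F : Ultrafilter I} {C : I → NonUnitalStarSubalgebra ℂ A} {k : Bd I A} {L : A → Bd I A}
    (H : HMS (F : Filter I) C k L) (hs : IsSimpleCStarAlgebra A) {x xb z : A}
    (x0 : 0 ≤ x) (x1 : x ≤ 1) (hxb : x * xb = x) (xb0 : 0 ≤ xb) (xb1 : xb ≤ 1)
    (z0 : 0 ≤ z) (z1 : z ≤ 1) (hz : z ≠ 0) {σ : ℝ} (hσ : 0 < σ)
    (hgap : ∀ t : A →ₗ[ℝ] ℝ, IsTr t → t xb + σ * t 1 ≤ t z) {ε : ℝ} (hε : 0 < ε) :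
    ∀ᶠ i in (F : Filter I), ∃ y : A, ‖(y * z) * star (y * z) - L x i‖ ≤ ε := by
  have := H.fd
  have xsa : IsSelfAdjoint x := IsSelfAdjoint.of_nonneg x0
  have zsa : IsSelfAdjoint z := IsSelfAdjoint.of_nonneg z0
  have xn := norm_le_one_of x0 x1
  have hδ : 0 < ε / 2 := by positivity
  obtain ⟨δ, hδd⟩ : ∃ δ, δ = ε / 2 := ⟨_, rfl⟩
  rw [← hδd] at hδ
  obtain ⟨δ', d0, hd⟩ := half_compare H hs xsa xn hxb xb0 xb1 z0 z1 hz hσ hgap hδ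
  obtain ⟨η, h0, h1, h2⟩ : ∃ η > 0, η ≤ 1 ∧ 12 * η ≤ ε / 2 :=
    ⟨min 1 (ε / 24), by positivity, min_le_left _ _, by linarith [min_le_right 1 (ε / 24)]⟩
  obtain ⟨r, r0, r1, rt⟩ := rho_exists z0 (t := η * δ' / 2) (by positivity)
  have hLk := H.Lk z
  rw [← map_mul] at hLk
  filter_upwards [hd, asy_ev hLk (show 0 < η * δ' / 2 by positivity), H.bounds x0 hδ] with i ⟨u, hu, hu1, hu2⟩ i2 i3
  have cfin := fd_finite_spectrum (C i) (H.Lmem x i)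
  have zfin := fd_finite_spectrum (C i) (H.Lmem z i)
  have csa := H.Lsa xsa i
  set c := L x i with hc
  set ζ := r * z with hζ
  have ζs : star ζ = ζ := (IsSelfAdjoint.of_nonneg r0).star_eq
  set P := chi δ' (L z i) with hP
  have hPW : pinv δ' (L z i) * L z i = P := pinv_mul zfin (H.Lsa zsa i) d0
  have Qp : IsStarProjection (chi δ c) := chi_proj cfin
  have un : ‖u‖ ≤ 1 := by
    have : ‖u * star u‖ ≤ 1 := by rw [hu1]; exact proj_norm_le Qp
    rw [CStarRing.norm_self_mul_star] at this
    nlinarith [norm_nonneg u]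
  have n1 : ‖u * (1 - ζ)‖ ≤ η := by
    have e : u * (1 - ζ) = u * pinv δ' (L z i) * (L z i * (1 - ζ)) := by
      conv_lhs => rw [← hu2, ← hPW]
      noncomm_ring
    have n2 : ‖L z i * (1 - ζ)‖ ≤ η * δ' := by
      have e2 : L z i * (1 - ζ) = (L z i - k i * z) * (1 - ζ) + k i * (z * (1 - ζ)) := by noncomm_ring
      have n3 : ‖1 - ζ‖ ≤ 1 := norm_le_one_of (sub_nonneg.2 r1) (sub_le_self _ r0)
      have n4 : ‖k i‖ ≤ 1 := norm_le_one_of (H.k0 i) (H.k1 i)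
      simp only [Bd.mul_apply, cst_apply] at i2
      rw [e2]
      calc _ ≤ ‖L z i - k i * z‖ * ‖1 - ζ‖ + ‖k i‖ * ‖z * (1 - ζ)‖ :=
            (norm_add_le _ _).trans (add_le_add (norm_mul_le _ _) (norm_mul_le _ _))
        _ ≤ (η * δ' / 2) * 1 + 1 * (η * δ' / 2) := by gcongr
        _ = η * δ' := by ring
    rw [e]
    calc _ ≤ ‖u‖ * ‖pinv δ' (L z i)‖ * ‖L z i * (1 - ζ)‖ := (norm_mul_le _ _).trans (by gcongr; exact norm_mul_le _ _)
      _ ≤ 1 * δ'⁻¹ * (η * δ') := by gcongr; exact pinv_norm d0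
      _ = η := by field_simp
  have n2 : ‖u * ζ * star (u * ζ) - chi δ c‖ ≤ 3 * η := by
    rw [← hu1]
    set d := u * (1 - ζ) with hd
    have e : u * ζ = u - d := by rw [hd]; noncomm_ring
    have e2 : (u - d) * star (u - d) - u * star u = d * star d - u * star d - d * star u := by
      rw [star_sub]; noncomm_ring
    rw [e, e2]
    calc _ ≤ ‖d‖ * ‖d‖ + ‖u‖ * ‖d‖ + ‖d‖ * ‖u‖ := by
          refine (norm_sub_le _ _).trans (add_le_add ((norm_sub_le _ _).trans (add_le_add ?_ ?_)) ?_)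
          · exact (norm_mul_le _ _).trans (by rw [norm_star])
          · exact (norm_mul_le _ _).trans (by rw [norm_star])
          · exact (norm_mul_le _ _).trans (by rw [norm_star])
      _ ≤ η * 1 + 1 * η + η * 1 := by gcongr; exact n1.trans h1
      _ = 3 * η := by ring
  -- the square root
  set R := cfc (fun s : ℝ => if δ ≤ s then Real.sqrt s else 0) c with hR
  have Rs : star R = R := fc_sa _ _
  have RQ : R * chi δ c * R = c * chi δ c := by
    have e1 : R * chi δ c = R := fc_mul (fin_cont cfin _) (fin_cont cfin _) (fun s _ => by split_ifs <;> simp)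
    rw [e1]
    have e2 : R * R = cfc (fun s : ℝ => s * if δ ≤ s then (1:ℝ) else 0) c :=
      fc_mul (fin_cont cfin _) (fin_cont cfin _) (fun s _ => by
        split_ifs with h
        · rw [Real.mul_self_sqrt (by linarith), mul_one]
        · simp)
    rw [e2]
    conv_rhs => enter [1]; rw [← fc_id csa]
    exact (fc_mul (fin_cont cfin _) (fin_cont cfin _) (fun s _ => rfl)).symm
  have Rn : ‖R‖ ≤ 2 := by
    refine norm_cfc_le (by norm_num) fun s hs => ?_
    have : ‖s‖ ≤ ‖c‖ * ‖(1:A)‖ := spectrum.norm_le_norm_mul_of_mem hs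
    have h1n : ‖(1:A)‖ ≤ 1 := norm_le_one_of zero_le_one le_rfl
    have h3 : ‖c‖ ≤ 2 := (H.Lnorm x i).trans (by linarith)
    have h4 : ‖s‖ ≤ 2 := this.trans (by nlinarith [norm_nonneg (1:A), norm_nonneg c])
    split_ifs with h
    · rw [Real.norm_of_nonneg (Real.sqrt_nonneg _)]
      rw [Real.sqrt_le_left (by norm_num)]
      have := Real.le_norm_self s
      linarith
    · simp
  refine ⟨R * u * r, ?_⟩
  have e1 : R * u * r * z = R * (u * ζ) := by rw [hζ]; noncomm_ring
  have e2 : R * (u * ζ) * star (R * (u * ζ)) - c * chi δ c = R * (u * ζ * star (u * ζ) - chi δ c) * star R := by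
    rw [star_mul R, mul_sub, sub_mul, Rs, RQ]; noncomm_ring
  have n3 : ‖R * (u * ζ) * star (R * (u * ζ)) - c * chi δ c‖ ≤ 12 * η := by
    rw [e2]
    calc _ ≤ _ := norm_conj_le _ _
      _ ≤ 2 * (3 * η) * 2 := by gcongr
      _ = 12 * η := by ring
  have n4 : ‖c * (1 - chi δ c)‖ ≤ δ := norm_mul_one_sub_chi cfin csa hδ.le i3.1
  rw [e1]
  have e3 : R * (u * ζ) * star (R * (u * ζ)) - c = (R * (u * ζ) * star (R * (u * ζ)) - c * chi δ c) - c * (1 - chi δ c) := by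
    noncomm_ring
  rw [e3]
  exact (norm_sub_le _ _).trans (by linarith)

lemma comp_lemma (hs : IsSimpleCStarAlgebra A) (hw : WeakCRLeOne A) {x xb z z' : A}
    (x0 : 0 ≤ x) (x1 : x ≤ 1) (hxb : x * xb = x) (xb0 : 0 ≤ xb) (xb1 : xb ≤ 1)
    (z0 : 0 ≤ z) (z1 : z ≤ 1) (hz : z ≠ 0) (z0' : 0 ≤ z') (z1' : z' ≤ 1) (hz' : z' ≠ 0)
    (hzz : z * z' = 0) {σ : ℝ} (hσ : 0 < σ)
    (hgap : ∀ t : A →ₗ[ℝ] ℝ, IsTr t → t xb + σ * t 1 ≤ t z)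
    (hgap' : ∀ t : A →ₗ[ℝ] ℝ, IsTr t → t xb + σ * t 1 ≤ t z') {ε : ℝ} (hε : 0 < ε) :
    ∃ y y' : A, ‖(y * z + y' * z') * star (y * z + y' * z') - x‖ < ε := by
  obtain ⟨I, F, C, D, k, l, L, M, h⟩ := exists_model hw
  have e : asy (F : Filter I) (L x + M x) = asy (F : Filter I) (cst I x) := by
    rw [map_add, h.hC.Lk, h.hD.Lk, ← add_mul, h.sum, one_mul]
  obtain ⟨i, ⟨y, hy⟩, ⟨y', hy'⟩, i3⟩ := ((half_v h.hC hs x0 x1 hxb xb0 xb1 z0 z1 hz hσ hgap (show 0 < ε / 4 by positivity)).and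
    ((half_v h.hD hs x0 x1 hxb xb0 xb1 z0' z1' hz' hσ hgap' (show 0 < ε / 4 by positivity)).and
    (asy_ev e (show 0 < ε / 4 by positivity)))).exists
  refine ⟨y, y', ?_⟩
  have zs : star z = z := (IsSelfAdjoint.of_nonneg z0).star_eq
  have zs' : star z' = z' := (IsSelfAdjoint.of_nonneg z0').star_eq
  have hzz' : z' * z = 0 := by
    have := congrArg star hzz
    rwa [star_mul, zs, zs', star_zero] at this
  have e1 : (y * z) * star (y' * z') = 0 := by
    rw [star_mul, zs']
    have : y * z * (z' * star y') = y * (z * z') * star y' := by noncomm_ring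
    rw [this, hzz]; simp
  have e2 : (y' * z') * star (y * z) = 0 := by
    rw [star_mul, zs]
    have : y' * z' * (z * star y) = y' * (z' * z) * star y := by noncomm_ring
    rw [this, hzz']; simp
  have e3 : (y * z + y' * z') * star (y * z + y' * z') - x =
      ((y * z) * star (y * z) - L x i) + ((y' * z') * star (y' * z') - M x i) + ((L x + M x) i - cst I x i) := by
    rw [star_add, mul_add, add_mul, add_mul, e1, e2]
    simp only [Bd.add_apply, cst_apply]
    abel
  rw [e3]
  have := norm_add₃_le (a := (y * z) * star (y * z) - L x i) (b := (y' * z') * star (y' * z') - M x i) (c := (L x + M x) i - cst I x i)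
  linarith

end Part10
end PartFile10

section PartFile11
set_option linter.unusedSectionVars false
set_option linter.unusedVariables false
open Filter Topology

section Part11
variable {A : Type u} [CStarAlgebra A] [PartialOrder A] [StarOrderedRing A]
variable {I : Type*}

lemma isUnit_of_ge {e : A} {r : ℝ} (hr : 0 < r) (h : r • (1 : A) ≤ e) : IsUnit e := by
  have h2 : IsStrictlyPositive (r • (1 : A)) := by
    rw [← Algebra.algebraMap_eq_smul_one]
    exact IsStrictlyPositive.iff_of_unital.2 ⟨by
      rw [Algebra.algebraMap_eq_smul_one]; exact smul_nonneg hr.le zero_le_one, (isUnit_iff_ne_zero.2 hr.ne').map (algebraMap ℝ A)⟩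
  exact CStarAlgebra.isUnit_of_le _ h h2

lemma proj_transfer {p w : A} (pp : IsStarProjection p) (hpw : p * w = w) {r : ℝ} (hr : 0 < r)
    (h : r • p ≤ w * star w) :
    ∃ q s : A, IsStarProjection q ∧ q = s * w ∧ w * q = w ∧ ∀ t : A →ₗ[ℝ] ℝ, IsTr t → t q = t p := by
  set e := w * star w + (1 - p) with he
  have h1 : (min r 1) • (1 : A) ≤ e := by
    have a1 : (min r 1) • p ≤ r • p := smul_le_smul_of_nonneg_right (min_le_left _ _) pp.nonneg
    have a2 : (min r 1) • (1 - p) ≤ (1:ℝ) • (1 - p) :=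
      smul_le_smul_of_nonneg_right (min_le_right _ _) (sub_nonneg.2 pp.le_one)
    rw [one_smul] at a2
    calc (min r 1) • (1 : A) = (min r 1) • p + (min r 1) • (1 - p) := by rw [← smul_add]; simp
      _ ≤ _ := add_le_add (a1.trans h) a2
  obtain ⟨v, hv⟩ := isUnit_of_ge (by positivity) h1
  set f := (↑v⁻¹ : A) with hf
  have ef : e * f = 1 := by rw [← hv]; exact v.mul_inv
  have fe : f * e = 1 := by rw [← hv]; exact v.inv_mul
  have es : star e = e := by
    rw [he, star_add, star_mul, star_star, star_sub, star_one, proj_star pp]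
  have fs : star f = f := by
    have : star f * e = 1 := by
      have := congrArg star ef
      rwa [star_mul, es, star_one] at this
    calc star f = star f * (e * f) := by rw [ef, mul_one]
      _ = f := by rw [← mul_assoc, this, one_mul]
  have hwp : star w * p = star w := by
    have := congrArg star hpw
    rwa [star_mul, proj_star pp] at this
  have p2 := proj_sq pp
  have ew : p * e = w * star w := by
    rw [he, mul_add, ← mul_assoc, hpw, mul_sub, p2]; simp
  have we : e * p = w * star w := by
    rw [he, add_mul, mul_assoc, hwp, sub_mul, p2]; simp
  have mf : w * star w * f = p := by rw [← ew, mul_assoc, ef, mul_one]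
  refine ⟨star w * f * w, star w * f, ⟨?_, ?_⟩, rfl, ?_, ?_⟩
  · change star w * f * w * (star w * f * w) = _
    calc _ = star w * f * (w * star w * f) * w := by noncomm_ring
      _ = star w * f * (p * w) := by rw [mf]; noncomm_ring
      _ = _ := by rw [hpw]
  · rw [isSelfAdjoint_iff, star_mul, star_mul, star_star, fs, mul_assoc]
  · calc _ = w * star w * f * w := by noncomm_ring
      _ = w := by rw [mf, hpw]
  · intro t ht
    rw [mul_assoc, ht.tr]
    have : f * w * star w = p := by
      rw [mul_assoc, ← we, ← mul_assoc, fe, one_mul]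
    rw [this]

lemma mul_eq_zero_of_sqrt {b g : A} (hb : 0 ≤ b) (h : b * g = 0) : CFC.sqrt b * g = 0 := by
  set w := CFC.sqrt b
  have ws : star w = w := (IsSelfAdjoint.of_nonneg (CFC.sqrt_nonneg b)).star_eq
  have hww : w * w = b := CFC.sqrt_mul_sqrt_self b
  rw [← CStarRing.star_mul_self_eq_zero_iff, star_mul, ws]
  calc star g * w * (w * g) = star g * (w * w * g) := by noncomm_ring
    _ = 0 := by rw [hww, h, mul_zero]

lemma mul_eq_zero_of_le {f g h : A} (g0 : 0 ≤ g) (hgh : g ≤ h) (hf : h * f = 0) : g * f = 0 := by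
  have h1 : star f * g * f ≤ star f * h * f := conj_le hgh
  rw [mul_assoc _ h, hf, mul_zero] at h1
  have h2 : 0 ≤ star f * g * f := star_left_conjugate_nonneg g0 f
  have h3 : star f * g * f = 0 := le_antisymm h1 h2
  set w := CFC.sqrt g
  have ws : star w = w := (IsSelfAdjoint.of_nonneg (CFC.sqrt_nonneg g)).star_eq
  have hww : w * w = g := CFC.sqrt_mul_sqrt_self g
  have h4 : w * f = 0 := by
    rw [← CStarRing.star_mul_self_eq_zero_iff, star_mul, ws]
    rw [← hww] at h3
    rw [← h3]; noncomm_ring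
  rw [← hww, mul_assoc, h4, mul_zero]

lemma star_zero_swap {f g : A} (hf : IsSelfAdjoint f) (hg : IsSelfAdjoint g) (h : f * g = 0) : g * f = 0 := by
  have := congrArg star h
  rwa [star_mul, hf.star_eq, hg.star_eq, star_zero] at this

/-- bump functions -/
lemma cfc_ne_zero {a : A} (ha : IsSelfAdjoint a) {f : ℝ → ℝ} (hf : Continuous f) {s : ℝ}
    (hs : s ∈ spectrum ℝ a) (h : f s ≠ 0) : cfc f a ≠ 0 := by
  intro h0
  have h1 : f s ∈ spectrum ℝ (cfc f a) := by
    rw [cfc_map_spectrum f a ha hf.continuousOn]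
    exact ⟨s, hs, rfl⟩
  rw [h0] at h1
  have : Nontrivial A := by
    by_contra hn
    rw [not_nontrivial_iff_subsingleton] at hn
    rw [spectrum.of_subsingleton] at h1
    exact h1
  rw [spectrum.zero_eq] at h1
  exact h h1

lemma split_of_two {b c : A} (hb : 0 ≤ b) (hc : IsSelfAdjoint c) {l m : ℝ}
    (hl : l ∈ spectrum ℝ (CFC.sqrt b * c * CFC.sqrt b)) (hm : m ∈ spectrum ℝ (CFC.sqrt b * c * CFC.sqrt b))
    (l0 : l ≠ 0) (m0 : m ≠ 0) (hlm : l ≠ m) :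
    ∃ f f' : A, 0 ≤ f ∧ 0 ≤ f' ∧ f ≠ 0 ∧ f' ≠ 0 ∧ f * f' = 0 ∧ f + f' ≤ b := by
  set w := CFC.sqrt b with hw
  have wsa : IsSelfAdjoint w := IsSelfAdjoint.of_nonneg (CFC.sqrt_nonneg b)
  have ws : star w = w := wsa.star_eq
  have hww : w * w = b := CFC.sqrt_mul_sqrt_self b
  set a := w * c * w with ha
  have asa : IsSelfAdjoint a := by
    rw [isSelfAdjoint_iff, ha, star_mul, star_mul, ws, hc.star_eq, mul_assoc]
  set d := |l - m| / 2 with hd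
  have hd0 : 0 < d := by have := abs_pos.2 (sub_ne_zero.2 hlm); positivity
  let g : ℝ → ℝ → ℝ := fun x s => max 0 (d - |s - x|)
  have gc : ∀ x, Continuous (g x) := fun x => by simp only [g]; fun_prop
  have g0 : ∀ x s, 0 ≤ g x s := fun x s => le_max_left _ _
  have gx : ∀ x, g x x = d := fun x => by simp [g, hd0.le]
  have gg : ∀ s, g l s * g m s = 0 := by
    intro s
    by_contra hne
    have h1 : 0 < d - |s - l| := by
      by_contra h; exact hne (by simp [g, max_eq_left (not_lt.1 h)])
    have h2 : 0 < d - |s - m| := by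
      by_contra h; exact hne (by simp [g, max_eq_left (not_lt.1 h)])
    have h3 := abs_sub_le l s m
    rw [abs_sub_comm l s] at h3
    linarith
  let f : ℝ → A := fun x => cfc (fun s => s * g x s * s) a
  have fcx : ∀ x, Continuous (fun s => s * g x s * s) := fun x => by
    have := gc x
    fun_prop
  have f0 : ∀ x, 0 ≤ f x := fun x => cfc_nonneg fun s _ => by
    have := g0 x s; nlinarith [mul_nonneg this (mul_self_nonneg s)]
  have fe : ∀ x, f x = w * (c * w * cfc (g x) a * w * c) * w := by
    intro x
    have e1 : a * cfc (g x) a * a = f x := by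
      conv_lhs => enter [2]; rw [← fc_id asa]
      conv_lhs => enter [1, 1]; rw [← fc_id asa]
      rw [fc_mul (e := fun s => s * g x s) (by fun_prop) (gc x).continuousOn (fun s _ => rfl)]
      exact fc_mul (by have := gc x; fun_prop) (by fun_prop) (fun s _ => rfl)
    rw [← e1]
    conv_lhs => enter [2]; rw [ha]
    conv_lhs => enter [1, 1]; rw [ha]
    noncomm_ring
  have fn : ∀ x ∈ spectrum ℝ a, x ≠ 0 → f x ≠ 0 := fun x hx hx0 =>
    cfc_ne_zero asa (fcx x) hx (by rw [gx]; positivity)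
  have ff : f l * f m = 0 := by
    have : f l * f m = cfc (fun _ => (0:ℝ)) a := fc_mul (fcx l).continuousOn (fcx m).continuousOn (fun s _ => by
      have := gg s
      linear_combination s^4 * this)
    rw [this]; simp
  set X := c * w * cfc (g l) a * w * c + c * w * cfc (g m) a * w * c with hX
  have Xsa : IsSelfAdjoint X := by
    have h1 : ∀ x, star (c * w * cfc (g x) a * w * c) = c * w * cfc (g x) a * w * c := by
      intro x
      simp only [star_mul, ws, hc.star_eq, (fc_sa (g x) a).star_eq, mul_assoc]
    rw [isSelfAdjoint_iff, hX, star_add, h1, h1]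
  have hsum : f l + f m = w * X * w := by rw [fe, fe, hX]; noncomm_ring
  have hle : f l + f m ≤ (‖X‖ + 1) • b := by
    rw [hsum]
    have h1 := conj_sa_le wsa (le_smul_one Xsa (show ‖X‖ ≤ ‖X‖ + 1 by linarith))
    rwa [mul_smul_comm, mul_one, smul_mul_assoc, hww] at h1
  have hN : 0 < ‖X‖ + 1 := by positivity
  set N := ‖X‖ + 1
  refine ⟨N⁻¹ • f l, N⁻¹ • f m, smul_nonneg (by positivity) (f0 l), smul_nonneg (by positivity) (f0 m),
    smul_ne_zero (by positivity) (fn l hl l0), smul_ne_zero (by positivity) (fn m hm m0), ?_, ?_⟩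
  · rw [smul_mul_smul_comm, ff, smul_zero]
  · rw [← smul_add]
    have := smul_le_smul_of_nonneg_left hle (show 0 ≤ N⁻¹ by positivity)
    rwa [smul_smul, inv_mul_cancel₀ hN.ne', one_smul] at this

lemma sq_of_one {a : A} (ha : IsSelfAdjoint a)
    (h : ∀ l ∈ spectrum ℝ a, ∀ m ∈ spectrum ℝ a, l ≠ 0 → m ≠ 0 → l = m) : ∃ l : ℝ, a * a = l • a := by
  by_cases h1 : ∃ l ∈ spectrum ℝ a, l ≠ 0
  · obtain ⟨l, hl, l0⟩ := h1
    refine ⟨l, ?_⟩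
    have e1 : a * a = cfc (fun s : ℝ => l * s) a := by
      conv_lhs => rw [← fc_id ha]
      refine fc_mul (by fun_prop) (by fun_prop) fun s hs => ?_
      by_cases s0 : s = 0
      · simp [s0]
      · rw [h s hs l hl s0 l0]
    rw [e1, cfc_const_mul _ _ _ (by fun_prop), fc_id ha]
  · push Not at h1
    refine ⟨0, ?_⟩
    conv_lhs => rw [← fc_id ha]
    rw [fc_mul (e := fun _ => (0:ℝ)) (by fun_prop) (by fun_prop) (fun s hs => by rw [h1 s hs, mul_zero])]
    simp

lemma split_or_fd (hs : IsSimpleCStarAlgebra A) (hfd : ¬ FiniteDimensional ℂ A) {b : A} (hb : 0 ≤ b) (hb0 : b ≠ 0) :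
    ∃ f f' : A, 0 ≤ f ∧ 0 ≤ f' ∧ f ≠ 0 ∧ f' ≠ 0 ∧ f * f' = 0 ∧ f + f' ≤ b := by
  by_contra hcon
  apply hfd
  set w := CFC.sqrt b with hw
  have wsa : IsSelfAdjoint w := IsSelfAdjoint.of_nonneg (CFC.sqrt_nonneg b)
  have ws : star w = w := wsa.star_eq
  have hww : w * w = b := CFC.sqrt_mul_sqrt_self b
  have bsa : IsSelfAdjoint b := IsSelfAdjoint.of_nonneg hb
  have asa : ∀ c, IsSelfAdjoint c → IsSelfAdjoint (w * c * w) := fun c hc => by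
    rw [isSelfAdjoint_iff, star_mul, star_mul, ws, hc.star_eq, mul_assoc]
  have key : ∀ c, IsSelfAdjoint c → ∃ l : ℝ, (w * c * w) * (w * c * w) = l • (w * c * w) := fun c hc =>
    sq_of_one (asa c hc) (fun l hl m hm l0 m0 => by
      by_contra hlm
      exact hcon (split_of_two hb hc hl hm l0 m0 hlm))
  obtain ⟨l, hl⟩ := key 1 (IsSelfAdjoint.one A)
  rw [mul_one, hww] at hl
  have l0 : l ≠ 0 := by
    rintro rfl
    rw [zero_smul] at hl
    apply hb0
    rw [← CStarRing.star_mul_self_eq_zero_iff, bsa.star_eq, hl]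
  set p := l⁻¹ • b with hp
  have p2 : p * p = p := by
    rw [hp, smul_mul_smul_comm, hl, smul_smul]; congr 1; field_simp
  have p0 : p ≠ 0 := smul_ne_zero (inv_ne_zero l0) hb0
  have psa : star p = p := by rw [hp, star_smul, bsa.star_eq, star_trivial]
  have pkey : ∀ c, IsSelfAdjoint c → ∃ m : ℝ, (p * c * p) * (p * c * p) = m • (p * c * p) := by
    intro c hc
    have e : p * c * p = w * ((l⁻¹ * l⁻¹) • (w * c * w)) * w := by
      rw [hp]; simp only [smul_mul_assoc, mul_smul_comm, smul_smul]
      rw [← hww]; congr 1; noncomm_ring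
    rw [e]
    exact key _ (by rw [isSelfAdjoint_iff, star_smul, (asa c hc).star_eq, star_trivial])
  clear_value p
  have pr : ∀ c, IsSelfAdjoint c → ∃ m : ℝ, p * c * p = m • p := by
    intro c hc
    obtain ⟨m, hm⟩ := pkey c hc
    set x := p * c * p with hx
    have px : p * x = x := by rw [hx, ← mul_assoc, ← mul_assoc, p2]
    have xp : x * p = x := by rw [hx, mul_assoc, p2]
    have sh : ∀ r : ℝ, r ≠ 0 → (∃ m : ℝ, x = m • p) ∨ m = - r := by
      intro r hr
      obtain ⟨n, hn⟩ := pkey (c + r • 1) (hc.add (by rw [isSelfAdjoint_iff, star_smul, star_one, star_trivial]))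
      have e : p * (c + r • 1) * p = x + r • p := by
        rw [mul_add, add_mul, mul_smul_comm, mul_one, smul_mul_assoc, p2]
      have e2 : (x + r • p) * (x + r • p) = x * x + r • x + r • x + (r * r) • p := by
        rw [mul_add, add_mul, add_mul, smul_mul_smul_comm, mul_smul_comm, smul_mul_assoc, px, xp, p2]; abel
      rw [e, e2, hm] at hn
      have e3 : (m + 2 * r - n) • x = (n * r - r * r) • p := by
        have : m • x + r • x + r • x + (r * r) • p - n • (x + r • p) = 0 := by rw [hn, sub_self]
        rw [← sub_eq_zero, ← this]
        module
      by_cases h : m + 2 * r - n = 0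
      · right
        rw [h, zero_smul] at e3
        have := (smul_eq_zero.1 e3.symm).resolve_right p0
        have h5 : n = r := by
          have : (n - r) * r = 0 := by linarith
          have := (mul_eq_zero.1 this).resolve_right hr
          linarith
        linarith
      · left
        refine ⟨(m + 2 * r - n)⁻¹ * (n * r - r * r), ?_⟩
        rw [mul_smul, ← e3, smul_smul, inv_mul_cancel₀ h, one_smul]
    rcases sh 1 one_ne_zero with h | h
    · exact h
    · rcases sh 2 two_ne_zero with h' | h'
      · exact h'
      · linarith
  have pc : ∀ c, ∃ m : ℂ, p * c * p = m • p := by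
    intro c
    obtain ⟨m, hm⟩ := pr (realPart c) (realPart c).2
    obtain ⟨n, hn⟩ := pr (imaginaryPart c) (imaginaryPart c).2
    refine ⟨m + Complex.I * n, ?_⟩
    conv_lhs => rw [← realPart_add_I_smul_imaginaryPart c]
    rw [mul_add, add_mul, hm, mul_smul_comm, smul_mul_assoc, hn, add_smul, mul_smul]
    simp
  obtain ⟨n, a, b', hab⟩ := simple_sum hs p0
  have : (⊤ : Submodule ℂ A) = Submodule.span ℂ (Set.range fun z : Fin n × Fin n => a z.1 * p * b' z.2) := by
    symm
    rw [eq_top_iff]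
    intro x _
    have e : x = ∑ i, ∑ j, a i * (p * (b' i * x * a j) * p) * b' j := by
      conv_lhs => rw [← one_mul x, ← mul_one (1 * x), hab]
      rw [Finset.sum_mul, Finset.sum_mul]
      refine Finset.sum_congr rfl fun i _ => ?_
      rw [Finset.mul_sum]
      refine Finset.sum_congr rfl fun j _ => ?_
      noncomm_ring
    rw [e]
    refine Submodule.sum_mem _ fun i _ => Submodule.sum_mem _ fun j _ => ?_
    obtain ⟨m, hm⟩ := pc (b' i * x * a j)
    rw [hm, mul_smul_comm, smul_mul_assoc]
    exact Submodule.smul_mem _ _ (Submodule.subset_span ⟨(i, j), rfl⟩)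
  have hfin : (⊤ : Submodule ℂ A).FG := by
    rw [this]
    exact Submodule.fg_span (Set.finite_range _)
  exact Module.finite_def.2 hfin

lemma split_n (hs : IsSimpleCStarAlgebra A) (hfd : ¬ FiniteDimensional ℂ A) (n : ℕ) :
    ∀ {b : A}, 0 ≤ b → b ≠ 0 → ∃ f : Fin n → A, (∀ j, 0 ≤ f j) ∧ (∀ j, f j ≠ 0) ∧
      (∀ i j, i ≠ j → f i * f j = 0) ∧ ∑ j, f j ≤ b := by
  induction n with
  | zero => intro b hb _; exact ⟨fun j => j.elim0, fun j => j.elim0, fun j => j.elim0, fun j => j.elim0, by simpa using hb⟩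
  | succ n ih =>
    intro b hb hb0
    obtain ⟨f, f', h1, h2, h3, h4, h5, h6⟩ := split_or_fd hs hfd hb hb0
    obtain ⟨g, g0, gn, gg, gs⟩ := ih h2 h4
    have gle : ∀ j, g j ≤ f' := fun j =>
      (Finset.single_le_sum (fun i _ => g0 i) (Finset.mem_univ j)).trans gs
    have f'f := star_zero_swap (IsSelfAdjoint.of_nonneg h1) (IsSelfAdjoint.of_nonneg h2) h5
    have gf : ∀ j, g j * f = 0 := fun j => mul_eq_zero_of_le (g0 j) (gle j) f'f
    have fg : ∀ j, f * g j = 0 := fun j => star_zero_swap (IsSelfAdjoint.of_nonneg (g0 j)) (IsSelfAdjoint.of_nonneg h1) (gf j)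
    refine ⟨Fin.cons f g, ?_, ?_, ?_, ?_⟩
    · intro j; refine Fin.cases ?_ (fun j => ?_) j <;> simp [h1, g0]
    · intro j; refine Fin.cases ?_ (fun j => ?_) j <;> simp [h3, gn]
    · intro i j
      refine Fin.cases ?_ (fun i => ?_) i <;> refine Fin.cases ?_ (fun j => ?_) j
      · simp
      · intro _; simpa using fg j
      · intro _; simpa using gf i
      · intro h
        simp only [Fin.cons_succ]
        exact gg i j (fun h' => h (by rw [h']))
    · rw [Fin.sum_univ_succ]
      simp only [Fin.cons_zero, Fin.cons_succ]
      exact (add_le_add le_rfl gs).trans h6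

end Part11
end PartFile11

section PartFile12
set_option linter.unusedSectionVars false
set_option linter.unusedVariables false
open Filter Topology

section Part12
variable {A : Type u} [CStarAlgebra A] [PartialOrder A] [StarOrderedRing A]
variable {I : Type*}

/-- minimal projections of a finite-dimensional algebra -/
structure MinP (C : NonUnitalStarSubalgebra ℂ A) (e : A) : Prop where
  mem : e ∈ C
  proj : IsStarProjection e
  ne : e ≠ 0
  pos : ∀ m ∈ C, 0 ≤ m → e * m = m → m = ‖m‖ • e

lemma minP_of_min (C : NonUnitalStarSubalgebra ℂ A) [FiniteDimensional ℂ C] {p : A} (hp : p ∈ C)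
    (pp : IsStarProjection p) (hp0 : p ≠ 0)
    (hmin : ∀ f ∈ C, IsStarProjection f → f ≠ 0 → p * f = f → f = p) : MinP C p := by
  refine ⟨hp, pp, hp0, fun m hm m0 hpm => ?_⟩
  by_contra hne
  have msa := IsSelfAdjoint.of_nonneg m0
  have hmp : m * p = m := by
    have := congrArg star hpm
    rwa [star_mul, msa.star_eq, proj_star pp] at this
  obtain ⟨m', hm'⟩ : ∃ m', m' = ‖m‖ • p - m := ⟨_, rfl⟩
  have m'C : m' ∈ C := hm' ▸ sub_mem (rsmul_mem _ _ hp) hm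
  have h1 : m ≤ ‖m‖ • p := by
    have := proj_conj_le pp (le_smul_one msa le_rfl)
    rwa [hpm, hmp] at this
  have m'0 : 0 ≤ m' := hm' ▸ sub_nonneg.2 h1
  have m'n : m' ≠ 0 := fun h => hne (by rw [hm', sub_eq_zero] at h; exact h.symm)
  have m'sa := IsSelfAdjoint.of_nonneg m'0
  have hfin := fd_finite_spectrum C m'C
  have hpos : 0 < ‖m'‖ := norm_pos_iff.2 m'n
  have pm' : p * m' = m' := by rw [hm', mul_sub, mul_smul_comm, proj_sq pp, hpm]
  have m'p : m' * p = m' := by rw [hm', sub_mul, smul_mul_assoc, proj_sq pp, hmp]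
  have hf := hmin (chi (‖m'‖ / 2) m') (chi_mem C m'C m'sa (by positivity)) (chi_proj hfin)
    (chi_ne_zero m'0 m'n hfin) (by
      rw [← mul_pinv hfin m'sa (by positivity), ← mul_assoc, pm'])
  have h2 := chi_conj_ge (θ := ‖m'‖ / 2) hfin m'sa
  rw [hf, pm', m'p] at h2
  have h3 : ‖m'‖ ≤ ‖m‖ := by
    refine norm_le_of_nonneg_le m'0 (norm_nonneg _) ?_
    calc m' ≤ ‖m‖ • p := by rw [hm']; exact sub_le_self _ m0
      _ ≤ _ := smul_le_smul_of_nonneg_left pp.le_one (norm_nonneg _)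
  have h4 : m ≤ (‖m‖ - ‖m'‖ / 2) • (1 : A) := by
    calc m = ‖m‖ • p - m' := by rw [hm']; abel
      _ ≤ ‖m‖ • p - (‖m'‖ / 2) • p := sub_le_sub_left h2 _
      _ = (‖m‖ - ‖m'‖ / 2) • p := by rw [sub_smul]
      _ ≤ _ := smul_le_smul_of_nonneg_left pp.le_one (by linarith)
  have h5 := norm_le_of_nonneg_le m0 (by linarith) h4
  linarith

lemma exists_minP (C : NonUnitalStarSubalgebra ℂ A) [FiniteDimensional ℂ C] (n : ℕ) :
    ∀ {p : A}, p ∈ C → IsStarProjection p → p ≠ 0 → rk C p ≤ n → ∃ e, MinP C e ∧ p * e = e := by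
  induction n with
  | zero =>
    intro p hp pp hp0 h
    exact absurd (rk_lt C (proj_sq pp) (proj_sq pp) hp pp hp0) (by omega)
  | succ n ih =>
    intro p hp pp hp0 h
    by_cases hm : ∀ f ∈ C, IsStarProjection f → f ≠ 0 → p * f = f → f = p
    · exact ⟨p, minP_of_min C hp pp hp0 hm, proj_sq pp⟩
    · push Not at hm
      obtain ⟨f, hf, pf, f0, hpf, hne⟩ := hm
      have hfp := proj_mul_star pp pf hpf
      have h1 : rk C (p - (p - f)) < rk C p := rk_lt C (by rw [mul_sub, proj_sq pp, hpf])
        (by rw [sub_mul, proj_sq pp, hfp]) (sub_mem hp hf) (proj_sub pp pf hpf) (fun h => hne (sub_eq_zero.1 h).symm)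
      rw [sub_sub_cancel] at h1
      obtain ⟨e, he, hfe⟩ := ih hf pf f0 (by omega)
      exact ⟨e, he, by rw [← hfe, ← mul_assoc, hpf]⟩

/-- decomposition into minimal projections -/
lemma dec_exists (C : NonUnitalStarSubalgebra ℂ A) [FiniteDimensional ℂ C] (n : ℕ) :
    ∀ {p : A}, p ∈ C → IsStarProjection p → rk C p ≤ n → ∃ (N : ℕ) (e : Fin N → A),
      (∀ j, MinP C (e j)) ∧ (∀ i j, i ≠ j → e i * e j = 0) ∧ ∑ j, e j = p := by
  induction n with
  | zero =>
    intro p hp pp h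
    by_cases hp0 : p = 0
    · exact ⟨0, fun j => j.elim0, fun j => j.elim0, fun j => j.elim0, by simp [hp0]⟩
    · exact absurd (rk_lt C (proj_sq pp) (proj_sq pp) hp pp hp0) (by omega)
  | succ n ih =>
    intro p hp pp h
    by_cases hp0 : p = 0
    · exact ⟨0, fun j => j.elim0, fun j => j.elim0, fun j => j.elim0, by simp [hp0]⟩
    obtain ⟨f, hf, hpf⟩ := exists_minP C _ hp pp hp0 le_rfl
    have hfp := proj_mul_star pp hf.proj hpf
    have h1 : rk C (p - f) < rk C p := rk_lt C hpf hfp hf.mem hf.proj hf.ne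
    obtain ⟨N, e, h2, h3, h4⟩ := ih (sub_mem hp hf.mem) (proj_sub pp hf.proj hpf) (by omega)
    have key : ∀ j, (p - f) * e j = e j := by
      intro j
      rw [← h4, Finset.sum_mul, Finset.sum_eq_single j]
      · exact proj_sq (h2 j).proj
      · intro i _ hij; exact h3 i j hij
      · simp
    have fe : ∀ j, f * e j = 0 := by
      intro j
      rw [← key j, ← mul_assoc, mul_sub, hfp, proj_sq hf.proj, sub_self, zero_mul]
    have ef : ∀ j, e j * f = 0 := fun j =>
      star_zero_swap hf.proj.isSelfAdjoint (h2 j).proj.isSelfAdjoint (fe j)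
    refine ⟨N + 1, Fin.cons f e, ?_, ?_, ?_⟩
    · intro j; refine Fin.cases ?_ (fun j => ?_) j <;> simp [hf, h2]
    · intro i j
      refine Fin.cases ?_ (fun i => ?_) i <;> refine Fin.cases ?_ (fun j => ?_) j
      · simp
      · intro _; simpa using fe j
      · intro _; simpa using ef i
      · intro h
        simp only [Fin.cons_succ]
        exact h3 i j (fun h' => h (by rw [h']))
    · rw [Fin.sum_univ_succ]
      simp only [Fin.cons_zero, Fin.cons_succ]
      rw [h4]; abel

/-- equivalence of projections in `C` -/
def Eqv (C : NonUnitalStarSubalgebra ℂ A) (e f : A) : Prop :=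
  ∃ u ∈ C, u * star u = e ∧ star u * u = f

lemma Eqv.symm {C : NonUnitalStarSubalgebra ℂ A} {e f : A} (h : Eqv C e f) : Eqv C f e := by
  obtain ⟨u, h1, h2, h3⟩ := h
  exact ⟨star u, star_mem h1, by rw [star_star]; exact h3, by rw [star_star]; exact h2⟩

lemma Eqv.trans {C : NonUnitalStarSubalgebra ℂ A} {e f g : A} (pe : IsStarProjection e) (pg : IsStarProjection g)
    (h : Eqv C e f) (h' : Eqv C f g) : Eqv C e g := by
  obtain ⟨u, h1, h2, h3⟩ := h
  obtain ⟨v, k1, k2, k3⟩ := h'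
  refine ⟨u * v, mul_mem h1 k1, ?_, ?_⟩
  · rw [star_mul]
    calc _ = u * (v * star v) * star u := by noncomm_ring
      _ = u * star u * (u * star u) := by rw [k2, ← h3]; noncomm_ring
      _ = e := by rw [h2, proj_sq pe]
  · rw [star_mul]
    calc _ = star v * (star u * u) * v := by noncomm_ring
      _ = star v * v * (star v * v) := by rw [h3, ← k2]; noncomm_ring
      _ = g := by rw [k3, proj_sq pg]

lemma Eqv.tr {C : NonUnitalStarSubalgebra ℂ A} {e f : A} (h : Eqv C e f) {t : A →ₗ[ℝ] ℝ} (ht : IsTr t) :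
    t e = t f := by
  obtain ⟨u, h1, h2, h3⟩ := h
  rw [← h2, ← h3, ht.tr]

lemma eqv_of_ne {C : NonUnitalStarSubalgebra ℂ A} {e f x : A} (he : MinP C e) (hf : MinP C f)
    (hx : x ∈ C) (h : e * x * f ≠ 0) : Eqv C e f := by
  obtain ⟨w, hw⟩ : ∃ w, w = e * x * f := ⟨_, rfl⟩
  rw [← hw] at h
  have wC : w ∈ C := hw ▸ mul_mem (mul_mem he.mem hx) hf.mem
  have ew : e * w = w := by rw [hw, ← mul_assoc, ← mul_assoc, proj_sq he.proj]
  have wf : w * f = w := by rw [hw, mul_assoc, proj_sq hf.proj]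
  have fw : f * star w = star w := by
    have := congrArg star wf
    rwa [star_mul, proj_star hf.proj] at this
  have h1 := he.pos (w * star w) (mul_mem wC (star_mem wC)) (mul_star_self_nonneg w) (by rw [← mul_assoc, ew])
  have h2 := hf.pos (star w * w) (mul_mem (star_mem wC) wC) (star_mul_self_nonneg w) (by rw [← mul_assoc, fw])
  rw [CStarRing.norm_self_mul_star] at h1
  rw [CStarRing.norm_star_mul_self] at h2
  have hn : 0 < ‖w‖ := norm_pos_iff.2 h
  refine ⟨‖w‖⁻¹ • w, rsmul_mem _ _ wC, ?_, ?_⟩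
  · rw [star_smul, star_trivial, smul_mul_smul_comm, h1, smul_smul]
    rw [show ‖w‖⁻¹ * ‖w‖⁻¹ * (‖w‖ * ‖w‖) = 1 by field_simp, one_smul]
  · rw [star_smul, star_trivial, smul_mul_smul_comm, h2, smul_smul]
    rw [show ‖w‖⁻¹ * ‖w‖⁻¹ * (‖w‖ * ‖w‖) = 1 by field_simp, one_smul]

/-- greedy selection -/
lemma greedy {ι : Type*} [DecidableEq ι] (r : ι → ι → Prop) (rr : ∀ a, r a a) (rs : ∀ a b, r a b → r b a)
    (rt : ∀ a b c, r a b → r b c → r a c) {n : ℕ} (hn : 0 < n) (m : ℕ) :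
    ∀ S : Finset ι, S.card ≤ m → ∃ T R : Finset ι, T ⊆ S ∧ R ⊆ S ∧ (∀ a ∈ R, ∀ b ∈ R, r a b → a = b) ∧
      ∀ w : ι → ℝ, (∀ a, 0 ≤ w a) → (∀ a b, r a b → w a = w b) →
        ∑ a ∈ S, w a ≤ n * ∑ a ∈ T, w a ∧ n * ∑ a ∈ T, w a ≤ ∑ a ∈ S, w a + n * ∑ a ∈ R, w a := by
  classical
  induction m with
  | zero =>
    intro S hS
    have : S = ∅ := Finset.card_eq_zero.1 (by omega)
    subst this
    exact ⟨∅, ∅, by simp, by simp, by simp, by simp⟩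
  | succ m ih =>
    intro S hS
    by_cases hS0 : S.Nonempty
    swap
    · rw [Finset.not_nonempty_iff_eq_empty] at hS0
      subst hS0
      exact ⟨∅, ∅, by simp, by simp, by simp, by simp⟩
    obtain ⟨a, ha⟩ := hS0
    set K := S.filter (fun b => r a b) with hK
    have haK : a ∈ K := by simp [hK, ha, rr]
    have hKS : K ⊆ S := Finset.filter_subset _ _
    -- general step
    have step : ∀ N ⊆ K, a ∈ N → N.card ≤ n → ∀ c : ℝ, (c = 0 ∧ N.card = n ∨ c = n ∧ N = K) → ∃ T R : Finset ι, T ⊆ S ∧ R ⊆ S ∧ (∀ a ∈ R, ∀ b ∈ R, r a b → a = b) ∧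
      ∀ w : ι → ℝ, (∀ a, 0 ≤ w a) → (∀ a b, r a b → w a = w b) →
        ∑ a ∈ S, w a ≤ n * ∑ a ∈ T, w a ∧ n * ∑ a ∈ T, w a ≤ ∑ a ∈ S, w a + n * ∑ a ∈ R, w a := by
      intro N hN haN hcard c hc
      have hNS := hN.trans hKS
      obtain ⟨T, R, h1, h2, h3, h4⟩ := ih (S \ N) (by
        have : (S \ N).card < S.card := Finset.card_lt_card (Finset.sdiff_ssubset hNS ⟨a, haN⟩)
        omega)
      have haT : a ∉ T := fun h => (Finset.mem_sdiff.1 (h1 h)).2 haN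
      have haR : a ∉ R := fun h => (Finset.mem_sdiff.1 (h2 h)).2 haN
      have hsumN : ∀ w : ι → ℝ, (∀ a b, r a b → w a = w b) → ∑ b ∈ N, w b = N.card * w a := by
        intro w hw
        rw [Finset.sum_congr rfl (fun b hb => (hw a b (Finset.mem_filter.1 (hN hb)).2).symm), Finset.sum_const, nsmul_eq_mul]
      have hcr : (N.card : ℝ) ≤ n := by exact_mod_cast hcard
      rcases hc with ⟨-, hc⟩ | ⟨-, hc⟩
      · refine ⟨insert a T, R, Finset.insert_subset ha (h1.trans Finset.sdiff_subset), h2.trans Finset.sdiff_subset, h3, ?_⟩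
        intro w w0 hw
        obtain ⟨k1, k2⟩ := h4 w w0 hw
        rw [Finset.sum_insert haT, ← Finset.sum_sdiff hNS, hsumN w hw, hc]
        constructor <;> nlinarith [w0 a]
      · refine ⟨insert a T, insert a R, Finset.insert_subset ha (h1.trans Finset.sdiff_subset), Finset.insert_subset ha (h2.trans Finset.sdiff_subset), ?_, ?_⟩
        · have aux : ∀ b ∈ R, ¬ r a b := fun b hb hab => by
            have := Finset.mem_sdiff.1 (h2 hb)
            exact this.2 (hc ▸ Finset.mem_filter.2 ⟨this.1, hab⟩)
          intro x hx y hy hxy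
          rcases Finset.mem_insert.1 hx with hx1 | hx1 <;> rcases Finset.mem_insert.1 hy with hy1 | hy1
          · rw [hx1, hy1]
          · exact absurd (hx1 ▸ hxy) (aux y hy1)
          · exact absurd (rs _ _ (hy1 ▸ hxy)) (aux x hx1)
          · exact h3 x hx1 y hy1 hxy
        · intro w w0 hw
          obtain ⟨k1, k2⟩ := h4 w w0 hw
          rw [Finset.sum_insert haT, Finset.sum_insert haR, ← Finset.sum_sdiff hNS, hsumN w hw]
          have := mul_le_mul_of_nonneg_right hcr (w0 a)
          have := mul_nonneg (Nat.cast_nonneg (α := ℝ) N.card) (w0 a)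
          constructor <;> nlinarith [w0 a]
    by_cases hKn : K.card ≤ n
    · exact step K le_rfl haK hKn n (Or.inr ⟨rfl, rfl⟩)
    · obtain ⟨N, h1, h2, h3⟩ := Finset.exists_subsuperset_card_eq (s := {a}) (t := K) (n := n) (by simpa using haK)
        (by rw [Finset.card_singleton]; omega) (by omega)
      exact step N h2 (by simpa using h1) h3.le 0 (Or.inl ⟨rfl, h3⟩)

lemma sum_proj {ι : Type*} {e : ι → A} (he : ∀ j, IsStarProjection (e j))
    (ho : ∀ i j, i ≠ j → e i * e j = 0) (S T : Finset ι) (hTS : T ⊆ S) :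
    (∑ j ∈ S, e j) * (∑ j ∈ T, e j) = ∑ j ∈ T, e j := by
  classical
  rw [Finset.mul_sum]
  refine Finset.sum_congr rfl fun j hj => ?_
  rw [Finset.sum_mul, Finset.sum_eq_single j]
  · exact proj_sq (he j)
  · intro i _ hij; exact ho i j hij
  · intro h; exact absurd (hTS hj) h

lemma divide (C : NonUnitalStarSubalgebra ℂ A) [FiniteDimensional ℂ C] {n : ℕ} (hn : 0 < n) {p : A} (hp : p ∈ C)
    (pp : IsStarProjection p) {P : Fin n → A} (hP : ∀ j, P j ∈ C) (pP : ∀ j, IsStarProjection (P j))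
    (hne : ∀ e, MinP C e → p * e = e → ∀ j, ∃ x ∈ C, e * x * P j ≠ 0) :
    ∃ p' ∈ C, IsStarProjection p' ∧ p * p' = p' ∧ ∀ t : A →ₗ[ℝ] ℝ, IsTr t →
      t p ≤ n * t p' ∧ n * t p' ≤ t p + ∑ j, t (P j) := by
  classical
  obtain ⟨N, e, h1, h2, h3⟩ := dec_exists C _ hp pp le_rfl
  have he := fun j => (h1 j).proj
  obtain ⟨T, R, hT, hR, hRi, hw⟩ := greedy (fun a b => Eqv C (e a) (e b))
    (fun a => ⟨e a, (h1 a).mem, by rw [proj_star (he a), proj_sq (he a)], by rw [proj_star (he a), proj_sq (he a)]⟩)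
    (fun a b h => h.symm) (fun a b c h h' => h.trans (he a) (he c) h') hn _ (Finset.univ : Finset (Fin N)) le_rfl
  have sp : ∀ T : Finset (Fin N), IsStarProjection (∑ j ∈ T, e j) := fun T =>
    ⟨sum_proj he h2 T T le_rfl, by
      rw [isSelfAdjoint_iff, star_sum]
      exact Finset.sum_congr rfl fun j _ => proj_star (he j)⟩
  have sub : ∀ T : Finset (Fin N), p * (∑ j ∈ T, e j) = ∑ j ∈ T, e j := fun T => by
    conv_lhs => rw [← h3]
    exact sum_proj he h2 _ T (Finset.subset_univ _)
  refine ⟨∑ j ∈ T, e j, sum_mem fun j _ => (h1 j).mem, sp T, sub T, ?_⟩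
  intro t ht
  obtain ⟨k1, k2⟩ := hw (fun a => t (e a)) (fun a => ht.pos _ (he a).nonneg) (fun a b h => h.tr ht)
  rw [← map_sum, h3, ← map_sum] at k1
  rw [← map_sum, ← map_sum, h3] at k2
  refine ⟨k1, k2.trans (add_le_add le_rfl ?_)⟩
  have hle : ∀ j, ∑ a ∈ R, t (e a) ≤ t (P j) := by
    intro j
    obtain ⟨N', f, g1, g2, g3⟩ := dec_exists C _ (hP j) (pP j) le_rfl
    have ex : ∀ a, ∃ b, Eqv C (e a) (f b) := by
      intro a
      have hpe : p * e a = e a := by simpa using sub {a}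
      obtain ⟨x, hx, hx0⟩ := hne _ (h1 a) hpe j
      rw [← g3, Finset.mul_sum] at hx0
      obtain ⟨b, _, hb⟩ := Finset.exists_ne_zero_of_sum_ne_zero hx0
      exact ⟨b, eqv_of_ne (h1 a) (g1 b) hx hb⟩
    choose β hβ using ex
    have inj : Set.InjOn β R := by
      intro a ha b hb hab
      refine hRi a ha b hb ((hβ a).trans (he a) (he b) ?_)
      rw [hab]
      exact (hβ b).symm
    rw [← g3, map_sum]
    calc ∑ a ∈ R, t (e a) = ∑ a ∈ R, t (f (β a)) := Finset.sum_congr rfl fun a _ => (hβ a).tr ht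
      _ = ∑ b ∈ R.image β, t (f b) := (Finset.sum_image (f := fun b => t (f b)) inj).symm
      _ ≤ _ := Finset.sum_le_sum_of_subset_of_nonneg (Finset.subset_univ _) (fun b _ _ => ht.pos _ (g1 b).proj.nonneg)
  calc (n:ℝ) * ∑ a ∈ R, t (e a) = ∑ j : Fin n, ∑ a ∈ R, t (e a) := by
        rw [Finset.sum_const, Finset.card_univ, Fintype.card_fin, nsmul_eq_mul]
    _ ≤ _ := Finset.sum_le_sum fun j _ => hle j

end Part12
end PartFile12

section PartFile13
set_option linter.unusedSectionVars false
set_option linter.unusedVariables false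
open Filter Topology

section Part13
variable {A : Type u} [CStarAlgebra A] [PartialOrder A] [StarOrderedRing A]
variable {I : Type*}

lemma cphi_nonneg (t : ℝ) (b : A) : 0 ≤ cfc (phi t) b := cfc_nonneg fun s _ => phi_nonneg t s
lemma cphi_le_one (t : ℝ) (b : A) : cfc (phi t) b ≤ 1 := cfc_le_one _ _ fun s _ => phi_le_one t s

lemma cphi_mul {t t' : ℝ} (b : A) (ht : 0 < t) (ht' : 0 < t') (h : t' ≤ t / 2) :
    cfc (phi t) b * cfc (phi t') b = cfc (phi t) b :=
  fc_mul (phi_cont t).continuousOn (phi_cont t').continuousOn fun s _ => by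
    rw [mul_comm]; exact phi_mul_phi ht ht' h

lemma cphi_ge {t : ℝ} {b : A} (ht : 0 < t) (b0 : 0 ≤ b) (b1 : b ≤ 1) : b - t • (1 : A) ≤ cfc (phi t) b := by
  have bsa := IsSelfAdjoint.of_nonneg b0
  have e : b - t • (1:A) = cfc (fun s : ℝ => s - t) b := by
    rw [cfc_sub (fun s : ℝ => s) (fun _ => t) b (by fun_prop) (by fun_prop), fc_id bsa, cfc_const t b, Algebra.algebraMap_eq_smul_one]
  rw [e]
  exact cfc_mono (fun s hs => phi_ge ht (spectrum_01 b0 b1 hs).2) (by fun_prop) (phi_cont t).continuousOn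

lemma cphi_zero {t : ℝ} {b g : A} (ht : 0 < t) (bsa : IsSelfAdjoint b) (h : b * g = 0) : cfc (phi t) b * g = 0 := by
  have e : cfc (fun s => phi t s / max s (t / 2)) b * b = cfc (phi t) b := by
    conv_lhs => enter [2]; rw [← fc_id bsa]
    refine fc_mul (Continuous.continuousOn ?_) (by fun_prop) fun s _ => ?_
    · exact (phi_cont t).div₀ (by fun_prop) (fun s => (lt_max_of_lt_right (by positivity)).ne')
    · rcases le_total s (t / 2) with h1 | h1
      · rw [phi_eq_zero ht h1]; simp
      · rw [max_eq_left h1, div_mul_cancel₀ _ (by linarith)]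
  rw [← e, mul_assoc, h, mul_zero]

lemma proj_le_of_mul {q g : A} (pq : IsStarProjection q) (g0 : 0 ≤ g) (h : q * g = q) : q ≤ g := by
  have gs : star g = g := (IsSelfAdjoint.of_nonneg g0).star_eq
  have h2 : g * q = q := by
    have := congrArg star h
    rwa [star_mul, gs, proj_star pq] at this
  have h3 := conj_sa_nonneg (pq.one_sub.isSelfAdjoint) g0
  rw [← sub_nonneg]
  convert h3 using 1
  rw [sub_mul, sub_mul, one_mul, mul_sub, mul_sub, mul_one, h, mul_one, h2, proj_sq pq]; abel

lemma transfer_phi {p b : A} (pp : IsStarProjection p) (b0 : 0 ≤ b) (b1 : b ≤ 1) {r : ℝ} (hr : 0 < r)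
    (h : (2 * r) • p ≤ p * b * p) : ∃ q, IsStarProjection q ∧ (∀ t, 0 < t → t ≤ r / 2 → q * cfc (phi t) b = q) ∧
      ∀ t : A →ₗ[ℝ] ℝ, IsTr t → t q = t p := by
  obtain ⟨g, hg⟩ : ∃ g, g = cfc (phi r) b := ⟨_, rfl⟩
  have g0 : 0 ≤ g := hg ▸ cphi_nonneg r b
  obtain ⟨w, hw⟩ : ∃ w, w = CFC.sqrt g := ⟨_, rfl⟩
  have wsa : IsSelfAdjoint w := hw ▸ IsSelfAdjoint.of_nonneg (CFC.sqrt_nonneg g)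
  have hww : w * w = g := hw ▸ CFC.sqrt_mul_sqrt_self g
  obtain ⟨q, s, h1, h2, h3, h4⟩ := proj_transfer (p := p) (w := p * w) pp (by rw [← mul_assoc, proj_sq pp]) hr (by
    rw [star_mul, wsa.star_eq, proj_star pp]
    have e : p * w * (w * p) = p * g * p := by rw [← hww]; noncomm_ring
    rw [e]
    have h1 := conj_sa_le pp.isSelfAdjoint (cphi_ge hr b0 b1)
    rw [← hg, mul_sub, sub_mul, mul_smul_comm, mul_one, smul_mul_assoc, proj_sq pp] at h1
    refine le_trans ?_ h1
    have := sub_le_sub_right h (r • p)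
    rwa [← sub_smul, show 2 * r - r = r by ring] at this)
  refine ⟨q, h1, fun t ht htr => ?_, h4⟩
  have h5 : g * (1 - cfc (phi t) b) = 0 := by
    rw [mul_sub, mul_one, hg, cphi_mul b hr ht htr, sub_self]
  have h6 := mul_eq_zero_of_sqrt g0 h5
  rw [← hw] at h6
  have h7 : q * (1 - cfc (phi t) b) = 0 := by
    rw [h2, mul_assoc, mul_assoc, h6, mul_zero, mul_zero]
  rw [mul_sub, mul_one, sub_eq_zero] at h7
  exact h7.symm

lemma sum_le_unit {n : ℕ} {f : Fin n → A} {g : A} {t : ℝ} (ht : 0 < t) (f0 : ∀ j, 0 ≤ f j) (g0 : 0 ≤ g) (g1 : g ≤ 1)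
    (ho : ∀ i j, i ≠ j → f i * f j = 0) (hg : ∀ j, f j * (1 - g) = 0) : ∑ j, cfc (phi t) (f j) ≤ g := by
  obtain ⟨y, hy⟩ : ∃ y, y = ∑ j, cfc (phi t) (f j) := ⟨_, rfl⟩
  rw [← hy]
  have y0 : 0 ≤ y := hy ▸ Finset.sum_nonneg fun j _ => cphi_nonneg t _
  have ysa := IsSelfAdjoint.of_nonneg y0
  have sa : ∀ j, IsSelfAdjoint (f j) := fun j => IsSelfAdjoint.of_nonneg (f0 j)
  have ho' : ∀ i j, i ≠ j → cfc (phi t) (f i) * cfc (phi t) (f j) = 0 := by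
    intro i j hij
    refine cphi_zero ht (sa i) ?_
    refine star_zero_swap (fc_sa _ _) (sa i) ?_
    exact cphi_zero ht (sa j) (ho j i hij.symm)
  have y2 : y * y ≤ y := by
    have e : y * y = ∑ j, cfc (phi t) (f j) * cfc (phi t) (f j) := by
      rw [hy, Finset.sum_mul]
      refine Finset.sum_congr rfl fun i _ => ?_
      rw [Finset.mul_sum, Finset.sum_eq_single i]
      · intro j _ hj; exact ho' i j hj.symm
      · simp
    rw [e, hy]
    refine Finset.sum_le_sum fun j _ => ?_
    rw [fc_mul (e := fun s => phi t s * phi t s) (phi_cont t).continuousOn (phi_cont t).continuousOn (fun s _ => rfl)]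
    exact cfc_mono (fun s _ => by nlinarith [phi_nonneg t s, phi_le_one t s])
      (((phi_cont t).mul (phi_cont t)).continuousOn) (phi_cont t).continuousOn
  have y1 : y ≤ 1 := by
    have h1 : ‖y * y‖ ≤ ‖y‖ := CStarAlgebra.norm_le_norm_of_nonneg_of_le (by
      have := star_mul_self_nonneg y; rwa [ysa.star_eq] at this) y2
    have h2 : ‖y * y‖ = ‖y‖ * ‖y‖ := by
      conv_lhs => enter [1, 1]; rw [← ysa.star_eq]
      exact CStarRing.norm_star_mul_self
    have h3 : ‖y‖ ≤ 1 := by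
      by_contra h
      push Not at h
      nlinarith
    simpa using le_smul_one ysa h3
  have yg : y * g = y := by
    have : y * (1 - g) = 0 := by
      rw [hy, Finset.sum_mul]
      exact Finset.sum_eq_zero fun j _ => cphi_zero ht (sa j) (hg j)
    rw [mul_sub, mul_one, sub_eq_zero] at this
    exact this.symm
  have gsa := IsSelfAdjoint.of_nonneg g0
  have gy : g * y = y := by
    have := congrArg star yg
    rwa [star_mul, gsa.star_eq, ysa.star_eq] at this
  have h1 := conj_sa_le gsa y1
  rw [gy, yg, mul_one] at h1
  refine h1.trans ?_
  have e1 : g * g = cfc (fun s : ℝ => s * s) g := by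
    conv_lhs => rw [← fc_id gsa]
    exact fc_mul (by fun_prop) (by fun_prop) (fun _ _ => rfl)
  rw [e1]
  conv_rhs => rw [← fc_id gsa]
  exact cfc_mono (fun s hs => by have := spectrum_01 g0 g1 hs; nlinarith [this.1, this.2]) (by fun_prop) (by fun_prop)

lemma HMS.L3 {F : Filter I} {C : I → NonUnitalStarSubalgebra ℂ A} {k : Bd I A} {L : A → Bd I A}
    (H : HMS F C k L) (x y z : A) : asy F (L x * L y * L z) = asy F k * asy F k * asy F k * asy F (cst I (x * y * z)) := by
  rw [map_mul, map_mul, H.Lk, H.Lk, H.Lk, cst_mul, cst_mul, map_mul, map_mul]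
  have h1 := H.comm x
  have h2 := H.comm y
  generalize asy F k = K at *
  generalize asy F (cst I x) = X at *
  generalize asy F (cst I y) = Y at *
  generalize asy F (cst I z) = Z at *
  calc K * X * (K * Y) * (K * Z) = K * (X * K) * (Y * K) * Z := by noncomm_ring
    _ = K * (K * X) * (K * Y) * Z := by rw [← h1, ← h2]
    _ = K * K * (X * K) * Y * Z := by noncomm_ring
    _ = K * K * (K * X) * Y * Z := by rw [← h1]
    _ = _ := by noncomm_ring

lemma HMS.L3sum {F : Filter I} {C : I → NonUnitalStarSubalgebra ℂ A} {k : Bd I A} {L : A → Bd I A}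
    (H : HMS F C k L) (x f : A) {n : ℕ} {a b : Fin n → A} (hab : 1 = ∑ j, a j * f * b j) :
    asy F (L x * L x * L x) = asy F ((∑ j, L (a j) * L f * L (b j)) * cst I (x * x * x)) := by
  rw [H.L3, map_mul, map_sum, Finset.sum_congr rfl (fun j _ => H.L3 (a j) f (b j)), ← Finset.mul_sum, ← map_sum, ← cst_sum, ← hab,
    cst_one, map_one, mul_one]

end Part13
end PartFile13

section PartFile14
set_option linter.unusedSectionVars false
set_option linter.unusedVariables false
open Filter Topology

section Part14
variable {A : Type u} [CStarAlgebra A] [PartialOrder A] [StarOrderedRing A]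
variable {I : Type*}

lemma proj_norm_one {e : A} (pe : IsStarProjection e) (h : e ≠ 0) : ‖e‖ = 1 := by
  have h1 : ‖e * star e‖ = ‖e‖ * ‖e‖ := CStarRing.norm_self_mul_star
  rw [proj_star pe, proj_sq pe] at h1
  have h2 : 0 < ‖e‖ := norm_pos_iff.2 h
  nlinarith

lemma chi_lower {c b : A} {θ : ℝ} (hfin : (spectrum ℝ c).Finite) (hs : IsSelfAdjoint c)
    (h : c ≤ b + (θ / 2) • (1 : A)) : (θ / 2) • chi θ c ≤ chi θ c * b * chi θ c := by
  have pp := chi_proj (θ := θ) hfin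
  have h1 := chi_conj_ge (θ := θ) hfin hs
  have h2 := conj_sa_le pp.isSelfAdjoint h
  have e : chi θ c * (b + (θ / 2) • (1 : A)) * chi θ c = chi θ c * b * chi θ c + (θ / 2) • chi θ c := by
    rw [mul_add, add_mul, mul_smul_comm, smul_mul_assoc, mul_one, proj_sq pp]
  rw [e] at h2
  have h3 := h1.trans h2
  have e2 : θ • chi θ c = (θ / 2) • chi θ c + (θ / 2) • chi θ c := by rw [← add_smul]; congr 1; ring
  rw [e2] at h3
  exact le_of_add_le_add_right h3

lemma sub_lower {p p' b : A} {r : ℝ} (pp : IsStarProjection p) (pp' : IsStarProjection p') (h : p * p' = p')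
    (hb : r • p ≤ p * b * p) : r • p' ≤ p' * b * p' := by
  have h2 := proj_mul_star pp pp' h
  have h1 := conj_sa_le pp'.isSelfAdjoint hb
  have e1 : p' * (r • p) * p' = r • p' := by rw [mul_smul_comm, smul_mul_assoc, h2, proj_sq pp']
  have e2 : p' * (p * b * p) * p' = p' * b * p' := by
    rw [show p' * (p * b * p) * p' = (p' * p) * b * (p * p') by noncomm_ring, h, h2]
  rwa [e1, e2] at h1

lemma minP_contra {c e f : A} {θ θ₁ S : ℝ} (hθ : 0 < θ) (hθ₁ : 0 < θ₁) (hcf : (spectrum ℝ c).Finite) (hcs : IsSelfAdjoint c)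
    (pe : IsStarProjection e) (e0 : e ≠ 0) (hpe : chi θ c * e = e) (hff : (spectrum ℝ f).Finite) (hfs : IsSelfAdjoint f)
    (hfl : -(θ₁ • (1 : A)) ≤ f) {N : ℕ} (a b : Fin N → A) (hz : ∀ s, e * a s * chi θ₁ f = 0)
    (hS : ∑ s, ‖a s‖ * ‖b s‖ ≤ S) (hSθ : S * θ₁ ≤ θ ^ 3 / 4) {x : A} (hx : ‖x‖ ≤ 1)
    (hc : ‖c * c * c - (∑ s, a s * f * b s) * x‖ ≤ θ ^ 3 / 4) : False := by
  have ep := proj_mul_star (chi_proj hcf) pe hpe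
  have h1 : e = e * (c * c * c) * (pinv θ c * pinv θ c * pinv θ c) := by
    have m1 := mul_pinv hcf hcs hθ
    have m2 := pinv_mul hcf hcs hθ
    have m3 := chi_comm (θ := θ) hcs
    have m4 := proj_sq (chi_proj (θ := θ) hcf)
    generalize pinv θ c = w at *
    generalize chi θ c = p at *
    have : c * c * c * (w * w * w) = p := by
      calc c * c * c * (w * w * w) = c * c * (c * w) * w * w := by noncomm_ring
        _ = c * c * p * w * w := by rw [m1]
        _ = c * (c * p) * w * w := by noncomm_ring
        _ = c * (p * c) * w * w := by rw [← m3]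
        _ = (c * p) * (c * w) * w := by noncomm_ring
        _ = (p * c) * p * w := by rw [← m3, m1]
        _ = p * (c * p) * w := by noncomm_ring
        _ = p * (p * c) * w := by rw [← m3]
        _ = (p * p) * (c * w) := by noncomm_ring
        _ = p := by rw [m1, m4, m4]
    rw [mul_assoc, this, ep]
  have n1 := proj_norm_one pe e0
  have hw := pinv_norm (c := c) hθ
  have hb : ∀ s, ‖e * a s * f * b s‖ ≤ ‖a s‖ * ‖b s‖ * θ₁ := by
    intro s
    have e2 : e * a s * f = e * a s * (f * (1 - chi θ₁ f)) := by
      rw [mul_sub, mul_one, ← chi_comm hfs, mul_sub, ← mul_assoc (e * a s), hz, zero_mul, sub_zero]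
    have h2 := norm_mul_one_sub_chi hff hfs hθ₁.le hfl
    calc ‖e * a s * f * b s‖ ≤ ‖e * a s * f‖ * ‖b s‖ := norm_mul_le _ _
      _ ≤ (‖e‖ * ‖a s‖ * ‖f * (1 - chi θ₁ f)‖) * ‖b s‖ := by
        rw [e2]
        gcongr
        exact (norm_mul_le _ _).trans (by gcongr; exact norm_mul_le _ _)
      _ ≤ (1 * ‖a s‖ * θ₁) * ‖b s‖ := by rw [n1]; gcongr
      _ = _ := by ring
  have h2 : ‖e * (c * c * c)‖ ≤ θ ^ 3 / 2 := by
    have e3 : e * (c * c * c) = e * (c * c * c - (∑ s, a s * f * b s) * x) + (∑ s, e * a s * f * b s) * x := by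
      have : ∑ s, e * a s * f * b s = e * ∑ s, a s * f * b s := by
        rw [Finset.mul_sum]; exact Finset.sum_congr rfl fun s _ => by noncomm_ring
      rw [this]; noncomm_ring
    have h3 : ‖∑ s, e * a s * f * b s‖ ≤ S * θ₁ := by
      refine (norm_sum_le _ _).trans ((Finset.sum_le_sum fun s _ => hb s).trans ?_)
      rw [← Finset.sum_mul]
      gcongr
    have h4 : ‖(∑ s, e * a s * f * b s) * x‖ ≤ S * θ₁ * 1 := (norm_mul_le _ _).trans
      (mul_le_mul h3 hx (norm_nonneg _) ((norm_nonneg _).trans h3))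
    have h5 : ‖e * (c * c * c - (∑ s, a s * f * b s) * x)‖ ≤ 1 * (θ ^ 3 / 4) :=
      (norm_mul_le _ _).trans (by rw [n1]; gcongr)
    rw [e3]
    refine (norm_add_le _ _).trans ?_
    linarith
  have h3 : ‖e‖ ≤ θ ^ 3 / 2 * (θ⁻¹ * θ⁻¹ * θ⁻¹) := by
    rw [h1]
    refine (norm_mul_le _ _).trans (mul_le_mul h2 ?_ (norm_nonneg _) (by positivity))
    refine (norm_mul_le _ _).trans (mul_le_mul ?_ hw (norm_nonneg _) (by positivity))
    exact (norm_mul_le _ _).trans (mul_le_mul hw hw (norm_nonneg _) (by positivity))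
  rw [n1] at h3
  have : θ ^ 3 / 2 * (θ⁻¹ * θ⁻¹ * θ⁻¹) = 1 / 2 := by field_simp
  linarith

lemma Mhalf {F : Filter I} {C : I → NonUnitalStarSubalgebra ℂ A} {k : Bd I A} {L : A → Bd I A}
    (H : HMS F C k L) (hs : IsSimpleCStarAlgebra A) (hfd : ¬ FiniteDimensional ℂ A) {b : A} (b0 : 0 ≤ b) (b1 : b ≤ 1)
    (bn : b ≠ 0) {n : ℕ} (hn : 0 < n) {θ : ℝ} (hθ : 0 < θ) :
    ∃ t₁ > 0, ∀ᶠ i in F, ∃ q : A, IsStarProjection q ∧ (∀ t, 0 < t → t ≤ t₁ → q * cfc (phi t) b = q) ∧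
      ∀ τ : A →ₗ[ℝ] ℝ, IsTr τ → (∀ t, 0 < t → t ≤ t₁ → n * τ q ≤ 2 * τ (cfc (phi t) b)) ∧
        τ (L b i) ≤ n * τ q + θ * τ 1 := by
  have bsa := IsSelfAdjoint.of_nonneg b0
  obtain ⟨t0, ht0⟩ : ∃ t0, t0 = ‖b‖ / 2 := ⟨_, rfl⟩
  have nb : 0 < ‖b‖ := norm_pos_iff.2 bn
  have t0p : 0 < t0 := by rw [ht0]; positivity
  have gn : cfc (phi t0) b ≠ 0 := by
    intro h
    have h1 := cphi_ge t0p b0 b1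
    rw [h, sub_nonpos] at h1
    have := norm_le_of_nonneg_le b0 t0p.le h1
    rw [ht0] at this; linarith
  obtain ⟨f, f0, fn, fo, fs⟩ := split_n hs hfd n (cphi_nonneg t0 b) gn
  have fle : ∀ j, f j ≤ cfc (phi t0) b := fun j =>
    (Finset.single_le_sum (f := f) (fun j _ => f0 j) (Finset.mem_univ j)).trans fs
  have f1 : ∀ j, f j ≤ 1 := fun j => (fle j).trans (cphi_le_one _ _)
  choose N a a' ha using fun j => simple_sum hs (fn j)
  obtain ⟨S, hS⟩ : ∃ S, S = ∑ j, ∑ s, (‖a j s‖ + 1) * (‖a' j s‖ + 1) + 1 := ⟨_, rfl⟩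
  have S0 : 0 < S := by rw [hS]; positivity
  have Sj : ∀ j, ∑ s, (‖a j s‖ + 1) * (‖a' j s‖ + 1) ≤ S := fun j => by
    rw [hS]
    have := Finset.single_le_sum (f := fun j => ∑ s, (‖a j s‖ + 1) * (‖a' j s‖ + 1)) (fun j _ => by positivity) (Finset.mem_univ j)
    linarith
  obtain ⟨θ₀, hθ₀⟩ : ∃ θ₀, θ₀ = θ / 2 := ⟨_, rfl⟩
  have θ₀p : 0 < θ₀ := by rw [hθ₀]; positivity
  obtain ⟨θ₁, hθ₁⟩ : ∃ θ₁, θ₁ = θ₀ ^ 3 / (4 * S) := ⟨_, rfl⟩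
  have θ₁p : 0 < θ₁ := by rw [hθ₁]; positivity
  have hSθ : S * θ₁ ≤ θ₀ ^ 3 / 4 := by rw [hθ₁]; apply le_of_eq; field_simp
  refine ⟨min (θ₀ / 8) (t0 / 2), by positivity, ?_⟩
  have ev1 := H.bounds b0 (η := θ₀ / 2) (by positivity)
  have ev2 : ∀ᶠ i in F, ∀ j, -((θ₁ / 2) • (1 : A)) ≤ L (f j) i ∧ L (f j) i ≤ f j + (θ₁ / 2) • (1 : A) :=
    eventually_all.2 fun j => H.bounds (f0 j) (η := θ₁ / 2) (by positivity)
  have ev3 := eventually_all.2 fun j => asy_ev (H.L3sum b (f j) (ha j)) (η := θ₀ ^ 3 / 4) (by positivity)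
  filter_upwards [ev1, ev2, ev3] with i h1 h2 h3
  have := H.fd i
  have csa := H.Lsa bsa i
  have cfin := fd_finite_spectrum (C i) (H.Lmem b i)
  have fsa := fun j => H.Lsa (IsSelfAdjoint.of_nonneg (f0 j)) i
  have ffin := fun j => fd_finite_spectrum (C i) (H.Lmem (f j) i)
  have nb3 : ‖b * b * b‖ ≤ 1 := by
    have := norm_le_one_of b0 b1
    calc ‖b * b * b‖ ≤ ‖b‖ * ‖b‖ * ‖b‖ := (norm_mul_le _ _).trans (by gcongr; exact norm_mul_le _ _)
      _ ≤ 1 * 1 * 1 := by gcongr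
      _ = 1 := by norm_num
  have pp := chi_proj (θ := θ₀) cfin
  have pP := fun j => chi_proj (θ := θ₁) (ffin j)
  obtain ⟨p', hp', pp', hpp', htr⟩ := divide (C i) hn (chi_mem (C i) (H.Lmem b i) csa θ₀p) pp
    (P := fun j => chi θ₁ (L (f j) i)) (fun j => chi_mem (C i) (H.Lmem (f j) i) (fsa j) θ₁p) pP (by
      intro e me hpe j
      by_contra hcon
      push Not at hcon
      refine minP_contra θ₀p θ₁p cfin csa me.proj me.ne hpe (ffin j) (fsa j) ?_ (fun s => L (a j s) i) (fun s => L (a' j s) i)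
        (fun s => hcon _ (H.Lmem _ _)) (S := S) ?_ hSθ nb3 ?_
      · refine le_trans (neg_le_neg ?_) (h2 j).1
        exact rsmul_one_mono (by linarith)
      · refine le_trans (Finset.sum_le_sum fun s _ => ?_) (Sj j)
        gcongr <;> exact H.Lnorm _ _
      · have := (h3 j).le
        simpa [Bd.sum_apply] using this)
  have hlow := chi_lower cfin csa h1.2
  have hlow' := sub_lower pp pp' hpp' hlow
  obtain ⟨q, q1, q2, q3⟩ := transfer_phi pp' b0 b1 (r := θ₀ / 4) (by positivity) (by
    convert hlow' using 2; ring)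
  obtain ⟨q', q1', q2', q3'⟩ := transfer_phi pp b0 b1 (r := θ₀ / 4) (by positivity) (by
    convert hlow using 2; ring)
  refine ⟨q, q1, fun t ht htt => q2 t ht (htt.trans ((min_le_left _ _).trans (by linarith))), fun τ hτ => ⟨fun t ht htt => ?_, ?_⟩⟩
  · have hle1 : t ≤ θ₀ / 8 := htt.trans (min_le_left _ _)
    have hle2 : t ≤ t0 / 2 := htt.trans (min_le_right _ _)
    rw [q3 τ hτ]
    have A1 := (htr τ hτ).2
    have A2 : τ (chi θ₀ (L b i)) ≤ τ (cfc (phi t) b) := by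
      rw [← q3' τ hτ]
      exact hτ.mono (proj_le_of_mul q1' (cphi_nonneg _ _) (q2' t ht (by linarith)))
    have A3 : ∑ j, τ (chi θ₁ (L (f j) i)) ≤ τ (cfc (phi t) b) := by
      calc ∑ j, τ (chi θ₁ (L (f j) i)) ≤ ∑ j, τ (cfc (phi (θ₁ / 8)) (f j)) := by
            refine Finset.sum_le_sum fun j _ => ?_
            obtain ⟨r, r1, r2, r3⟩ := transfer_phi (pP j) (f0 j) (f1 j) (r := θ₁ / 4) (by positivity) (by
              convert chi_lower (ffin j) (fsa j) (h2 j).2 using 2; ring)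
            rw [← r3 τ hτ]
            exact hτ.mono (proj_le_of_mul r1 (cphi_nonneg _ _) (r2 (θ₁ / 8) (by positivity) (by linarith)))
        _ = τ (∑ j, cfc (phi (θ₁ / 8)) (f j)) := (map_sum _ _ _).symm
        _ ≤ _ := hτ.mono (sum_le_unit (by positivity) f0 (cphi_nonneg _ _) (cphi_le_one _ _) fo (fun j =>
            mul_eq_zero_of_le (f0 j) (fle j) (by rw [mul_sub, mul_one, cphi_mul b t0p ht hle2, sub_self])))
    linarith
  · have B1 : τ (L b i) = τ (chi θ₀ (L b i) * L b i * chi θ₀ (L b i)) + τ (L b i * (1 - chi θ₀ (L b i))) := by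
      rw [mul_assoc, hτ.tr, mul_assoc, proj_sq pp, ← map_add]; congr 1; noncomm_ring
    have B2 : τ (chi θ₀ (L b i) * L b i * chi θ₀ (L b i)) ≤ (1 + θ₀ / 2) * τ (chi θ₀ (L b i)) := by
      have := hτ.mono (proj_conj_le pp (r := 1 + θ₀ / 2) (h1.2.trans (by rw [add_smul, one_smul]; gcongr)))
      rwa [map_smul, smul_eq_mul] at this
    have B3 := hτ.le_norm (L b i * (1 - chi θ₀ (L b i)))
    have B4 := norm_mul_one_sub_chi cfin csa θ₀p.le (le_trans (neg_le_neg (rsmul_one_mono (by linarith))) h1.1)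
    have B5 := mul_le_mul_of_nonneg_right B4 hτ.one_nonneg
    have B6 := hτ.mono pp.le_one
    have B7 := (htr τ hτ).1
    rw [q3 τ hτ]
    have B8 : θ₀ / 2 * τ (chi θ₀ (L b i)) ≤ θ₀ / 2 * τ 1 := by gcongr
    have B9 := mul_nonneg θ₀p.le hτ.one_nonneg
    rw [show θ = 2 * θ₀ by rw [hθ₀]; ring]
    nlinarith

end Part14
end PartFile14

section PartFile15
set_option linter.unusedSectionVars false
set_option linter.unusedVariables false
open Filter Topology

section Part15
variable {A : Type u} [CStarAlgebra A] [PartialOrder A] [StarOrderedRing A]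
variable {I : Type*}

lemma lemmaM (hs : IsSimpleCStarAlgebra A) (hw : WeakCRLeOne A) (hfd : ¬ FiniteDimensional ℂ A) {b : A} (b0 : 0 ≤ b) (b1 : b ≤ 1)
    {n : ℕ} (hn : 0 < n) {σ : ℝ} (hσ : 0 < σ) :
    ∃ t, 0 < t ∧ t ≤ σ ∧ ∃ q₁ q₂ : A, IsStarProjection q₁ ∧ IsStarProjection q₂ ∧
      q₁ * cfc (phi t) b = q₁ ∧ q₂ * cfc (phi t) b = q₂ ∧ ∀ τ : A →ₗ[ℝ] ℝ, IsTr τ →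
        n * τ q₁ ≤ 2 * τ (cfc (phi t) b) ∧ n * τ q₂ ≤ 2 * τ (cfc (phi t) b) ∧
        τ b ≤ n * (τ q₁ + τ q₂) + σ * τ 1 ∧ τ b - σ * τ 1 ≤ τ (cfc (phi t) b) := by
  have key : ∀ t, 0 < t → t ≤ σ → ∀ τ : A →ₗ[ℝ] ℝ, IsTr τ → τ b - σ * τ 1 ≤ τ (cfc (phi t) b) := by
    intro t ht hts τ hτ
    have h1 := hτ.mono (cphi_ge ht b0 b1)
    rw [map_sub, map_smul, smul_eq_mul] at h1
    have := mul_le_mul_of_nonneg_right hts hτ.one_nonneg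
    linarith
  by_cases bn : b = 0
  · refine ⟨σ, hσ, le_rfl, 0, 0, IsStarProjection.zero A, IsStarProjection.zero A, by simp, by simp, fun τ hτ => ?_⟩
    have h1 := hτ.pos _ (cphi_nonneg σ b)
    have h2 := mul_nonneg hσ.le hτ.one_nonneg
    have h3 := key σ hσ le_rfl τ hτ
    refine ⟨by simp; linarith, by simp; linarith, by rw [bn]; simpa using h2, h3⟩
  obtain ⟨I, F, C, D, k, l, L, M, h⟩ := exists_model hw
  have e : asy (F : Filter I) (L b + M b) = asy (F : Filter I) (cst I b) := by
    rw [map_add, h.hC.Lk, h.hD.Lk, ← add_mul, h.sum, one_mul]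
  obtain ⟨t₁, t1p, ev1⟩ := Mhalf h.hC hs hfd b0 b1 bn hn (θ := σ / 4) (by positivity)
  obtain ⟨t₂, t2p, ev2⟩ := Mhalf h.hD hs hfd b0 b1 bn hn (θ := σ / 4) (by positivity)
  obtain ⟨i, ⟨q₁, a1, a2, a3⟩, ⟨q₂, c1, c2, c3⟩, i3⟩ := (ev1.and (ev2.and (asy_ev e (η := σ / 4) (by positivity)))).exists
  obtain ⟨t, ht⟩ : ∃ t, t = min σ (min t₁ t₂) := ⟨_, rfl⟩
  have tp : 0 < t := by rw [ht]; positivity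
  have tσ : t ≤ σ := ht ▸ min_le_left _ _
  have tt1 : t ≤ t₁ := ht ▸ (min_le_right _ _).trans (min_le_left _ _)
  have tt2 : t ≤ t₂ := ht ▸ (min_le_right _ _).trans (min_le_right _ _)
  refine ⟨t, tp, tσ, q₁, q₂, a1, c1, a2 t tp tt1, c2 t tp tt2, fun τ hτ => ⟨(a3 τ hτ).1 t tp tt1, (c3 τ hτ).1 t tp tt2, ?_, key t tp tσ τ hτ⟩⟩
  have h1 := (a3 τ hτ).2
  have h2 := (c3 τ hτ).2
  have h3 := (abs_le.1 (hτ.abs_le ((L b + M b) i - cst I b i))).1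
  have h4 := mul_le_mul_of_nonneg_right i3.le hτ.one_nonneg
  rw [Bd.add_apply, cst_apply, map_sub, map_add] at h3
  rw [Bd.add_apply, cst_apply] at h4
  have h5 := mul_nonneg hσ.le hτ.one_nonneg
  linarith

lemma conj_le_one {w x : A} (w0 : 0 ≤ w) (w1 : w ≤ 1) (x0 : 0 ≤ x) (x1 : x ≤ 1) : w * x * w ≤ 1 := by
  have wsa := IsSelfAdjoint.of_nonneg w0
  have h1 := norm_le_one_of w0 w1
  have h2 := norm_le_one_of x0 x1
  have h3 : ‖w * x * w‖ ≤ 1 := by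
    calc ‖w * x * w‖ ≤ ‖w‖ * ‖x‖ * ‖w‖ := (norm_mul_le _ _).trans (by gcongr; exact norm_mul_le _ _)
      _ ≤ 1 * 1 * 1 := by gcongr
      _ = 1 := by norm_num
  simpa using le_smul_one (IsSelfAdjoint.of_nonneg (conj_sa_nonneg wsa x0)) h3

lemma cs {x y : A} (xs : IsSelfAdjoint x) (ys : IsSelfAdjoint y) (h : x * y = 0) : y * x = 0 := by
  have := congrArg star h
  rwa [star_mul, xs.star_eq, ys.star_eq, star_zero] at this

lemma IsTr.mul_le {τ : A →ₗ[ℝ] ℝ} (hτ : IsTr τ) {x h : A} (x1 : x ≤ 1) (h0 : 0 ≤ h) : τ (x * h) ≤ τ h := by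
  have e := CFC.sqrt_mul_sqrt_self h
  have s := IsSelfAdjoint.of_nonneg (CFC.sqrt_nonneg h)
  have h1 := hτ.mono (_root_.conj_sa_le s x1)
  rw [mul_one, e] at h1
  refine le_trans (le_of_eq ?_) h1
  conv_lhs => rw [← e, ← mul_assoc, hτ.tr, ← mul_assoc]

lemma IsTr.mul_nonneg {τ : A →ₗ[ℝ] ℝ} (hτ : IsTr τ) {x h : A} (x0 : 0 ≤ x) (h0 : 0 ≤ h) : 0 ≤ τ (x * h) := by
  have e := CFC.sqrt_mul_sqrt_self h
  have s := IsSelfAdjoint.of_nonneg (CFC.sqrt_nonneg h)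
  have h1 := hτ.pos _ (conj_sa_nonneg s x0)
  refine le_trans h1 (le_of_eq ?_)
  conv_rhs => rw [← e, ← mul_assoc, hτ.tr, ← mul_assoc]

/-- the trace of `2φ - φ²` at `u q u` is at most the trace of `q` -/
lemma tr_h2 {τ : A →ₗ[ℝ] ℝ} (hτ : IsTr τ) {u q y : A} (pu : IsStarProjection u) (pq : IsStarProjection q) (hy : y = u * q * u)
    {η : ℝ} (hη : 0 < η) : τ (cfc (fun s => 2 * phi η s - phi η s * phi η s) y) ≤ τ q := by
  have y0 : 0 ≤ y := hy ▸ conj_sa_nonneg pu.isSelfAdjoint pq.nonneg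
  have ysa := IsSelfAdjoint.of_nonneg y0
  have c1 := phi_cont η
  have c2 : Continuous fun s => 2 * phi η s - phi η s * phi η s := by fun_prop
  obtain ⟨mf, hmf⟩ : ∃ mf : ℝ → ℝ, mf = fun s => Real.sqrt ((2 * phi η s - phi η s * phi η s) / max s (η / 2)) := ⟨_, rfl⟩
  have c3 : Continuous mf := by
    rw [hmf]
    exact (c2.div₀ (by fun_prop) (fun s => (lt_max_of_lt_right (by positivity)).ne')).sqrt
  have nn : ∀ s, 0 ≤ 2 * phi η s - phi η s * phi η s := fun s => by
    nlinarith [phi_nonneg η s, phi_le_one η s]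
  have hid : ∀ s, mf s * s * mf s = 2 * phi η s - phi η s * phi η s := by
    intro s
    have e1 : mf s * s * mf s = mf s * mf s * s := by ring
    rw [e1, hmf]
    simp only
    rw [Real.mul_self_sqrt (div_nonneg (nn s) (le_max_of_le_right (by positivity)))]
    rcases le_total s (η / 2) with h1 | h1
    · rw [phi_eq_zero hη h1]; simp
    · rw [max_eq_left h1, div_mul_cancel₀ _ (by linarith)]
  obtain ⟨m, hm⟩ : ∃ m, m = cfc mf y := ⟨_, rfl⟩
  have msa : star m = m := by rw [hm]; exact (fc_sa mf y).star_eq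
  have e1 : m * y * m = cfc (fun s => 2 * phi η s - phi η s * phi η s) y := by
    have : m * y = cfc (fun s => mf s * s) y := by
      rw [hm]
      conv_lhs => enter [2]; rw [← fc_id ysa]
      exact fc_mul c3.continuousOn (by fun_prop) fun _ _ => rfl
    rw [this, hm]
    exact fc_mul (by fun_prop) c3.continuousOn fun s _ => hid s
  rw [← e1]
  obtain ⟨X, hX⟩ : ∃ X, X = m * u * q := ⟨_, rfl⟩
  have sX : star X = q * u * m := by rw [hX, star_mul, star_mul, proj_star pq, proj_star pu, msa, mul_assoc]
  have XX : X * star X = m * y * m := by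
    rw [sX, hX, hy]
    calc m * u * q * (q * u * m) = m * u * (q * q) * u * m := by noncomm_ring
      _ = _ := by rw [proj_sq pq]; noncomm_ring
  have hn : ‖star X * X‖ ≤ 1 := by
    rw [CStarRing.norm_star_mul_self, ← CStarRing.norm_self_mul_star, XX, e1]
    refine norm_cfc_le zero_le_one fun s _ => ?_
    rw [Real.norm_of_nonneg (nn s)]
    nlinarith [phi_nonneg η s, phi_le_one η s]
  have h1 : star X * X ≤ 1 := by simpa using le_smul_one (IsSelfAdjoint.star_mul_self X) hn
  have Xq : X * q = X := by rw [hX, mul_assoc, proj_sq pq]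
  have h2 := conj_sa_le pq.isSelfAdjoint h1
  have e3 : q * (star X * X) * q = star X * X := by
    rw [mul_assoc, mul_assoc, Xq, ← mul_assoc]
    have := congrArg star Xq
    rw [star_mul, proj_star pq] at this
    rw [this]
  rw [e3, mul_one, proj_sq pq] at h2
  rw [← XX, hτ.tr]
  exact hτ.mono h2

lemma hosts (hs : IsSimpleCStarAlgebra A) (hw : WeakCRLeOne A) (hfd : ¬ FiniteDimensional ℂ A) {G : A} (G0 : 0 ≤ G) (G1 : G ≤ 1)
    {σ : ℝ} (hσ : 0 < σ) : ∃ z₀ z₁ : A, 0 ≤ z₀ ∧ z₀ ≤ 1 ∧ 0 ≤ z₁ ∧ z₁ ≤ 1 ∧ z₀ * z₁ = 0 ∧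
      (∀ w, G * w = 0 → z₀ * w = 0 ∧ z₁ * w = 0) ∧
      ∀ τ : A →ₗ[ℝ] ℝ, IsTr τ → τ G / 32 - σ * τ 1 ≤ τ z₀ ∧ τ G / 32 - σ * τ 1 ≤ τ z₁ := by
  obtain ⟨t, tp, tσ, q₁, q₂, p1, p2, g1, g2, htr⟩ := lemmaM hs hw hfd G0 G1 (n := 16) (by norm_num) hσ
  have Gsa := IsSelfAdjoint.of_nonneg G0
  have hgw : ∀ w, G * w = 0 → cfc (phi t) G * w = 0 := fun w hw => cphi_zero tp Gsa hw
  have g0 := cphi_nonneg t G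
  have gle := cphi_le_one t G
  generalize cfc (phi t) G = g at *
  obtain ⟨u, hu⟩ : ∃ u, u = 1 - q₁ := ⟨_, rfl⟩
  have pu : IsStarProjection u := hu ▸ p1.one_sub
  have uq : u * q₁ = 0 := by rw [hu, sub_mul, one_mul, proj_sq p1, sub_self]
  have qu := cs pu.isSelfAdjoint p1.isSelfAdjoint uq
  obtain ⟨y, hy⟩ : ∃ y, y = u * q₂ * u := ⟨_, rfl⟩
  have y0 : 0 ≤ y := hy ▸ conj_sa_nonneg pu.isSelfAdjoint p2.nonneg
  have ysa := IsSelfAdjoint.of_nonneg y0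
  have y1 : y ≤ 1 := hy ▸ conj_le_one pu.nonneg pu.le_one p2.nonneg p2.le_one
  have yq : y * q₁ = 0 := by rw [hy, mul_assoc, uq, mul_zero]
  obtain ⟨η, hη⟩ : ∃ η, η = σ / 4 := ⟨_, rfl⟩
  have ηp : 0 < η := by rw [hη]; positivity
  have hh2 : ∀ τ : A →ₗ[ℝ] ℝ, IsTr τ → τ (cfc (fun s => 2 * phi η s - phi η s * phi η s) y) ≤ τ q₂ :=
    fun τ hτ => tr_h2 hτ pu p2 hy ηp
  have eh2 : cfc (fun s => 2 * phi η s - phi η s * phi η s) y = (2:ℝ) • cfc (phi η) y - cfc (phi η) y * cfc (phi η) y := by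
    have c1 := phi_cont η
    rw [cfc_sub (fun s => 2 * phi η s) (fun s => phi η s * phi η s) y (by fun_prop) (by fun_prop), cfc_const_mul 2 (phi η) y c1.continuousOn,
      cfc_mul (phi η) (phi η) y c1.continuousOn c1.continuousOn]
  rw [eh2] at hh2
  have nn2 : 0 ≤ (2:ℝ) • cfc (phi η) y - cfc (phi η) y * cfc (phi η) y := by
    rw [← eh2]; exact cfc_nonneg fun s _ => by nlinarith [phi_nonneg η s, phi_le_one η s]
  have hφh := cphi_mul y (t := 2 * η) (t' := η) (by positivity) ηp (by linarith)
  have hφge := cphi_ge (t := 2 * η) (b := y) (by positivity) y0 y1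
  have h0 := cphi_nonneg η y
  have h1 := cphi_le_one η y
  have v0 := cphi_nonneg (2 * η) y
  have v1 := cphi_le_one (2 * η) y
  have hz : ∀ w, y * w = 0 → cfc (phi η) y * w = 0 := fun w hw => cphi_zero ηp ysa hw
  have vz : ∀ w, y * w = 0 → cfc (phi (2 * η)) y * w = 0 := fun w hw => cphi_zero (by positivity) ysa hw
  generalize cfc (phi η) y = h at *
  generalize cfc (phi (2 * η)) y = v at *
  have hsa := IsSelfAdjoint.of_nonneg h0
  have vsa := IsSelfAdjoint.of_nonneg v0
  have hq := hz q₁ yq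
  have vq := vz q₁ yq
  have qv := cs vsa p1.isSelfAdjoint vq
  have qh := cs hsa p1.isSelfAdjoint hq
  have gsa := IsSelfAdjoint.of_nonneg g0
  have vh : v * (1 - h) = 0 := by rw [mul_sub, mul_one, hφh, sub_self]
  have hv := cs vsa ((IsSelfAdjoint.one A).sub hsa) vh
  have h1' : 0 ≤ 1 - h := sub_nonneg.2 h1
  have h1'' : 1 - h ≤ 1 := sub_le_self _ h0
  have ugu0 : 0 ≤ u * g * u := conj_sa_nonneg pu.isSelfAdjoint g0
  have ugu1 : u * g * u ≤ 1 := conj_le_one pu.nonneg pu.le_one g0 gle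
  refine ⟨(1 - h) * (u * g * u) * (1 - h), q₁ + v, conj_sa_nonneg (IsSelfAdjoint.of_nonneg h1') ugu0, conj_le_one h1' h1'' ugu0 ugu1,
    add_nonneg p1.nonneg v0, ?_, ?_, ?_, ?_⟩
  · have := conj_sa_le pu.isSelfAdjoint v1
    rw [mul_one, proj_sq pu] at this
    have e : u * v * u = v := by rw [hu, sub_mul, one_mul, qv, sub_zero, mul_sub, mul_one, vq, sub_zero]
    rw [e, hu] at this
    calc q₁ + v ≤ q₁ + (1 - q₁) := by gcongr
      _ = 1 := by abel
  · have e1 : (1 - h) * q₁ = q₁ := by rw [sub_mul, one_mul, hq, sub_zero]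
    rw [mul_assoc, mul_add, e1, hv, add_zero, mul_assoc, mul_assoc, uq]; simp
  · intro w hGw
    have gw := hgw w hGw
    have q1w : q₁ * w = 0 := by rw [← g1, mul_assoc, gw, mul_zero]
    have q2w : q₂ * w = 0 := by rw [← g2, mul_assoc, gw, mul_zero]
    have uw : u * w = w := by rw [hu, sub_mul, one_mul, q1w, sub_zero]
    have yw : y * w = 0 := by rw [hy, mul_assoc, uw, mul_assoc, q2w, mul_zero]
    have hw' : (1 - h) * w = w := by rw [sub_mul, one_mul, hz w yw, sub_zero]
    constructor
    · rw [mul_assoc, hw', mul_assoc, mul_assoc, uw, mul_assoc, gw]; simp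
    · rw [add_mul, q1w, vz w yw, add_zero]
  · intro τ hτ
    obtain ⟨t1, t2, t3, t4⟩ := htr τ hτ
    have T1 := hτ.one_nonneg
    have T2 := hτ.pos _ p1.nonneg
    have T3 := hτ.pos _ p2.nonneg
    have T4 := hτ.pos _ g0
    have T5 := mul_nonneg hσ.le T1
    have T6 := hh2 τ hτ
    push_cast at t1 t2 t3
    constructor
    · have E : τ ((1 - h) * (u * g * u) * (1 - h)) = τ (u * g * u) - τ (u * g * u * ((2:ℝ) • h - h * h)) := by
        rw [mul_assoc, hτ.tr, ← map_sub]
        congr 1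
        rw [two_smul]; noncomm_ring
      have E1 := hτ.mul_le ugu1 nn2
      have E2 : τ (u * g * u) = τ g - τ (g * q₁) := by
        rw [mul_assoc, hτ.tr, mul_assoc, proj_sq pu, hu, mul_sub, mul_one, map_sub]
      have E3 := hτ.mul_le gle p1.nonneg
      linarith
    · rw [map_add]
      have E1 := hτ.mono hφge
      rw [map_sub, map_smul, smul_eq_mul] at E1
      have E2 : τ y = τ q₂ - τ (q₂ * q₁) := by
        rw [hy, mul_assoc, hτ.tr, mul_assoc, proj_sq pu, hu, mul_sub, mul_one, map_sub]
      have E3 := hτ.mul_le p2.le_one p1.nonneg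
      have E4 := hτ.pos _ v0
      rw [hη] at E1
      linarith

lemma Lpp (hs : IsSimpleCStarAlgebra A) (hw : WeakCRLeOne A) (hfd : ¬ FiniteDimensional ℂ A) {b : A} (b0 : 0 ≤ b) (b1 : b ≤ 1)
    {σ : ℝ} (hσ : 0 < σ) : ∃ q : A, IsStarProjection q ∧ (∃ s, 0 < s ∧ q * cfc (phi s) b = q) ∧
      ∀ τ : A →ₗ[ℝ] ℝ, IsTr τ → τ b ≤ 100 * τ q + σ * τ 1 := by
  by_cases hex : ∃ τ : A →ₗ[ℝ] ℝ, IsTr τ ∧ 0 < τ 1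
  swap
  · refine ⟨0, IsStarProjection.zero A, ⟨1, one_pos, by simp⟩, fun τ hτ => ?_⟩
    have h1 : τ 1 = 0 := le_antisymm (not_lt.1 fun h => hex ⟨τ, hτ, h⟩) hτ.one_nonneg
    have h2 := hτ.le_norm b
    rw [h1] at h2 ⊢
    simpa using h2
  obtain ⟨τ₀, hτ₀, hτ₀1⟩ := hex
  obtain ⟨t, tp, tσ, q₁, q₂, p1, p2, g1, g2, htr⟩ := lemmaM hs hw hfd b0 b1 (n := 100) (by norm_num) hσ
  have hsup := cphi_mul b (t := t) (t' := t / 2) tp (by positivity) le_rfl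
  have g0 := cphi_nonneg t b
  have gle := cphi_le_one t b
  generalize cfc (phi t) b = g at *
  by_cases hg : g = 0
  · refine ⟨0, IsStarProjection.zero A, ⟨1, one_pos, by simp⟩, fun τ hτ => ?_⟩
    have := (htr τ hτ).2.2.1
    rw [← g1, ← g2, hg] at this
    simpa using this
  obtain ⟨κ, κ0, hκ⟩ := simple_tr_lower hs g0 hg
  obtain ⟨u, hu⟩ : ∃ u, u = 1 - q₁ := ⟨_, rfl⟩
  have pu : IsStarProjection u := hu ▸ p1.one_sub
  have uq : u * q₁ = 0 := by rw [hu, sub_mul, one_mul, proj_sq p1, sub_self]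
  obtain ⟨z₀, z₁, a0, a1, c0, c1, hzz, hzw, hztr⟩ := hosts hs hw hfd (G := u * g * u) (conj_sa_nonneg pu.isSelfAdjoint g0)
    (conj_le_one pu.nonneg pu.le_one g0 gle) (σ := κ / 1000) (by positivity)
  have gap : ∀ τ : A →ₗ[ℝ] ℝ, IsTr τ → τ q₂ + κ / 1000 * τ 1 ≤ τ z₀ ∧ τ q₂ + κ / 1000 * τ 1 ≤ τ z₁ := by
    intro τ hτ
    have h1 := hκ τ hτ
    obtain ⟨t1, t2, t3, t4⟩ := htr τ hτ
    have h2 := hztr τ hτ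
    have E2 : τ (u * g * u) = τ g - τ (g * q₁) := by
      rw [mul_assoc, hτ.tr, mul_assoc, proj_sq pu, hu, mul_sub, mul_one, map_sub]
    have E3 := hτ.mul_le gle p1.nonneg
    have T1 := mul_nonneg κ0.le hτ.one_nonneg
    push_cast at t1 t2 t3
    constructor <;> linarith [h2.1, h2.2]
  have gp := mul_pos κ0 hτ₀1
  have z0n : z₀ ≠ 0 := fun h => by
    have := (gap τ₀ hτ₀).1
    rw [h, map_zero] at this
    linarith [hτ₀.pos _ p2.nonneg]
  have z1n : z₁ ≠ 0 := fun h => by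
    have := (gap τ₀ hτ₀).2
    rw [h, map_zero] at this
    linarith [hτ₀.pos _ p2.nonneg]
  obtain ⟨y, y', hyy⟩ := comp_lemma hs hw p2.nonneg p2.le_one (proj_sq p2) p2.nonneg p2.le_one a0 a1 z0n c0 c1 z1n hzz
    (σ := κ / 1000) (by positivity) (fun τ hτ => (gap τ hτ).1) (fun τ hτ => (gap τ hτ).2) (ε := 1 / 2) (by norm_num)
  obtain ⟨v, hv⟩ : ∃ v, v = y * z₀ + y' * z₁ := ⟨_, rfl⟩
  rw [← hv] at hyy
  have hvw : ∀ w, u * g * u * w = 0 → v * w = 0 := fun w h => by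
    rw [hv, add_mul, mul_assoc, mul_assoc, (hzw w h).1, (hzw w h).2]; simp
  obtain ⟨q, s, r1, r2, r3, r4⟩ := proj_transfer (p := q₂) (w := q₂ * v) p2 (by rw [← mul_assoc, proj_sq p2]) (r := 1 / 2) (by norm_num) (by
    have h1 := neg_smul_one_le ((IsSelfAdjoint.mul_star_self v).sub p2.isSelfAdjoint) hyy.le
    have h2 := le_proj_conj p2 h1
    have e : q₂ * (v * star v - q₂) * q₂ = q₂ * v * star (q₂ * v) - q₂ := by
      rw [mul_sub, sub_mul, proj_sq p2, proj_sq p2, star_mul, proj_star p2]; congr 1; noncomm_ring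
    rw [e, le_sub_iff_add_le] at h2
    refine le_trans (le_of_eq ?_) h2
    rw [← sub_eq_neg_add]
    have : (1 / 2 : ℝ) • q₂ + (1 / 2 : ℝ) • q₂ = q₂ := by rw [← add_smul]; norm_num
    exact eq_sub_of_add_eq this)
  have qw : ∀ w, u * g * u * w = 0 → q * w = 0 := fun w h => by
    rw [r2, mul_assoc, mul_assoc, hvw w h]; simp
  have qq1 : q * q₁ = 0 := qw _ (by rw [mul_assoc, uq, mul_zero])
  have q1q := cs r1.isSelfAdjoint p1.isSelfAdjoint qq1
  refine ⟨q₁ + q, ⟨?_, p1.isSelfAdjoint.add r1.isSelfAdjoint⟩, ⟨t / 2, by positivity, ?_⟩, fun τ hτ => ?_⟩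
  · change (q₁ + q) * (q₁ + q) = q₁ + q
    rw [add_mul, mul_add, mul_add, qq1, q1q, proj_sq p1, proj_sq r1]; simp
  · have e1 : q₁ * (1 - cfc (phi (t / 2)) b) = 0 := by
      rw [← g1, mul_assoc, mul_sub g, hsup, mul_one, sub_self, mul_zero]
    have e2 : q * (1 - cfc (phi (t / 2)) b) = 0 := by
      apply qw
      have : u * (1 - cfc (phi (t / 2)) b) = (1 - cfc (phi (t / 2)) b) := by rw [hu, sub_mul, one_mul, e1, sub_zero]
      rw [mul_assoc, this, mul_assoc, mul_sub g, hsup, mul_one, sub_self, mul_zero]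
    rw [mul_sub, mul_one, sub_eq_zero] at e1 e2
    rw [add_mul, ← e1, ← e2]
  · have := (htr τ hτ).2.2.1
    rw [map_add, r4 τ hτ]
    exact_mod_cast this

end Part15
end PartFile15

section PartFile16
set_option linter.unusedSectionVars false
set_option linter.unusedVariables false
open Filter Topology

section Part16
variable {A : Type u} [CStarAlgebra A] [PartialOrder A] [StarOrderedRing A]
variable {I : Type*}

lemma sp_half {y c : A} (y0 : 0 ≤ y) {θ : ℝ} (hθ : 0 < θ) (hfin : (spectrum ℝ c).Finite) (hs : IsSelfAdjoint c)
    (h1 : -((θ / 2) • (1 : A)) ≤ c) (h2 : c ≤ y + (θ / 2) • (1 : A)) (hn : θ < ‖c‖) :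
    ∃ q : A, IsStarProjection q ∧ q ≠ 0 ∧ ∀ g, y * g = 0 → q * g = 0 := by
  have pp := chi_proj (θ := θ) hfin
  have hlow := chi_lower hfin hs h2
  have pn : chi θ c ≠ 0 := by
    intro h
    have := norm_mul_one_sub_chi hfin hs hθ.le (le_trans (neg_le_neg (rsmul_one_mono (by linarith))) h1)
    rw [h, sub_zero, mul_one] at this
    linarith
  have hyy := CFC.sqrt_mul_sqrt_self y
  have ssa := IsSelfAdjoint.of_nonneg (CFC.sqrt_nonneg y)
  have hz : ∀ g, y * g = 0 → CFC.sqrt y * g = 0 := fun g hg => mul_eq_zero_of_sqrt y0 hg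
  generalize CFC.sqrt y = w at *
  generalize chi θ c = p at *
  have eww : p * w * star (p * w) = p * y * p := by
    rw [star_mul, ssa.star_eq, proj_star pp, ← hyy]; noncomm_ring
  obtain ⟨q, s, r1, r2, r3, r4⟩ := proj_transfer (p := p) (w := p * w) pp (by rw [← mul_assoc, proj_sq pp]) (r := θ / 2) (by positivity)
    (by rw [eww]; exact hlow)
  refine ⟨q, r1, fun h => pn ?_, fun g hg => ?_⟩
  · rw [h, mul_zero] at r3
    rw [← eww, ← r3] at hlow
    simp only [zero_mul] at hlow
    have h5 : p ≤ 0 := by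
      have := smul_le_smul_of_nonneg_left hlow (show (0:ℝ) ≤ 2 / θ by positivity)
      rw [smul_zero, smul_smul] at this
      have e : 2 / θ * (θ / 2) = 1 := by field_simp
      rwa [e, one_smul] at this
    exact le_antisymm h5 pp.nonneg
  · rw [r2, mul_assoc, mul_assoc, hz g hg]; simp

lemma SP (hw : WeakCRLeOne A) {y : A} (y0 : 0 ≤ y) (yn : y ≠ 0) :
    ∃ q : A, IsStarProjection q ∧ q ≠ 0 ∧ ∀ g, y * g = 0 → q * g = 0 := by
  have np : 0 < ‖y‖ := norm_pos_iff.2 yn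
  obtain ⟨I, F, C, D, k, l, L, M, h⟩ := exists_model hw
  have e : asy (F : Filter I) (L y + M y) = asy (F : Filter I) (cst I y) := by
    rw [map_add, h.hC.Lk, h.hD.Lk, ← add_mul, h.sum, one_mul]
  obtain ⟨i, i1, i2, i3⟩ := ((h.hC.bounds y0 (η := ‖y‖ / 4 / 2) (by positivity)).and
    ((h.hD.bounds y0 (η := ‖y‖ / 4 / 2) (by positivity)).and (asy_ev e (η := ‖y‖ / 4) (by positivity)))).exists
  rw [Bd.add_apply, cst_apply] at i3
  have ysa := IsSelfAdjoint.of_nonneg y0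
  have hor : ‖y‖ / 4 < ‖L y i‖ ∨ ‖y‖ / 4 < ‖M y i‖ := by
    by_contra hcon
    push Not at hcon
    have h1 : ‖y‖ ≤ ‖L y i + M y i‖ + ‖L y i + M y i - y‖ := by
      calc ‖y‖ = ‖(L y i + M y i) - (L y i + M y i - y)‖ := by congr 1; abel
        _ ≤ _ := norm_sub_le _ _
    have h2 := norm_add_le (L y i) (M y i)
    linarith [hcon.1, hcon.2]
  rcases hor with hh | hh
  · have := h.hC.fd i
    exact sp_half y0 (by positivity) (fd_finite_spectrum (C i) (h.hC.Lmem y i)) (h.hC.Lsa ysa i) i1.1 i1.2 hh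
  · have := h.hD.fd i
    exact sp_half y0 (by positivity) (fd_finite_spectrum (D i) (h.hD.Lmem y i)) (h.hD.Lsa ysa i) i2.1 i2.2 hh

lemma exh_step (hs : IsSimpleCStarAlgebra A) (hw : WeakCRLeOne A) (hfd : ¬ FiniteDimensional ℂ A) {b : A} (b0 : 0 ≤ b) (b1 : b ≤ 1)
    {δ : ℝ} (hδ : 0 < δ) : ∃ q : A, IsStarProjection q ∧ (∀ w, b * w = 0 → q * w = 0) ∧
      ∀ τ : A →ₗ[ℝ] ℝ, IsTr τ → τ ((1 - q) * b * (1 - q)) ≤ τ b - δ / 100 * (τ b - 2 * δ * τ 1) := by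
  have bsa := IsSelfAdjoint.of_nonneg b0
  have cf : Continuous fun s : ℝ => max (s - δ) 0 := by fun_prop
  obtain ⟨c, hc⟩ : ∃ c, c = cfc (fun s : ℝ => max (s - δ) 0) b := ⟨_, rfl⟩
  have c0 : 0 ≤ c := hc ▸ cfc_nonneg fun s _ => le_max_right _ _
  have cb : c ≤ b := by
    rw [hc]; conv_rhs => rw [← fc_id bsa]
    exact cfc_mono (fun s hs => by have := (spectrum_01 b0 b1 hs).1; exact max_le (by linarith) this) (by fun_prop) (by fun_prop)
  have cge : b - δ • (1 : A) ≤ c := by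
    have e : b - δ • (1:A) = cfc (fun s : ℝ => s - δ) b := by
      rw [cfc_sub (fun s : ℝ => s) (fun _ => δ) b (by fun_prop) (by fun_prop), fc_id bsa, cfc_const δ b, Algebra.algebraMap_eq_smul_one]
    rw [e, hc]
    exact cfc_mono (fun s hs => le_max_left _ _) (by fun_prop) (by fun_prop)
  obtain ⟨q, pq, ⟨s, s0, hqs⟩, htr⟩ := Lpp hs hw hfd c0 (cb.trans b1) hδ
  have csa := IsSelfAdjoint.of_nonneg c0
  obtain ⟨ψ, hψ⟩ : ∃ ψ, ψ = cfc (phi s) c := ⟨_, rfl⟩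
  have hψ' : ψ = cfc (fun r : ℝ => phi s (max (r - δ) 0)) b := by
    rw [hψ, hc]
    exact (cfc_comp' (phi s) (fun r : ℝ => max (r - δ) 0) b (phi_cont s).continuousOn cf.continuousOn bsa).symm
  have cψ : Continuous fun r : ℝ => phi s (max (r - δ) 0) := (phi_cont s).comp cf
  rw [← hψ] at hqs
  have ψsa : IsSelfAdjoint ψ := hψ ▸ fc_sa _ _
  have sqψ : ψ * q = q := by
    have := congrArg star hqs
    rwa [star_mul, ψsa.star_eq, proj_star pq] at this
  have h1 : δ • (ψ * ψ) ≤ ψ * b * ψ := by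
    have e1 : ψ * b * ψ = cfc (fun r : ℝ => phi s (max (r - δ) 0) * r * phi s (max (r - δ) 0)) b := by
      rw [hψ']
      conv_lhs => enter [1, 2]; rw [← fc_id bsa]
      rw [fc_mul (e := fun r => phi s (max (r - δ) 0) * r) cψ.continuousOn (by fun_prop) (fun _ _ => rfl)]
      exact fc_mul (cψ.mul continuous_id).continuousOn cψ.continuousOn (fun _ _ => rfl)
    have e2 : δ • (ψ * ψ) = cfc (fun r : ℝ => δ * (phi s (max (r - δ) 0) * phi s (max (r - δ) 0))) b := by
      rw [cfc_const_mul δ (fun r : ℝ => phi s (max (r - δ) 0) * phi s (max (r - δ) 0)) b (cψ.mul cψ).continuousOn, hψ']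
      congr 1
      exact fc_mul cψ.continuousOn cψ.continuousOn (fun _ _ => rfl)
    rw [e1, e2]
    refine cfc_mono (fun r hr => ?_) (continuous_const.mul (cψ.mul cψ)).continuousOn ((cψ.mul continuous_id).mul cψ).continuousOn
    rcases le_total r δ with h | h
    · have : phi s (max (r - δ) 0) = 0 := by
        rw [max_eq_right (by linarith)]; exact phi_eq_zero s0 (by linarith)
      rw [this]; simp
    · nlinarith [mul_self_nonneg (phi s (max (r - δ) 0))]
  have h2 : δ • q ≤ q * b * q := by
    have := conj_sa_le pq.isSelfAdjoint h1
    have e1 : q * (δ • (ψ * ψ)) * q = δ • q := by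
      rw [mul_smul_comm, smul_mul_assoc, show q * (ψ * ψ) * q = (q * ψ) * (ψ * q) by noncomm_ring, hqs, sqψ, proj_sq pq]
    have e2 : q * (ψ * b * ψ) * q = q * b * q := by
      rw [show q * (ψ * b * ψ) * q = (q * ψ) * b * (ψ * q) by noncomm_ring, hqs, sqψ]
    rwa [e1, e2] at this
  refine ⟨q, pq, fun w hw => ?_, fun τ hτ => ?_⟩
  · have := cphi_zero s0 csa (mul_eq_zero_of_le c0 cb hw)
    rw [← hqs, mul_assoc, hψ, this, mul_zero]
  · have T1 := htr τ hτ
    have T2 := hτ.mono cge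
    have T3 := hτ.mono h2
    rw [map_sub, map_smul, smul_eq_mul] at T2
    rw [map_smul, smul_eq_mul] at T3
    have E : τ ((1 - q) * b * (1 - q)) = τ b - τ (q * b * q) := by
      rw [mul_assoc, hτ.tr, mul_assoc, proj_sq pq.one_sub, mul_assoc q, hτ.tr q, mul_assoc, proj_sq pq, mul_sub, mul_one, map_sub]
    rw [E]
    have T4 : τ b ≤ 100 * τ q + 2 * δ * τ 1 := by linarith
    nlinarith

lemma exhaust (hs : IsSimpleCStarAlgebra A) (hw : WeakCRLeOne A) (hfd : ¬ FiniteDimensional ℂ A) {b : A} (b0 : 0 ≤ b) (b1 : b ≤ 1)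
    {δ : ℝ} (hδ : 0 < δ) (hδ1 : δ ≤ 1) : ∃ q : A, IsStarProjection q ∧ (∀ w, b * w = 0 → q * w = 0) ∧
      ∀ τ : A →ₗ[ℝ] ℝ, IsTr τ → τ ((1 - q) * b * (1 - q)) ≤ 3 * δ * τ 1 := by
  have key : ∀ n : ℕ, ∃ q : A, IsStarProjection q ∧ (∀ w, b * w = 0 → q * w = 0) ∧
      ∀ τ : A →ₗ[ℝ] ℝ, IsTr τ → τ ((1 - q) * b * (1 - q)) - 2 * δ * τ 1 ≤ (1 - δ / 100) ^ n * τ 1 := by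
    intro n
    induction n with
    | zero =>
      refine ⟨0, IsStarProjection.zero A, fun w _ => zero_mul w, fun τ hτ => ?_⟩
      have := hτ.mono b1
      have := mul_nonneg hδ.le hτ.one_nonneg
      simp
      linarith
    | succ n ih =>
      obtain ⟨q, pq, hq, htr⟩ := ih
      have pu := pq.one_sub
      obtain ⟨q', pq', hq', htr'⟩ := exh_step hs hw hfd (conj_sa_nonneg pu.isSelfAdjoint b0)
        (conj_le_one pu.nonneg pu.le_one b0 b1) hδ
      have q'q : q' * q = 0 := hq' q (by rw [mul_assoc, show (1 - q) * q = 0 by rw [sub_mul, one_mul, proj_sq pq, sub_self], mul_zero])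
      have qq' := cs pq'.isSelfAdjoint pq.isSelfAdjoint q'q
      refine ⟨q + q', ⟨?_, pq.isSelfAdjoint.add pq'.isSelfAdjoint⟩, fun w hbw => ?_, fun τ hτ => ?_⟩
      · change (q + q') * (q + q') = q + q'
        rw [add_mul, mul_add, mul_add, qq', q'q, proj_sq pq, proj_sq pq']; simp
      · have e1 := hq w hbw
        rw [add_mul, e1, zero_add]
        apply hq'
        rw [mul_assoc, show (1 - q) * w = w by rw [sub_mul, e1, one_mul, sub_zero], mul_assoc, hbw, mul_zero]
      · have T1 := htr τ hτ
        have T2 := htr' τ hτ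
        have e1 : (1 - q') * ((1 - q) * b * (1 - q)) * (1 - q') = (1 - (q + q')) * b * (1 - (q + q')) := by
          have a1 : (1 - q') * (1 - q) = 1 - (q + q') := by
            rw [sub_mul, one_mul, mul_sub, mul_one, q'q]; abel
          have a2 : (1 - q) * (1 - q') = 1 - (q + q') := by
            rw [sub_mul, one_mul, mul_sub, mul_one, qq']; abel
          rw [show (1 - q') * ((1 - q) * b * (1 - q)) * (1 - q') = ((1 - q') * (1 - q)) * b * ((1 - q) * (1 - q')) by noncomm_ring, a1, a2]
        rw [e1] at T2
        have := mul_le_mul_of_nonneg_left T1 (show (0:ℝ) ≤ 1 - δ / 100 by linarith)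
        rw [pow_succ]
        linarith
  obtain ⟨n, hn⟩ := exists_pow_lt_of_lt_one hδ (show 1 - δ / 100 < 1 by linarith)
  obtain ⟨q, pq, hq, htr⟩ := key n
  refine ⟨q, pq, hq, fun τ hτ => ?_⟩
  have := htr τ hτ
  have := mul_le_mul_of_nonneg_right hn.le hτ.one_nonneg
  linarith

end Part16
end PartFile16

section PartFile17
set_option linter.unusedSectionVars false
set_option linter.unusedVariables false
open Filter Topology

section Part17
variable {A : Type u} [CStarAlgebra A] [PartialOrder A] [StarOrderedRing A]
variable {I : Type*}

/-- algebraic core: from `v` with `r v = 0`, `v r = v` build a projection absorbing `v`. -/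
lemma absorb_core {r v : A} (pr : IsStarProjection r) (hrv : r * v = 0) (hvr : v * r = v) {η : ℝ} (hη : 0 < η) :
    ∃ R : A, IsStarProjection R ∧ (∀ w, r * w = 0 → star v * w = 0 → R * w = 0) ∧ ‖(1 - R) * (v * star v) * (1 - R)‖ ≤ η := by
  obtain ⟨m, hm⟩ : ∃ m, m = star v * v := ⟨_, rfl⟩
  have m0 : 0 ≤ m := hm ▸ star_mul_self_nonneg v
  have msa := IsSelfAdjoint.of_nonneg m0
  have mspec : ∀ s ∈ spectrum ℝ m, 0 ≤ s := fun s hs => spectrum_nonneg_of_nonneg m0 hs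
  have hrv' : r * star v = star v := by
    have := congrArg star hvr
    rwa [star_mul, proj_star pr] at this
  have mr : m * r = m := by rw [hm, mul_assoc, hvr]
  have rm : r * m = m := by rw [hm, ← mul_assoc, hrv']
  have comm : ∀ f : ℝ → ℝ, r * cfc f m = cfc f m * r := fun f => by
    have : Commute m r := by rw [commute_iff_eq, mr, rm]
    exact ((this.cfc_real f).eq).symm
  have mx : ∀ s : ℝ, 0 < max s η := fun s => lt_max_of_lt_right hη
  obtain ⟨ρ, hρ⟩ : ∃ ρ : ℝ → ℝ, ρ = fun s => (Real.sqrt (max s η))⁻¹ := ⟨_, rfl⟩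
  have cρ : Continuous ρ := by
    rw [hρ]
    exact Continuous.inv₀ (by fun_prop) fun s => (Real.sqrt_pos.2 (mx s)).ne'
  have ρρ : ∀ s, ρ s * ρ s = (max s η)⁻¹ := fun s => by
    rw [hρ]; simp only; rw [← mul_inv, Real.mul_self_sqrt (mx s).le]
  obtain ⟨g, hg⟩ : ∃ g : ℝ → ℝ, g = fun s => Real.sqrt (1 - s * (max s η)⁻¹) := ⟨_, rfl⟩
  have cinv : Continuous fun s : ℝ => (max s η)⁻¹ := Continuous.inv₀ (by fun_prop) fun s => (mx s).ne'
  have cg : Continuous g := by rw [hg]; fun_prop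
  have gg : ∀ s, g s * g s = 1 - s * (max s η)⁻¹ := fun s => by
    rw [hg]; simp only
    rw [Real.mul_self_sqrt]
    have : s * (max s η)⁻¹ ≤ 1 := by
      rw [← div_eq_mul_inv, div_le_one (mx s)]; exact le_max_left _ _
    linarith
  obtain ⟨X, hX⟩ : ∃ X, X = v * cfc ρ m := ⟨_, rfl⟩
  have sρ : star (cfc ρ m) = cfc ρ m := (fc_sa ρ m).star_eq
  have sg : star (cfc g m) = cfc g m := (fc_sa g m).star_eq
  have XX : star X * X = cfc (fun s => s * (max s η)⁻¹) m := by
    rw [hX, star_mul, sρ, show cfc ρ m * star v * (v * cfc ρ m) = cfc ρ m * (star v * v) * cfc ρ m by noncomm_ring, ← hm]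
    conv_lhs => enter [1, 2]; rw [← fc_id msa]
    rw [fc_mul (e := fun s => ρ s * s) cρ.continuousOn (by fun_prop) (fun _ _ => rfl)]
    refine fc_mul (cρ.mul continuous_id).continuousOn cρ.continuousOn (fun s _ => ?_)
    rw [← ρρ]; ring
  have Xr : X * r = X := by rw [hX, mul_assoc, ← comm, ← mul_assoc, hvr]
  have rX : r * X = 0 := by rw [hX, ← mul_assoc, hrv, zero_mul]
  have sXr : star X * r = 0 := by
    have := congrArg star rX
    rwa [star_mul, proj_star pr, star_zero] at this
  obtain ⟨T, hT⟩ : ∃ T, T = r * cfc g m + X := ⟨_, rfl⟩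
  have sT : star T = cfc g m * r + star X := by rw [hT, star_add, star_mul, sg, proj_star pr]
  have TT : star T * T = r := by
    have e1 : cfc g m * cfc g m = 1 - star X * X := by
      rw [XX, ← fc_one msa, ← cfc_sub (fun _ => (1:ℝ)) (fun s => s * (max s η)⁻¹) m (by fun_prop) (by fun_prop)]
      exact fc_mul cg.continuousOn cg.continuousOn fun s _ => gg s
    rw [sT, hT]
    calc (cfc g m * r + star X) * (r * cfc g m + X)
        = cfc g m * (r * r) * cfc g m + cfc g m * (r * X) + (star X * r) * cfc g m + star X * X := by noncomm_ring
      _ = cfc g m * r * cfc g m + star X * X := by rw [rX, sXr, proj_sq pr]; simp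
      _ = r * (cfc g m * cfc g m) + star X * X := by rw [← comm, mul_assoc]
      _ = r * 1 - (r * star X) * X + star X * X := by rw [e1]; noncomm_ring
      _ = r := by
        have : r * star X = star X := by
          have := congrArg star Xr
          rwa [star_mul, proj_star pr] at this
        rw [this]; simp
  have Tr : T * r = T := by
    rw [hT, add_mul, Xr, mul_assoc, ← comm, ← mul_assoc, proj_sq pr]
  have RT : T * star T * T = T := by rw [mul_assoc, TT, Tr]
  have pR : IsStarProjection (T * star T) := by
    refine ⟨?_, IsSelfAdjoint.mul_star_self T⟩
    change T * star T * (T * star T) = T * star T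
    rw [← mul_assoc, RT]
  refine ⟨T * star T, pR, fun w hrw hvw => ?_, ?_⟩
  · have : star T * w = 0 := by
      rw [sT, add_mul, mul_assoc, hrw, hX, star_mul, mul_assoc, hvw]; simp
    rw [mul_assoc, this, mul_zero]
  · obtain ⟨e, he⟩ : ∃ e : ℝ → ℝ, e = fun s => max (Real.sqrt s - Real.sqrt η) 0 := ⟨_, rfl⟩
    have ce : Continuous e := by rw [he]; fun_prop
    have ge : cfc g m * cfc e m = 0 := by
      rw [fc_mul (e := fun _ => (0:ℝ)) cg.continuousOn ce.continuousOn, cfc_const_zero]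
      intro s hs
      have hs0 := mspec s hs
      rcases le_total s η with h | h
      · have : e s = 0 := by rw [he]; simp only; rw [max_eq_right]; linarith [Real.sqrt_le_sqrt h]
        rw [this, mul_zero]
      · have : g s = 0 := by
          rw [hg]; simp only
          rw [max_eq_left h, mul_inv_cancel₀ (by linarith)]; simp
        rw [this, zero_mul]
    have Te : T * cfc e m = v * cfc (fun s => ρ s * e s) m := by
      rw [hT, add_mul, mul_assoc, ge, mul_zero, zero_add, hX, mul_assoc]
      congr 1
      exact fc_mul cρ.continuousOn ce.continuousOn fun _ _ => rfl
    have k1 : (1 - T * star T) * (v * cfc (fun s => ρ s * e s) m) = 0 := by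
      rw [← Te, ← mul_assoc, sub_mul, one_mul, RT, sub_self, zero_mul]
    obtain ⟨n, hn⟩ : ∃ n : ℝ → ℝ, n = fun s => 1 - ρ s * e s := ⟨_, rfl⟩
    have cn : Continuous n := by rw [hn]; fun_prop
    have k2 : (1 - T * star T) * v = (1 - T * star T) * (v * cfc n m) := by
      have : cfc n m = 1 - cfc (fun s => ρ s * e s) m := by
        rw [hn, cfc_sub (fun _ => (1:ℝ)) (fun s => ρ s * e s) m (by fun_prop) (by fun_prop), fc_one msa]
      rw [this, mul_sub v, mul_one, mul_sub, k1, sub_zero]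
    have k3 : ‖v * cfc n m‖ * ‖v * cfc n m‖ ≤ η := by
      rw [← CStarRing.norm_star_mul_self, star_mul, (fc_sa n m).star_eq,
        show cfc n m * star v * (v * cfc n m) = cfc n m * (star v * v) * cfc n m by noncomm_ring, ← hm]
      have : cfc n m * m * cfc n m = cfc (fun s => n s * s * n s) m := by
        conv_lhs => enter [1, 2]; rw [← fc_id msa]
        rw [fc_mul (e := fun s => n s * s) cn.continuousOn (by fun_prop) (fun _ _ => rfl)]
        exact fc_mul (cn.mul continuous_id).continuousOn cn.continuousOn (fun s _ => rfl)
      rw [this]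
      refine norm_cfc_le hη.le fun s hs => ?_
      have hs0 := mspec s hs
      rw [Real.norm_of_nonneg (by nlinarith [mul_nonneg hs0 (mul_self_nonneg (n s))])]
      rcases le_total s η with h | h
      · have : e s = 0 := by rw [he]; simp only; rw [max_eq_right]; linarith [Real.sqrt_le_sqrt h]
        rw [hn]; simp only; rw [this]; simp; exact h
      · have h1 : e s = Real.sqrt s - Real.sqrt η := by
          rw [he]; simp only; rw [max_eq_left]; linarith [Real.sqrt_le_sqrt h]
        have h2 : ρ s = (Real.sqrt s)⁻¹ := by rw [hρ]; simp only; rw [max_eq_left h]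
        have h3 : 0 < Real.sqrt s := Real.sqrt_pos.2 (by linarith)
        have h4 : n s = (Real.sqrt s)⁻¹ * Real.sqrt η := by
          rw [hn]; simp only; rw [h1, h2]; field_simp; ring
        rw [h4]
        have h5 := Real.mul_self_sqrt hs0
        have h6 := Real.mul_self_sqrt hη.le
        apply le_of_eq
        calc (Real.sqrt s)⁻¹ * Real.sqrt η * s * ((Real.sqrt s)⁻¹ * Real.sqrt η)
            = (Real.sqrt η * Real.sqrt η) * (s * ((Real.sqrt s) * (Real.sqrt s))⁻¹) := by rw [mul_inv]; ring
          _ = η := by rw [h5, h6, mul_inv_cancel₀ (by linarith), mul_one]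
    have k4 : (1 - T * star T) * (v * star v) * (1 - T * star T) = ((1 - T * star T) * v) * star ((1 - T * star T) * v) := by
      rw [star_mul, pR.one_sub.isSelfAdjoint.star_eq]; noncomm_ring
    rw [k4, CStarRing.norm_self_mul_star, k2]
    have k5 : ‖(1 - T * star T) * (v * cfc n m)‖ ≤ ‖v * cfc n m‖ := by
      refine (norm_mul_le _ _).trans ?_
      have := proj_norm_le pR.one_sub
      nlinarith [norm_nonneg (v * cfc n m)]
    nlinarith [norm_nonneg ((1 - T * star T) * (v * cfc n m)), norm_nonneg (v * cfc n m)]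

lemma absorb (hs : IsSimpleCStarAlgebra A) (hw : WeakCRLeOne A) {b r z z' : A} (b0 : 0 ≤ b) (b1 : b ≤ 1)
    (pr : IsStarProjection r) (hbr : b * r = 0)
    (z0 : 0 ≤ z) (z1 : z ≤ 1) (hz : z ≠ 0) (z0' : 0 ≤ z') (z1' : z' ≤ 1) (hz' : z' ≠ 0)
    (hzz : z * z' = 0) (hzr : z * r = z) (hzr' : z' * r = z') {σ η : ℝ} (hσ : 0 < σ) (hη : 0 < η)
    (hgap : ∀ t : A →ₗ[ℝ] ℝ, IsTr t → η⁻¹ * t b + σ * t 1 ≤ t z)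
    (hgap' : ∀ t : A →ₗ[ℝ] ℝ, IsTr t → η⁻¹ * t b + σ * t 1 ≤ t z') :
    ∃ R : A, IsStarProjection R ∧ (∀ w, b * w = 0 → r * w = 0 → R * w = 0) ∧ ‖(1 - R) * b * (1 - R)‖ ≤ 3 * η := by
  have bsa := IsSelfAdjoint.of_nonneg b0
  have bspec : ∀ s ∈ spectrum ℝ b, 0 ≤ s ∧ s ≤ 1 := fun s hs => spectrum_01 b0 b1 hs
  have cx : Continuous fun s : ℝ => max (s - η) 0 := by fun_prop
  have cxb : Continuous fun s : ℝ => min (η⁻¹ * s) 1 := by fun_prop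
  obtain ⟨x, hx⟩ : ∃ x, x = cfc (fun s : ℝ => max (s - η) 0) b := ⟨_, rfl⟩
  obtain ⟨xb, hxb⟩ : ∃ xb, xb = cfc (fun s : ℝ => min (η⁻¹ * s) 1) b := ⟨_, rfl⟩
  have x0 : 0 ≤ x := hx ▸ cfc_nonneg fun s _ => le_max_right _ _
  have x1 : x ≤ 1 := hx ▸ cfc_le_one _ _ fun s hs => max_le (by linarith [(bspec s hs).2]) zero_le_one
  have xb0 : 0 ≤ xb := hxb ▸ cfc_nonneg fun s hs => le_min (mul_nonneg (by positivity) (bspec s hs).1) zero_le_one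
  have xb1 : xb ≤ 1 := hxb ▸ cfc_le_one _ _ fun s hs => min_le_right _ _
  have xxb : x * xb = x := by
    rw [hx, hxb]
    refine fc_mul cx.continuousOn cxb.continuousOn fun s hs => ?_
    rcases le_total s η with h | h
    · rw [max_eq_right (by linarith)]; simp
    · rw [min_eq_right, mul_one]
      rw [← div_eq_inv_mul, one_le_div hη]; exact h
  have xbb : xb ≤ η⁻¹ • b := by
    have : η⁻¹ • b = cfc (fun s : ℝ => η⁻¹ * s) b := by rw [cfc_const_mul η⁻¹ (fun s : ℝ => s) b (by fun_prop), fc_id bsa]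
    rw [this, hxb]
    exact cfc_mono (fun s _ => min_le_left _ _) (by fun_prop) (by fun_prop)
  have bx : ‖x - b‖ ≤ η := by
    have : x - b = cfc (fun s : ℝ => max (s - η) 0 - s) b := by
      rw [cfc_sub (fun s : ℝ => max (s - η) 0) (fun s => s) b (by fun_prop) (by fun_prop), fc_id bsa, hx]
    rw [this]
    refine norm_cfc_le hη.le fun s hs => ?_
    have := bspec s hs
    rw [Real.norm_eq_abs, abs_le]
    rcases le_total s η with h | h
    · rw [max_eq_right (by linarith)]; constructor <;> linarith
    · rw [max_eq_left (by linarith)]; constructor <;> linarith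
  have xbw : ∀ w, b * w = 0 → xb * w = 0 := fun w h =>
    mul_eq_zero_of_le xb0 xbb (by rw [smul_mul_assoc, h, smul_zero])
  have xbt : ∀ t : A →ₗ[ℝ] ℝ, IsTr t → t xb ≤ η⁻¹ * t b := fun t ht => by
    have := ht.mono xbb
    rwa [map_smul, smul_eq_mul] at this
  obtain ⟨y, y', hyy⟩ := comp_lemma hs hw x0 x1 xxb xb0 xb1 z0 z1 hz z0' z1' hz' hzz hσ
    (fun t ht => by linarith [hgap t ht, xbt t ht]) (fun t ht => by linarith [hgap' t ht, xbt t ht]) hη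
  obtain ⟨v, hv⟩ : ∃ v, v = y * z + y' * z' := ⟨_, rfl⟩
  rw [← hv] at hyy
  have xbsa := IsSelfAdjoint.of_nonneg xb0
  have rxb : r * xb = 0 := cs xbsa pr.isSelfAdjoint (xbw r hbr)
  have vr : v * r = v := by rw [hv, add_mul, mul_assoc, mul_assoc, hzr, hzr']
  obtain ⟨R, pR, hR, hn⟩ := absorb_core (r := r) (v := xb * v) pr (by rw [← mul_assoc, rxb, zero_mul]) (by rw [mul_assoc, vr]) hη
  refine ⟨R, pR, fun w hbw hrw => hR w hrw (by rw [star_mul, xbsa.star_eq, mul_assoc, xbw w hbw, mul_zero]), ?_⟩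
  have xbx : xb * x = x := by
    have := congrArg star xxb
    rwa [star_mul, xbsa.star_eq, (IsSelfAdjoint.of_nonneg x0).star_eq] at this
  have nxb := norm_le_one_of xb0 xb1
  have e1 : xb * v * star (xb * v) - x = xb * (v * star v - x) * xb := by
    rw [star_mul, xbsa.star_eq, mul_sub, sub_mul, xbx, xxb]; noncomm_ring
  have n1 : ‖xb * v * star (xb * v) - x‖ ≤ η := by
    rw [e1]
    calc ‖xb * (v * star v - x) * xb‖ ≤ ‖xb‖ * ‖v * star v - x‖ * ‖xb‖ := (norm_mul_le _ _).trans (by gcongr; exact norm_mul_le _ _)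
      _ ≤ 1 * η * 1 := by gcongr
      _ = η := by ring
  have e2 : (1 - R) * b * (1 - R) = (1 - R) * (xb * v * star (xb * v)) * (1 - R) -
      (1 - R) * ((xb * v * star (xb * v) - x) + (x - b)) * (1 - R) := by
    generalize xb * v * star (xb * v) = V
    noncomm_ring
  have n2 : ‖(1 - R) * ((xb * v * star (xb * v) - x) + (x - b)) * (1 - R)‖ ≤ 2 * η := by
    have hp := proj_norm_le pR.one_sub
    calc _ ≤ ‖1 - R‖ * ‖(xb * v * star (xb * v) - x) + (x - b)‖ * ‖1 - R‖ := (norm_mul_le _ _).trans (by gcongr; exact norm_mul_le _ _)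
      _ ≤ 1 * (η + η) * 1 := by
        gcongr
        exact (norm_add_le _ _).trans (add_le_add n1 bx)
      _ = 2 * η := by ring
  rw [e2]
  refine (norm_sub_le _ _).trans ?_
  linarith

end Part17
end PartFile17

section PartFile18
set_option linter.unusedSectionVars false
set_option linter.unusedVariables false
open Filter Topology

section Part18
variable {A : Type u} [CStarAlgebra A] [PartialOrder A] [StarOrderedRing A]
variable {I : Type*}

lemma norm_cut {b Q : A} (b0 : 0 ≤ b) (b1 : b ≤ 1) (pQ : IsStarProjection Q) {c : ℝ} (hc : 0 ≤ c)
    (h : ‖(1 - Q) * b * (1 - Q)‖ ≤ c ^ 2) : ‖b - Q * b * Q‖ ≤ 2 * c := by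
  have hww := CFC.sqrt_mul_sqrt_self b
  have wsa := IsSelfAdjoint.of_nonneg (CFC.sqrt_nonneg b)
  generalize CFC.sqrt b = w at *
  have nb := norm_le_one_of b0 b1
  have nw : ‖w‖ ≤ 1 := by
    have : ‖star w * w‖ = ‖w‖ * ‖w‖ := CStarRing.norm_star_mul_self
    rw [wsa.star_eq, hww] at this
    by_contra hcon
    push Not at hcon
    nlinarith
  have n1 : ‖w * (1 - Q)‖ ≤ c := by
    have e : ‖star (w * (1 - Q)) * (w * (1 - Q))‖ = ‖w * (1 - Q)‖ * ‖w * (1 - Q)‖ := CStarRing.norm_star_mul_self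
    rw [star_mul, wsa.star_eq, pQ.one_sub.isSelfAdjoint.star_eq,
      show (1 - Q) * w * (w * (1 - Q)) = (1 - Q) * (w * w) * (1 - Q) by noncomm_ring, hww] at e
    rw [e] at h
    by_contra hcon
    push Not at hcon
    nlinarith
  have n2 : ‖(1 - Q) * w‖ ≤ c := by
    rw [← norm_star, star_mul, wsa.star_eq, pQ.one_sub.isSelfAdjoint.star_eq]; exact n1
  have e : b - Q * b * Q = w * (w * (1 - Q)) + ((1 - Q) * w) * (w * Q) := by
    rw [← hww]; noncomm_ring
  have nQ := proj_norm_le pQ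
  rw [e]
  calc _ ≤ ‖w‖ * ‖w * (1 - Q)‖ + ‖(1 - Q) * w‖ * (‖w‖ * ‖Q‖) := by
        refine (norm_add_le _ _).trans (add_le_add (norm_mul_le _ _) ((norm_mul_le _ _).trans ?_))
        gcongr
        exact norm_mul_le _ _
    _ ≤ 1 * c + c * (1 * 1) := by gcongr
    _ = 2 * c := by ring

lemma inv_near (hs : IsSimpleCStarAlgebra A) (hw : WeakCRLeOne A) (hfd : ¬ FiniteDimensional ℂ A) {a : A} (asa : IsSelfAdjoint a)
    (ha : ‖a‖ ≤ 1) {δ : ℝ} (hδ : 0 < δ) : ∃ a' : A, IsSelfAdjoint a' ∧ IsUnit a' ∧ ‖a - a'‖ ≤ 4 * δ := by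
  have aspec : ∀ s ∈ spectrum ℝ a, s ≤ 1 := fun s hs => by
    have h1 : a ≤ algebraMap ℝ A 1 := by rw [Algebra.algebraMap_eq_smul_one]; exact le_smul_one asa ha
    have h2 : algebraMap ℝ A (-1) ≤ a := by
      rw [Algebra.algebraMap_eq_smul_one, neg_smul]; exact neg_smul_one_le asa ha
    exact (spectrum_Icc h2 h1 asa hs).2
  have cy : Continuous fun s : ℝ => max (min s (δ - s)) 0 := by fun_prop
  have cb : Continuous fun s : ℝ => max (s - δ) 0 := by fun_prop
  have cm : Continuous fun s : ℝ => max (-s) 0 := by fun_prop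
  obtain ⟨y, hy⟩ : ∃ y, y = cfc (fun s : ℝ => max (min s (δ - s)) 0) a := ⟨_, rfl⟩
  obtain ⟨b, hb⟩ : ∃ b, b = cfc (fun s : ℝ => max (s - δ) 0) a := ⟨_, rfl⟩
  obtain ⟨n, hn⟩ : ∃ n, n = cfc (fun s : ℝ => max (-s) 0) a := ⟨_, rfl⟩
  have y0 : 0 ≤ y := hy ▸ cfc_nonneg fun s _ => le_max_right _ _
  have b0 : 0 ≤ b := hb ▸ cfc_nonneg fun s _ => le_max_right _ _
  have n0 : 0 ≤ n := hn ▸ cfc_nonneg fun s _ => le_max_right _ _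
  have b1 : b ≤ 1 := hb ▸ cfc_le_one _ _ fun s hs => max_le (by linarith [aspec s hs]) zero_le_one
  by_cases yn : y = 0
  · refine ⟨a - (δ / 2) • (1 : A), asa.sub ((IsSelfAdjoint.all _).smul (IsSelfAdjoint.one A)), ?_, ?_⟩
    · have h1 : δ / 2 ∉ spectrum ℝ a := by
        intro hmem
        refine cfc_ne_zero asa cy hmem ?_ (hy ▸ yn)
        have : min (δ / 2) (δ - δ / 2) = δ / 2 := by rw [min_eq_left]; linarith
        rw [this, max_eq_left (by positivity)]; positivity
      rw [spectrum.notMem_iff, Algebra.algebraMap_eq_smul_one] at h1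
      have := h1.neg
      rwa [neg_sub] at this
    · rw [sub_sub_cancel]
      have h1 : ‖(1 : A)‖ ≤ 1 := proj_norm_le (IsStarProjection.one A)
      rw [norm_smul, Real.norm_of_nonneg (by positivity)]
      nlinarith
  obtain ⟨r, pr, rn, hr⟩ := SP hw y0 yn
  have yb : y * b = 0 := by
    rw [hy, hb, fc_mul (e := fun _ => (0:ℝ)) cy.continuousOn cb.continuousOn, cfc_const_zero]
    intro s _
    rcases le_total s δ with h | h
    · rw [max_eq_right (a := s - δ) (by linarith), mul_zero]
    · rw [max_eq_right (a := min s (δ - s)) ((min_le_right _ _).trans (by linarith)), zero_mul]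
  have yn' : y * n = 0 := by
    rw [hy, hn, fc_mul (e := fun _ => (0:ℝ)) cy.continuousOn cm.continuousOn, cfc_const_zero]
    intro s _
    rcases le_total 0 s with h | h
    · rw [max_eq_right (a := -s) (by linarith), mul_zero]
    · rw [max_eq_right (a := min s (δ - s)) ((min_le_left _ _).trans h), zero_mul]
  have bn : b * n = 0 := by
    rw [hb, hn, fc_mul (e := fun _ => (0:ℝ)) cb.continuousOn cm.continuousOn, cfc_const_zero]
    intro s _
    rcases le_total 0 s with h | h
    · rw [max_eq_right (a := -s) (by linarith), mul_zero]
    · rw [max_eq_right (a := s - δ) (by linarith), zero_mul]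
  have rb := hr b yb
  have rn' := hr n yn'
  have bsa := IsSelfAdjoint.of_nonneg b0
  have nsa := IsSelfAdjoint.of_nonneg n0
  have br := cs pr.isSelfAdjoint bsa rb
  obtain ⟨z, z', z0, z0', zn, zn', zz, hzz⟩ := split_or_fd hs hfd pr.nonneg rn
  have zle : z ≤ r := (le_add_of_nonneg_right z0').trans hzz
  have zle' : z' ≤ r := (le_add_of_nonneg_left z0).trans hzz
  have r1r : r * (1 - r) = 0 := by rw [mul_sub, mul_one, proj_sq pr, sub_self]
  have zr : z * r = z := by
    have := mul_eq_zero_of_le z0 zle r1r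
    rw [mul_sub, mul_one, sub_eq_zero] at this; exact this.symm
  have zr' : z' * r = z' := by
    have := mul_eq_zero_of_le z0' zle' r1r
    rw [mul_sub, mul_one, sub_eq_zero] at this; exact this.symm
  obtain ⟨κ, κ0, hκ⟩ := simple_tr_lower hs z0 zn
  obtain ⟨κ', κ0', hκ'⟩ := simple_tr_lower hs z0' zn'
  obtain ⟨κ₁, hκ₁⟩ : ∃ κ₁, κ₁ = min κ κ' := ⟨_, rfl⟩
  have κ₁0 : 0 < κ₁ := by rw [hκ₁]; positivity
  have κ₁le : κ₁ ≤ κ := hκ₁ ▸ min_le_left _ _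
  have κ₁le' : κ₁ ≤ κ' := hκ₁ ▸ min_le_right _ _
  obtain ⟨η, hη⟩ : ∃ η, η = δ ^ 2 / 12 := ⟨_, rfl⟩
  have η0 : 0 < η := by rw [hη]; positivity
  obtain ⟨q, pq, hq, hqt⟩ := exhaust hs hw hfd b0 b1 (δ := min 1 (κ₁ * η / 6)) (by positivity) (min_le_left _ _)
  have pu := pq.one_sub
  have qr := hq r br
  have qn := hq n bn
  obtain ⟨b', hb'⟩ : ∃ b', b' = (1 - q) * b * (1 - q) := ⟨_, rfl⟩
  have b'0 : 0 ≤ b' := hb' ▸ conj_sa_nonneg pu.isSelfAdjoint b0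
  have b'1 : b' ≤ 1 := hb' ▸ conj_le_one pu.nonneg pu.le_one b0 b1
  have b'w : ∀ w, q * w = 0 → b * w = 0 → b' * w = 0 := fun w h1 h2 => by
    rw [hb', mul_assoc, show (1 - q) * w = w by rw [sub_mul, one_mul, h1, sub_zero], mul_assoc, h2, mul_zero]
  have b'q : b' * q = 0 := by
    rw [hb', mul_assoc, show (1 - q) * q = 0 by rw [sub_mul, one_mul, proj_sq pq, sub_self], mul_zero]
  have rq := cs pq.isSelfAdjoint pr.isSelfAdjoint qr
  have gap : ∀ t : A →ₗ[ℝ] ℝ, IsTr t → η⁻¹ * t b' + κ₁ / 2 * t 1 ≤ κ₁ * t 1 := fun t ht => by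
    have h1 := hqt t ht
    rw [← hb'] at h1
    have h2 := mul_le_mul_of_nonneg_right (min_le_right 1 (κ₁ * η / 6)) ht.one_nonneg
    have h3 : t b' ≤ η * (κ₁ / 2 * t 1) := by linarith
    have h4 := mul_le_mul_of_nonneg_left h3 (inv_nonneg.2 η0.le)
    rw [← mul_assoc, inv_mul_cancel₀ η0.ne', one_mul] at h4
    linarith
  obtain ⟨R, pR, hR, hRn⟩ := absorb hs hw b'0 b'1 pr (b'w r qr br) z0 (zle.trans pr.le_one) zn z0' (zle'.trans pr.le_one) zn' zz zr zr'
    (σ := κ₁ / 2) (η := η) (by positivity) η0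
    (fun t ht => (gap t ht).trans ((mul_le_mul_of_nonneg_right κ₁le ht.one_nonneg).trans (hκ t ht)))
    (fun t ht => (gap t ht).trans ((mul_le_mul_of_nonneg_right κ₁le' ht.one_nonneg).trans (hκ' t ht)))
  have Rq : R * q = 0 := hR q b'q rq
  have qR := cs pR.isSelfAdjoint pq.isSelfAdjoint Rq
  have Rn : R * n = 0 := hR n (b'w n qn bn) rn'
  obtain ⟨Q, hQ⟩ : ∃ Q, Q = q + R := ⟨_, rfl⟩
  have pQ : IsStarProjection Q := by
    refine ⟨?_, hQ ▸ pq.isSelfAdjoint.add pR.isSelfAdjoint⟩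
    change Q * Q = Q
    rw [hQ, add_mul, mul_add, mul_add, qR, Rq, proj_sq pq, proj_sq pR]; simp
  have Qn : Q * n = 0 := by rw [hQ, add_mul, qn, Rn, add_zero]
  have cut : ‖(1 - Q) * b * (1 - Q)‖ ≤ (δ / 2) ^ 2 := by
    have a1 : (1 - R) * (1 - q) = 1 - Q := by rw [hQ, sub_mul, one_mul, mul_sub, mul_one, Rq]; abel
    have a2 : (1 - q) * (1 - R) = 1 - Q := by rw [hQ, sub_mul, one_mul, mul_sub, mul_one, qR]; abel
    have e : (1 - R) * b' * (1 - R) = (1 - Q) * b * (1 - Q) := by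
      rw [hb', show (1 - R) * ((1 - q) * b * (1 - q)) * (1 - R) = ((1 - R) * (1 - q)) * b * ((1 - q) * (1 - R)) by noncomm_ring, a1, a2]
    rw [e] at hRn
    refine hRn.trans (le_of_eq ?_)
    rw [hη]; ring
  have cut2 := norm_cut b0 b1 pQ (by positivity) cut
  have QbQ0 := conj_sa_nonneg pQ.isSelfAdjoint b0
  obtain ⟨V, hV⟩ : ∃ V, V = Q - (1 - Q) := ⟨_, rfl⟩
  have Vsa : IsSelfAdjoint V := hV ▸ pQ.isSelfAdjoint.sub pQ.one_sub.isSelfAdjoint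
  have QQ := proj_sq pQ
  have VV : V * V = 1 := by
    rw [hV]
    calc (Q - (1 - Q)) * (Q - (1 - Q)) = 4 • (Q * Q) - 4 • Q + 1 := by noncomm_ring
      _ = 1 := by rw [QQ]; simp
  have VQ : V * Q = Q := by
    rw [hV, sub_mul, sub_mul, one_mul, QQ]; simp
  have Vn : V * n = - n := by
    rw [hV, sub_mul, sub_mul, one_mul, Qn]; simp
  refine ⟨Q * b * Q - n + δ • V, ?_, ?_, ?_⟩
  · exact ((IsSelfAdjoint.of_nonneg QbQ0).sub nsa).add ((IsSelfAdjoint.all _).smul Vsa)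
  · have e : V * (Q * b * Q - n + δ • V) = Q * b * Q + n + δ • (1 : A) := by
      rw [mul_add, mul_sub, mul_smul_comm, VV, Vn, mul_assoc, ← mul_assoc V, VQ, sub_neg_eq_add]
    have hu : IsUnit (V * (Q * b * Q - n + δ • V)) := by
      rw [e]
      exact isUnit_of_ge hδ (le_add_of_nonneg_left (add_nonneg QbQ0 n0))
    have hVu : IsUnit V := ⟨⟨V, V, VV, VV⟩, rfl⟩
    have := hVu.mul hu
    rwa [← mul_assoc, VV, one_mul] at this
  · have nd : ‖a - (b - n)‖ ≤ δ := by
      have e : a - (b - n) = cfc (fun s : ℝ => s - (max (s - δ) 0 - max (-s) 0)) a := by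
        rw [cfc_sub (fun s : ℝ => s) (fun s : ℝ => max (s - δ) 0 - max (-s) 0) a (by fun_prop) (by fun_prop),
          cfc_sub (fun s : ℝ => max (s - δ) 0) (fun s : ℝ => max (-s) 0) a (by fun_prop) (by fun_prop), fc_id asa, hb, hn]
      rw [e]
      refine norm_cfc_le hδ.le fun s _ => ?_
      rw [Real.norm_eq_abs, abs_le]
      rcases le_total 0 s with h | h
      · rw [max_eq_right (a := -s) (by linarith)]
        rcases le_total s δ with h' | h'
        · rw [max_eq_right (by linarith)]; constructor <;> linarith
        · rw [max_eq_left (by linarith)]; constructor <;> linarith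
      · rw [max_eq_left (a := -s) (by linarith), max_eq_right (by linarith)]; constructor <;> linarith
    have nV : ‖δ • V‖ ≤ 2 * δ := by
      rw [norm_smul, Real.norm_of_nonneg hδ.le, hV]
      have h1 := norm_sub_le Q (1 - Q)
      have h2 := proj_norm_le pQ
      have h3 := proj_norm_le pQ.one_sub
      nlinarith
    have e : a - (Q * b * Q - n + δ • V) = (a - (b - n)) + (b - Q * b * Q) - δ • V := by abel
    rw [e]
    refine (norm_sub_le _ _).trans ?_
    have := norm_add_le (a - (b - n)) (b - Q * b * Q)
    linarith

lemma inv_dense (hs : IsSimpleCStarAlgebra A) (hw : WeakCRLeOne A) (hfd : ¬ FiniteDimensional ℂ A) {a : A} (asa : IsSelfAdjoint a)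
    {ε : ℝ} (hε : 0 < ε) : ∃ a' : A, IsSelfAdjoint a' ∧ IsUnit a' ∧ ‖a - a'‖ < ε := by
  obtain ⟨N, hN⟩ : ∃ N, N = ‖a‖ + 1 := ⟨_, rfl⟩
  have N0 : 0 < N := by rw [hN]; positivity
  obtain ⟨a', h1, h2, h3⟩ := inv_near hs hw hfd (a := N⁻¹ • a) ((IsSelfAdjoint.all _).smul asa) (by
    rw [norm_smul, Real.norm_of_nonneg (by positivity), inv_mul_le_iff₀ N0, hN]; linarith) (δ := ε / (8 * N)) (by positivity)
  refine ⟨N • a', (IsSelfAdjoint.all _).smul h1, ?_, ?_⟩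
  · exact (h2.smul (Units.mk0 N N0.ne'))
  · have e : a - N • a' = N • (N⁻¹ • a - a') := by rw [smul_sub, smul_smul, mul_inv_cancel₀ N0.ne', one_smul]
    rw [e, norm_smul, Real.norm_of_nonneg N0.le]
    calc N * ‖N⁻¹ • a - a'‖ ≤ N * (4 * (ε / (8 * N))) := by gcongr
      _ = ε / 2 := by field_simp; norm_num
      _ < ε := by linarith

lemma avoid_finset (hs : IsSimpleCStarAlgebra A) (hw : WeakCRLeOne A) (hfd : ¬ FiniteDimensional ℂ A) (S : Finset ℝ) :
    ∀ {a : A}, IsSelfAdjoint a → ∀ {ε : ℝ}, 0 < ε → ∃ a' : A, IsSelfAdjoint a' ∧ ‖a - a'‖ < ε ∧ ∀ s ∈ S, IsUnit (a' - s • (1 : A)) := by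
  classical
  induction S using Finset.induction_on with
  | empty => intro a asa ε hε; exact ⟨a, asa, by simpa using hε, by simp⟩
  | insert l S hl ih =>
    intro a asa ε hε
    obtain ⟨a', h1, h2, h3⟩ := ih asa (half_pos hε)
    have hopen : ∀ s ∈ S, ∀ᶠ x in 𝓝 a', IsUnit (x - s • (1 : A)) := fun s hs' => by
      have hc : Continuous fun x : A => x - s • (1 : A) := by fun_prop
      exact hc.continuousAt.eventually (Units.isOpen.mem_nhds (h3 s hs'))
    have hall := (Filter.eventually_all_finset S).2 hopen
    obtain ⟨ε', e0, he⟩ := Metric.eventually_nhds_iff.1 hall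
    obtain ⟨c, c1, c2, c3⟩ := inv_dense hs hw hfd (a := a' - l • (1 : A)) (h1.sub ((IsSelfAdjoint.all _).smul (IsSelfAdjoint.one A)))
      (ε := min ε' (ε / 2)) (by positivity)
    have e1 : a' - (c + l • (1 : A)) = a' - l • (1 : A) - c := by abel
    refine ⟨c + l • (1 : A), c1.add ((IsSelfAdjoint.all _).smul (IsSelfAdjoint.one A)), ?_, ?_⟩
    · calc ‖a - (c + l • (1 : A))‖ = ‖(a - a') + (a' - (c + l • (1 : A)))‖ := by congr 1; abel
        _ ≤ ‖a - a'‖ + ‖a' - (c + l • (1 : A))‖ := norm_add_le _ _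
        _ < ε / 2 + ε / 2 := add_lt_add h2 (by rw [e1]; exact c3.trans_le (min_le_right _ _))
        _ = ε := by ring
    · intro s hs'
      rcases Finset.mem_insert.1 hs' with h | h
      · rw [h, add_sub_cancel_right]; exact c2
      · refine he (y := c + l • (1 : A)) ?_ s h
        rw [dist_comm, dist_eq_norm, e1]; exact c3.trans_le (min_le_left _ _)

lemma rr0_aux (hs : IsSimpleCStarAlgebra A) (hw : WeakCRLeOne A) : RealRankZero A := by
  intro a asa ε hε
  by_cases hfd : FiniteDimensional ℂ A
  · refine ⟨a, asa, ?_, by simpa using hε⟩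
    have : FiniteDimensional ℂ (⊤ : NonUnitalStarSubalgebra ℂ A) :=
      FiniteDimensional.finiteDimensional_submodule (⊤ : NonUnitalStarSubalgebra ℂ A).toSubmodule
    exact fd_finite_spectrum (⊤ : NonUnitalStarSubalgebra ℂ A) (by simp)
  obtain ⟨d, hd⟩ : ∃ d, d = ε / 2 := ⟨_, rfl⟩
  have d0 : 0 < d := by rw [hd]; positivity
  obtain ⟨N, hN⟩ := exists_nat_gt ((‖a‖ + d + 1) / d)
  rw [div_lt_iff₀ d0] at hN
  obtain ⟨c, csa, hac, hc⟩ := avoid_finset hs hw hfd ((Finset.Icc (-(N:ℤ)) N).image fun k : ℤ => (k : ℝ) * d) asa d0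
  have cn : ‖c‖ < N * d := by
    have : ‖c‖ ≤ ‖a‖ + ‖a - c‖ := by
      calc ‖c‖ = ‖a - (a - c)‖ := by congr 1; abel
        _ ≤ _ := norm_sub_le _ _
    linarith
  have sp : ∀ s ∈ spectrum ℝ c, -(N * d) < s ∧ s < N * d := fun s hs => by
    have h1 : c ≤ algebraMap ℝ A ‖c‖ := by rw [Algebra.algebraMap_eq_smul_one]; exact le_smul_one csa le_rfl
    have h2 : algebraMap ℝ A (-‖c‖) ≤ c := by
      rw [Algebra.algebraMap_eq_smul_one, neg_smul]; exact neg_smul_one_le csa le_rfl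
    have := spectrum_Icc h2 h1 csa hs
    exact ⟨by linarith [this.1], by linarith [this.2]⟩
  have flb : ∀ s ∈ spectrum ℝ c, ⌊s / d⌋ ∈ Finset.Icc (-(N:ℤ)) N := fun s hs => by
    obtain ⟨h1, h2⟩ := sp s hs
    rw [Finset.mem_Icc]
    constructor
    · rw [Int.le_floor, le_div_iff₀ d0]; push_cast; linarith
    · have : ⌊s / d⌋ < (N : ℤ) := by rw [Int.floor_lt, div_lt_iff₀ d0]; push_cast; linarith
      exact this.le
  have cont : ContinuousOn (fun s : ℝ => (⌊s / d⌋ : ℝ) * d) (spectrum ℝ c) := by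
    intro s hs
    apply ContinuousAt.continuousWithinAt
    have hne : (⌊s / d⌋ : ℝ) * d ≠ s := by
      intro h
      have h1 := hc _ (Finset.mem_image.2 ⟨_, flb s hs, rfl⟩)
      rw [h] at h1
      have h2 := h1.neg
      rw [neg_sub, ← Algebra.algebraMap_eq_smul_one] at h2
      exact hs h2
    have h1 : (⌊s / d⌋ : ℝ) < s / d := by
      refine lt_of_le_of_ne (Int.floor_le _) fun h => hne ?_
      rw [h, div_mul_cancel₀ _ d0.ne']
    have h2 := Int.lt_floor_add_one (s / d)
    have hev : ∀ᶠ x in 𝓝 s, (⌊x / d⌋ : ℝ) * d = (⌊s / d⌋ : ℝ) * d := by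
      have hcd : ContinuousAt (fun x : ℝ => x / d) s := by fun_prop
      filter_upwards [hcd.eventually (Ioo_mem_nhds h1 h2)] with x hx
      have : ⌊x / d⌋ = ⌊s / d⌋ := Int.floor_eq_iff.2 ⟨hx.1.le, hx.2⟩
      rw [this]
    exact (continuousAt_const).congr (hev.mono fun x hx => hx.symm)
  refine ⟨cfc (fun s : ℝ => (⌊s / d⌋ : ℝ) * d) c, fc_sa _ _, ?_, ?_⟩
  · rw [cfc_map_spectrum (fun s : ℝ => (⌊s / d⌋ : ℝ) * d) c csa cont]
    refine Set.Finite.subset (((Finset.Icc (-(N:ℤ)) N).finite_toSet).image fun k : ℤ => (k : ℝ) * d) ?_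
    rintro _ ⟨s, hs, rfl⟩
    exact ⟨_, flb s hs, rfl⟩
  · have e : c - cfc (fun s : ℝ => (⌊s / d⌋ : ℝ) * d) c = cfc (fun s : ℝ => s - (⌊s / d⌋ : ℝ) * d) c := by
      rw [cfc_sub (fun s : ℝ => s) (fun s : ℝ => (⌊s / d⌋ : ℝ) * d) c (by fun_prop) cont, fc_id csa]
    have n1 : ‖c - cfc (fun s : ℝ => (⌊s / d⌋ : ℝ) * d) c‖ ≤ d := by
      rw [e]
      refine norm_cfc_le d0.le fun s _ => ?_
      have h1 := Int.floor_le (s / d)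
      have h2 := (Int.lt_floor_add_one (s / d)).le
      rw [le_div_iff₀ d0] at h1
      rw [div_le_iff₀ d0] at h2
      rw [Real.norm_eq_abs, abs_le]
      constructor <;> linarith
    calc ‖a - cfc (fun s : ℝ => (⌊s / d⌋ : ℝ) * d) c‖ = ‖(a - c) + (c - cfc (fun s : ℝ => (⌊s / d⌋ : ℝ) * d) c)‖ := by congr 1; abel
      _ ≤ ‖a - c‖ + ‖c - cfc (fun s : ℝ => (⌊s / d⌋ : ℝ) * d) c‖ := norm_add_le _ _
      _ < d + d := add_lt_add_of_lt_of_le hac n1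
      _ = ε := by rw [hd]; ring

end Part18
end PartFile18

/-- Proposition 3.9 of the paper.  Let `A` be a simple, separable, unital
C*-algebra with weak complexity rank at most one.  Then `A` has real rank zero. -/
theorem realRankZero_of_simple_weakCRLeOne
    (A : Type u) [CStarAlgebra A] [TopologicalSpace.SeparableSpace A]
    (hsimple : IsSimpleCStarAlgebra A) (hwcr : WeakCRLeOne A) :
    RealRankZero A := by
  letI := CStarAlgebra.spectralOrder A
  haveI := CStarAlgebra.spectralOrderedRing A
  exact rr0_aux hsimple hwcr
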